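/- Let h(T) := − Σ_{ρ} Re ρ, where the sum runs over the zeros ρ of Riemann's auxiliary function R with 0 < Im ρ ≤ T, counted with multiplicity. Then h(T) = (T/4π) log 2 + o(T) as T → +∞; that is, for every ε > 0 there exists T₀ such that for all T ≥ T₀, |h(T) − (T/4π) log 2| ≤ ε T. -/

import Mathlib

open MeasureTheory

/-- The straight line of slope 1 crossing the real axis at `1/2`,
parametrized from upper right to lower left. -/
noncomputable def rline (u : ℝ) : ℂ :=
  1 / 2 - Complex.exp (Real.pi * Complex.I / 4) * (u : ℂ)

/-- Riemann's auxiliary function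
`R(s) = ∫_{0↙1} x^{-s} e^{πix²}/(e^{πix} − e^{-πix}) dx`, written out as an
integral over the real parameter of the line `0↙1`. Here `z ^ (-s)` is the
principal power `exp (−s Log z)`. -/
noncomputable def RiemannR (s : ℂ) : ℂ :=
  -Complex.exp (Real.pi * Complex.I / 4) *
    ∫ u : ℝ, (rline u) ^ (-s) *
      Complex.exp (Real.pi * Complex.I * (rline u) ^ 2) /
      (Complex.exp (Real.pi * Complex.I * rline u) -
        Complex.exp (-(Real.pi * Complex.I * rline u)))


section

namespace Sg
open Complex Set

/-- Boundary integral over the rectangle `[a,b] × [c,d]`, counterclockwise. -/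
noncomputable def rectInt (f : ℂ → ℂ) (a b c d : ℝ) : ℂ :=
  (∫ x : ℝ in a..b, f (x + c * I)) - (∫ x : ℝ in a..b, f (x + d * I)) +
    I * (∫ y : ℝ in c..d, f (b + y * I)) - I * (∫ y : ℝ in c..d, f (a + y * I))

theorem rectInt_eq_zero (f : ℂ → ℂ) {a b c d : ℝ} (hab : a ≤ b) (hcd : c ≤ d)
    (Hc : ContinuousOn f (uIcc a b ×ℂ uIcc c d))
    (Hd : DifferentiableOn ℂ f (Ioo a b ×ℂ Ioo c d)) : rectInt f a b c d = 0 := by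
  have := integral_boundary_rect_eq_zero_of_continuousOn_of_differentiableOn f
    (⟨a, c⟩ : ℂ) (⟨b, d⟩ : ℂ) (by simpa using Hc) (by simpa [hab, hcd] using Hd)
  simpa [rectInt] using this

theorem hasDerivAt_hline (c x : ℝ) : HasDerivAt (fun x : ℝ => ((x : ℂ) + c * I)) 1 x := by
  simpa using (Complex.ofRealCLM.hasDerivAt (x := x)).add_const (c * I : ℂ)

theorem hasDerivAt_vline (b y : ℝ) : HasDerivAt (fun y : ℝ => ((b : ℂ) + y * I)) I y := by
  simpa using ((Complex.ofRealCLM.hasDerivAt (x := y)).mul_const I).const_add (b : ℂ)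

theorem continuous_hline (c : ℝ) : Continuous (fun x : ℝ => ((x : ℂ) + c * I)) := by fun_prop
theorem continuous_vline (c : ℝ) : Continuous (fun y : ℝ => ((c : ℂ) + y * I)) := by fun_prop

theorem log_sub_log_neg_pos {z : ℂ} (hz : 0 < z.im) : log z - log (-z) = Real.pi * I := by
  rw [Complex.log, Complex.log, Complex.arg_neg_eq_arg_sub_pi_of_im_pos hz]
  simp; ring

theorem log_sub_log_neg_neg {z : ℂ} (hz : z.im < 0) : log z - log (-z) = -(Real.pi * I) := by
  rw [Complex.log, Complex.log, Complex.arg_neg_eq_arg_add_pi_of_im_neg hz]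
  simp; ring

theorem rectInt_inv (p : ℂ) {a b c d : ℝ} (ha : a < p.re) (hb : p.re < b) (hc : c < p.im)
    (hd : p.im < d) : rectInt (fun z => (z - p)⁻¹) a b c d = 2 * Real.pi * I := by
  have h1 : (∫ x : ℝ in a..b, ((x + c * I : ℂ) - p)⁻¹) =
      log (b + c * I - p) - log (a + c * I - p) := by
    refine intervalIntegral.integral_eq_sub_of_hasDerivAt
      (f := fun x : ℝ => log ((x : ℂ) + c * I - p)) (fun x _ => ?_) ?_
    · have := ((hasDerivAt_hline c x).sub_const p).clog_real
        (show (x : ℂ) + c * I - p ∈ slitPlane from Or.inr (by simp; linarith))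
      simpa using this
    · refine Continuous.intervalIntegrable (Continuous.inv₀ (by fun_prop) fun x h => ?_) _ _
      have := congrArg Complex.im h; simp at this; linarith
  have h2 : (∫ x : ℝ in a..b, ((x + d * I : ℂ) - p)⁻¹) =
      log (b + d * I - p) - log (a + d * I - p) := by
    refine intervalIntegral.integral_eq_sub_of_hasDerivAt
      (f := fun x : ℝ => log ((x : ℂ) + d * I - p)) (fun x _ => ?_) ?_
    · have := ((hasDerivAt_hline d x).sub_const p).clog_real
        (show (x : ℂ) + d * I - p ∈ slitPlane from Or.inr (by simp; linarith))
      simpa using this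
    · refine Continuous.intervalIntegrable (Continuous.inv₀ (by fun_prop) fun x h => ?_) _ _
      have := congrArg Complex.im h; simp at this; linarith
  have h3 : I * (∫ y : ℝ in c..d, ((b + y * I : ℂ) - p)⁻¹) =
      log (b + d * I - p) - log (b + c * I - p) := by
    rw [← intervalIntegral.integral_const_mul]
    refine intervalIntegral.integral_eq_sub_of_hasDerivAt
      (f := fun y : ℝ => log ((b : ℂ) + y * I - p)) (fun x _ => ?_) ?_
    · have := ((hasDerivAt_vline b x).sub_const p).clog_real
        (show (b : ℂ) + x * I - p ∈ slitPlane from Or.inl (by simp; linarith))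
      simpa [div_eq_mul_inv] using this
    · refine Continuous.intervalIntegrable
        (continuous_const.mul (Continuous.inv₀ (by fun_prop) fun x h => ?_)) _ _
      have := congrArg Complex.re h; simp at this; linarith
  have h4 : I * (∫ y : ℝ in c..d, ((a + y * I : ℂ) - p)⁻¹) =
      log (-(a + d * I - p)) - log (-(a + c * I - p)) := by
    rw [← intervalIntegral.integral_const_mul]
    refine intervalIntegral.integral_eq_sub_of_hasDerivAt
      (f := fun y : ℝ => log (-((a : ℂ) + y * I - p))) (fun x _ => ?_) ?_
    · have := ((hasDerivAt_vline a x).sub_const p).neg.clog_real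
        (show -((a : ℂ) + x * I - p) ∈ slitPlane from Or.inl (by simp; linarith))
      rw [Pi.neg_apply, neg_div_neg_eq] at this
      simpa [div_eq_mul_inv] using this
    · refine Continuous.intervalIntegrable
        (continuous_const.mul (Continuous.inv₀ (by fun_prop) fun x h => ?_)) _ _
      have := congrArg Complex.re h; simp at this; linarith
  have h5 := log_sub_log_neg_pos (z := a + d * I - p) (by simp; linarith)
  have h6 := log_sub_log_neg_neg (z := a + c * I - p) (by simp; linarith)
  unfold rectInt
  rw [h1, h2, h3, h4]
  linear_combination h5 - h6

end Sg

end

section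

namespace Sg
open Complex Set MeasureTheory
set_option autoImplicit false

/-- Closed rectangle. -/
def crect (a b c d : ℝ) : Set ℂ := {z | a ≤ z.re ∧ z.re ≤ b ∧ c ≤ z.im ∧ z.im ≤ d}

/-- Boundary of the rectangle. -/
def rbdry (a b c d : ℝ) : Set ℂ :=
  {z | z ∈ crect a b c d ∧ (z.re = a ∨ z.re = b ∨ z.im = c ∨ z.im = d)}

theorem crect_eq {a b c d : ℝ} (hab : a ≤ b) (hcd : c ≤ d) :
    crect a b c d = uIcc a b ×ℂ uIcc c d := by
  ext z
  simp [crect, mem_reProdIm, uIcc_of_le hab, uIcc_of_le hcd, and_assoc]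

section
variable {a b c d : ℝ}

theorem mem_rbdry_bot (hcd : c ≤ d) {x : ℝ} (hx : x ∈ Icc a b) : (x + c * I : ℂ) ∈ rbdry a b c d := by
  simp [rbdry, crect, hx.1, hx.2, hcd]
theorem mem_rbdry_top (hcd : c ≤ d) {x : ℝ} (hx : x ∈ Icc a b) : (x + d * I : ℂ) ∈ rbdry a b c d := by
  simp [rbdry, crect, hx.1, hx.2, hcd]
theorem mem_rbdry_left (hab : a ≤ b) {y : ℝ} (hy : y ∈ Icc c d) : (a + y * I : ℂ) ∈ rbdry a b c d := by
  simp [rbdry, crect, hy.1, hy.2, hab]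
theorem mem_rbdry_right (hab : a ≤ b) {y : ℝ} (hy : y ∈ Icc c d) : (b + y * I : ℂ) ∈ rbdry a b c d := by
  simp [rbdry, crect, hy.1, hy.2, hab]

theorem ii_bot (hab : a ≤ b) (hcd : c ≤ d) {f : ℂ → ℂ} (hf : ContinuousOn f (rbdry a b c d)) :
    IntervalIntegrable (fun x : ℝ => f (x + c * I)) volume a b := by
  refine ContinuousOn.intervalIntegrable (hf.comp (continuous_hline c).continuousOn ?_)
  intro x hx; rw [uIcc_of_le hab] at hx; exact mem_rbdry_bot hcd hx
theorem ii_top (hab : a ≤ b) (hcd : c ≤ d) {f : ℂ → ℂ} (hf : ContinuousOn f (rbdry a b c d)) :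
    IntervalIntegrable (fun x : ℝ => f (x + d * I)) volume a b := by
  refine ContinuousOn.intervalIntegrable (hf.comp (continuous_hline d).continuousOn ?_)
  intro x hx; rw [uIcc_of_le hab] at hx; exact mem_rbdry_top hcd hx
theorem ii_left (hab : a ≤ b) (hcd : c ≤ d) {f : ℂ → ℂ} (hf : ContinuousOn f (rbdry a b c d)) :
    IntervalIntegrable (fun y : ℝ => f (a + y * I)) volume c d := by
  refine ContinuousOn.intervalIntegrable (hf.comp (continuous_vline a).continuousOn ?_)
  intro x hx; rw [uIcc_of_le hcd] at hx; exact mem_rbdry_left hab hx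
theorem ii_right (hab : a ≤ b) (hcd : c ≤ d) {f : ℂ → ℂ} (hf : ContinuousOn f (rbdry a b c d)) :
    IntervalIntegrable (fun y : ℝ => f (b + y * I)) volume c d := by
  refine ContinuousOn.intervalIntegrable (hf.comp (continuous_vline b).continuousOn ?_)
  intro x hx; rw [uIcc_of_le hcd] at hx; exact mem_rbdry_right hab hx

theorem rectInt_congr (hab : a ≤ b) (hcd : c ≤ d) {f g : ℂ → ℂ} (h : EqOn f g (rbdry a b c d)) :
    rectInt f a b c d = rectInt g a b c d := by
  unfold rectInt
  congr 1
  · congr 1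
    · congr 1
      · refine intervalIntegral.integral_congr fun x hx => h ?_
        rw [uIcc_of_le hab] at hx; exact mem_rbdry_bot hcd hx
      · refine intervalIntegral.integral_congr fun x hx => h ?_
        rw [uIcc_of_le hab] at hx; exact mem_rbdry_top hcd hx
    · congr 1
      refine intervalIntegral.integral_congr fun x hx => h ?_
      rw [uIcc_of_le hcd] at hx; exact mem_rbdry_right hab hx
  · congr 1
    refine intervalIntegral.integral_congr fun x hx => h ?_
    rw [uIcc_of_le hcd] at hx; exact mem_rbdry_left hab hx

theorem rectInt_add (hab : a ≤ b) (hcd : c ≤ d) {f g : ℂ → ℂ} (hf : ContinuousOn f (rbdry a b c d))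
    (hg : ContinuousOn g (rbdry a b c d)) :
    rectInt (fun z => f z + g z) a b c d = rectInt f a b c d + rectInt g a b c d := by
  unfold rectInt
  rw [intervalIntegral.integral_add (ii_bot hab hcd hf) (ii_bot hab hcd hg),
    intervalIntegral.integral_add (ii_top hab hcd hf) (ii_top hab hcd hg),
    intervalIntegral.integral_add (ii_left hab hcd hf) (ii_left hab hcd hg),
    intervalIntegral.integral_add (ii_right hab hcd hf) (ii_right hab hcd hg)]
  ring

theorem rectInt_const_mul (k : ℂ) (f : ℂ → ℂ) :
    rectInt (fun z => k * f z) a b c d = k * rectInt f a b c d := by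
  unfold rectInt
  simp only [intervalIntegral.integral_const_mul]
  ring

theorem rectInt_sum (hab : a ≤ b) (hcd : c ≤ d) {ι : Type*} (s : Finset ι) {f : ι → ℂ → ℂ}
    (hf : ∀ i ∈ s, ContinuousOn (f i) (rbdry a b c d)) :
    rectInt (fun z => ∑ i ∈ s, f i z) a b c d = ∑ i ∈ s, rectInt (f i) a b c d := by
  classical
  induction s using Finset.induction_on with
  | empty => simp [rectInt]
  | insert i s hi ih =>
    simp only [Finset.sum_insert hi]
    rw [rectInt_add hab hcd (hf i (by simp))
      (continuousOn_finsetSum _ fun j hj => hf j (by simp [hj])),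
      ih fun j hj => hf j (by simp [hj])]

theorem rectInt_eq_zero_of_diff (hab : a ≤ b) (hcd : c ≤ d) {f : ℂ → ℂ} {U : Set ℂ} (hU : IsOpen U)
    (hUc : crect a b c d ⊆ U) (hf : DifferentiableOn ℂ f U) : rectInt f a b c d = 0 := by
  refine rectInt_eq_zero f hab hcd (by rw [← crect_eq hab hcd]; exact (hf.mono hUc).continuousOn)
    (hf.mono fun z hz => hUc ?_)
  rw [mem_reProdIm] at hz
  exact ⟨hz.1.1.le, hz.1.2.le, hz.2.1.le, hz.2.2.le⟩
end

/-- Factor out finitely many zeros. -/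
theorem factor_zeros {U : Set ℂ} (hU : IsOpen U) {f : ℂ → ℂ} (hf : DifferentiableOn ℂ f U)
    (m : ℂ → ℕ) (Z : Finset ℂ) (hZU : ∀ ρ ∈ Z, ρ ∈ U)
    (hm : ∀ ρ ∈ Z, ∃ g : ℂ → ℂ, AnalyticAt ℂ g ρ ∧ g ρ ≠ 0 ∧
        ∀ᶠ s in nhds ρ, f s = (s - ρ) ^ (m ρ) * g s) :
    ∃ h : ℂ → ℂ, DifferentiableOn ℂ h U ∧ (∀ z ∈ U, f z = (∏ ρ ∈ Z, (z - ρ) ^ (m ρ)) * h z) ∧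
      ∀ ρ ∈ Z, h ρ ≠ 0 := by
  classical
  induction Z using Finset.induction_on with
  | empty => exact ⟨f, hf, by simp, by simp⟩
  | insert ρ Z hρ ih =>
    obtain ⟨h, hh, hfe, hne⟩ := ih (fun x hx => hZU x (by simp [hx])) (fun x hx => hm x (by simp [hx]))
    obtain ⟨g, hg, hg0, hgf⟩ := hm ρ (by simp)
    have hρU := hZU ρ (by simp)
    set P : ℂ → ℂ := fun z => ∏ ρ ∈ Z, (z - ρ) ^ (m ρ) with hP
    have hPd : Differentiable ℂ P := by
      rw [hP]; fun_prop
    have hP0 : P ρ ≠ 0 := by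
      rw [hP]; refine Finset.prod_ne_zero_iff.2 fun x hx => pow_ne_zero _ (sub_ne_zero.2 ?_)
      rintro rfl; exact hρ hx
    have hPev : ∀ᶠ s in nhds ρ, P s ≠ 0 := hPd.continuous.continuousAt.eventually_ne hP0
    set h' : ℂ → ℂ := fun z => if z = ρ then g ρ / P ρ else h z / (z - ρ) ^ (m ρ) with hh'
    have hev : h' =ᶠ[nhds ρ] fun z => g z / P z := by
      filter_upwards [hPev, hgf, hU.mem_nhds hρU] with z hz1 hz2 hz3
      by_cases hzρ : z = ρ
      · simp [hh', hzρ]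
      · have hzρ' : (z - ρ) ^ m ρ ≠ 0 := pow_ne_zero _ (sub_ne_zero.2 hzρ)
        simp only [hh', if_neg hzρ]
        rw [div_eq_div_iff hzρ' hz1, mul_comm (h z), ← hfe z hz3, hz2]; ring
    refine ⟨h', fun z hz => ?_, fun z hz => ?_, fun z hz => ?_⟩
    · by_cases hzρ : z = ρ
      · subst hzρ
        exact ((hg.differentiableAt.div hPd.differentiableAt hP0).congr_of_eventuallyEq
          hev).differentiableWithinAt
      · have hzρ' : (z - ρ) ^ m ρ ≠ 0 := pow_ne_zero _ (sub_ne_zero.2 hzρ)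
        have h1 : DifferentiableAt ℂ h z := hh.differentiableAt (hU.mem_nhds hz)
        have h2 : DifferentiableAt ℂ (fun z => h z / (z - ρ) ^ (m ρ)) z :=
          h1.div (by fun_prop) hzρ'
        refine (h2.congr_of_eventuallyEq ?_).differentiableWithinAt
        filter_upwards [isOpen_ne.mem_nhds hzρ] with w hw
        simp only [hh', if_neg hw]
    · rw [Finset.prod_insert hρ]
      by_cases hzρ : z = ρ
      · subst hzρ
        have e1 := hgf.self_of_nhds
        rw [e1]
        have : h' z = g z / P z := by simp [hh']
        rw [this, mul_assoc]
        congr 1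
        change g z = P z * (g z / P z)
        field_simp
      · have hzρ' : (z - ρ) ^ m ρ ≠ 0 := pow_ne_zero _ (sub_ne_zero.2 hzρ)
        simp only [hh', if_neg hzρ]
        rw [hfe z hz]
        field_simp
    · by_cases hzρ : z = ρ
      · simp only [hh', if_pos hzρ]; exact div_ne_zero hg0 hP0
      · simp only [hh', if_neg hzρ]
        refine div_ne_zero (hne z ?_) (pow_ne_zero _ (sub_ne_zero.2 hzρ))
        simpa [hzρ] using hz

theorem logDeriv_factor {f h : ℂ → ℂ} {U : Set ℂ} (hU : IsOpen U) (m : ℂ → ℕ) (Z : Finset ℂ)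
    (hh : DifferentiableOn ℂ h U)
    (hfe : ∀ z ∈ U, f z = (∏ ρ ∈ Z, (z - ρ) ^ (m ρ)) * h z) {z : ℂ} (hz : z ∈ U)
    (hzZ : z ∉ Z) (hz0 : h z ≠ 0) :
    logDeriv f z = (∑ ρ ∈ Z, (m ρ : ℂ) * (z - ρ)⁻¹) + logDeriv h z := by
  have hev : f =ᶠ[nhds z] fun z => (∏ ρ ∈ Z, (z - ρ) ^ (m ρ)) * h z := by
    filter_upwards [hU.mem_nhds hz] with w hw using hfe w hw
  have e1 : logDeriv f z = logDeriv (fun z => (∏ ρ ∈ Z, (z - ρ) ^ (m ρ)) * h z) z := by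
    simp only [logDeriv_apply, hev.deriv_eq, hev.self_of_nhds]
  have hne : ∀ ρ ∈ Z, (z - ρ) ^ m ρ ≠ 0 := fun ρ hρ =>
    pow_ne_zero _ (sub_ne_zero.2 (by rintro rfl; exact hzZ hρ))
  rw [e1, logDeriv_mul (f := fun z => ∏ ρ ∈ Z, (z - ρ) ^ (m ρ)) z
    (Finset.prod_ne_zero_iff.2 hne) hz0 (by fun_prop) (hh.differentiableAt (hU.mem_nhds hz))]
  congr 1
  rw [logDeriv_prod (f := fun ρ z => (z - ρ) ^ (m ρ)) hne (by intros; fun_prop)]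
  refine Finset.sum_congr rfl fun ρ hρ => ?_
  have := logDeriv_fun_pow (f := fun z : ℂ => z - ρ) (x := z) (by fun_prop) (m ρ)
  rw [this]
  simp [logDeriv_apply]

theorem diffOn_logDeriv {h : ℂ → ℂ} {U : Set ℂ} (hU : IsOpen U) (hh : DifferentiableOn ℂ h U)
    (h0 : ∀ z ∈ U, h z ≠ 0) : DifferentiableOn ℂ (logDeriv h) U := by
  have := (hh.deriv hU).div hh h0
  exact this

/-- Weighted argument principle for z times the logarithmic derivative. -/
theorem rectInt_mul_logDeriv {f : ℂ → ℂ} {U : Set ℂ} (hU : IsOpen U) (hf : DifferentiableOn ℂ f U)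
    {a b c d : ℝ} (hab : a ≤ b) (hcd : c ≤ d) (hUc : crect a b c d ⊆ U)
    (m : ℂ → ℕ) (Z : Finset ℂ)
    (hZ : ∀ z ∈ crect a b c d, f z = 0 ↔ z ∈ Z) (hZr : ∀ z ∈ Z, z ∈ crect a b c d)
    (hb : ∀ z ∈ rbdry a b c d, f z ≠ 0)
    (hm : ∀ ρ ∈ Z, ∃ g : ℂ → ℂ, AnalyticAt ℂ g ρ ∧ g ρ ≠ 0 ∧
        ∀ᶠ s in nhds ρ, f s = (s - ρ) ^ (m ρ) * g s) :
    rectInt (fun z => z * logDeriv f z) a b c d =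
      2 * Real.pi * I * ∑ ρ ∈ Z, (m ρ : ℂ) * ρ := by
  obtain ⟨h, hh, hfe, hne⟩ := factor_zeros hU hf m Z (fun ρ hρ => hUc (hZr ρ hρ)) hm
  have hne' : ∀ z ∈ crect a b c d, h z ≠ 0 := by
    intro z hz h0
    by_cases hzZ : z ∈ Z
    · exact hne z hzZ h0
    · exact hzZ ((hZ z hz).1 (by rw [hfe z (hUc hz), h0, mul_zero]))
  set V := U ∩ h ⁻¹' {0}ᶜ with hV
  have hVo : IsOpen V := hh.continuousOn.isOpen_inter_preimage hU isOpen_compl_singleton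
  have hVc : crect a b c d ⊆ V := fun z hz => ⟨hUc hz, hne' z hz⟩
  have hsub : rbdry a b c d ⊆ crect a b c d := fun z hz => hz.1
  have hL : DifferentiableOn ℂ (logDeriv h) V :=
    diffOn_logDeriv hVo (hh.mono inter_subset_left) fun z hz => hz.2
  have hzL : DifferentiableOn ℂ (fun z => z * logDeriv h z) V := differentiableOn_id.mul hL
  have hnotZ : ∀ z ∈ rbdry a b c d, z ∉ Z := fun z hz hzZ => hb z hz ((hZ z hz.1).2 hzZ)
  have hinv : ∀ ρ ∈ Z, ContinuousOn (fun z => (z - ρ)⁻¹) (rbdry a b c d) := by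
    intro ρ hρ
    refine ContinuousOn.inv₀ (by fun_prop) fun z hz h => hnotZ z hz ?_
    rw [sub_eq_zero.1 h]; exact hρ
  have e1 : rectInt (fun z => z * logDeriv f z) a b c d = rectInt (fun z =>
      (∑ ρ ∈ Z, ((m ρ : ℂ) * 1 + (m ρ * ρ) * (z - ρ)⁻¹)) + z * logDeriv h z) a b c d := by
    refine rectInt_congr hab hcd fun z hz => ?_
    rw [logDeriv_factor hU m Z hh hfe (hUc hz.1) (hnotZ z hz) (hne' z hz.1), mul_add, Finset.mul_sum]
    congr 1
    refine Finset.sum_congr rfl fun ρ hρ => ?_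
    have : z - ρ ≠ 0 := sub_ne_zero.2 (by rintro rfl; exact hnotZ z hz hρ)
    field_simp; ring
  have hcz : ContinuousOn (fun z => z * logDeriv h z) (rbdry a b c d) :=
    (hzL.mono (hsub.trans hVc)).continuousOn
  have hterm : ∀ ρ ∈ Z, ContinuousOn (fun z => (m ρ : ℂ) * 1 + (m ρ * ρ) * (z - ρ)⁻¹)
      (rbdry a b c d) := fun ρ hρ =>
    continuousOn_const.add (continuousOn_const.mul (hinv ρ hρ))
  rw [e1, rectInt_add hab hcd (continuousOn_finsetSum _ hterm) hcz,
    rectInt_eq_zero_of_diff hab hcd hVo hVc hzL, add_zero,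
    rectInt_sum hab hcd _ hterm,
    Finset.mul_sum]
  refine Finset.sum_congr rfl fun ρ hρ => ?_
  rw [rectInt_add (f := fun _ => (m ρ : ℂ) * 1) (g := fun z => (m ρ * ρ) * (z - ρ)⁻¹) hab hcd
    continuousOn_const (continuousOn_const.mul (hinv ρ hρ)),
    rectInt_const_mul (f := fun _ => 1), rectInt_const_mul,
    rectInt_eq_zero_of_diff hab hcd isOpen_univ (subset_univ _) (differentiableOn_const 1)]
  have hr := hZr ρ hρ
  have hnb : ρ ∉ rbdry a b c d := fun hb' => hnotZ ρ hb' hρ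
  have hr' : a < ρ.re ∧ ρ.re < b ∧ c < ρ.im ∧ ρ.im < d := by
    refine ⟨lt_of_le_of_ne hr.1 ?_, lt_of_le_of_ne hr.2.1 ?_, lt_of_le_of_ne hr.2.2.1 ?_,
      lt_of_le_of_ne hr.2.2.2 ?_⟩ <;> intro h <;> exact hnb ⟨hr, by simp [h]⟩
  rw [rectInt_inv ρ hr'.1 hr'.2.1 hr'.2.2.1 hr'.2.2.2]
  ring

end Sg

end

section

namespace Sg
open Complex Set MeasureTheory
set_option autoImplicit false

theorem hasDerivAt_log_norm {φ : ℝ → ℂ} {φ' : ℂ} {x : ℝ} (h : HasDerivAt φ φ' x) (h0 : φ x ≠ 0) :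
    HasDerivAt (fun x => Real.log ‖φ x‖) (φ' / φ x).re x := by
  have h1 : HasDerivAt (fun y => φ y / φ x) (φ' / φ x) x := h.div_const _
  have h2 := h1.clog_real (by simp [h0])
  have h3 := (Complex.reCLM.hasFDerivAt.comp_hasDerivAt x h2)
  have h4 := h3.add_const (Real.log ‖φ x‖)
  simp only [div_self h0, div_one] at h4
  refine h4.congr_of_eventuallyEq ?_
  filter_upwards [h.continuousAt.eventually_ne h0] with y hy
  simp only [Function.comp, reCLM_apply, log_re, norm_div]
  rw [Real.log_div (norm_ne_zero_iff.2 hy) (norm_ne_zero_iff.2 h0)]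
  ring

theorem ii_re {f : ℝ → ℂ} {a b : ℝ} (h : IntervalIntegrable f volume a b) :
    IntervalIntegrable (fun x => (f x).re) volume a b := ⟨h.1.re, h.2.re⟩
theorem ii_im {f : ℝ → ℂ} {a b : ℝ} (h : IntervalIntegrable f volume a b) :
    IntervalIntegrable (fun x => (f x).im) volume a b := ⟨h.1.im, h.2.im⟩
theorem int_re {f : ℝ → ℂ} {a b : ℝ} (h : IntervalIntegrable f volume a b) :
    (∫ x in a..b, f x).re = ∫ x in a..b, (f x).re :=
  (Complex.reCLM.intervalIntegral_comp_comm h).symm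
theorem int_im {f : ℝ → ℂ} {a b : ℝ} (h : IntervalIntegrable f volume a b) :
    (∫ x in a..b, f x).im = ∫ x in a..b, (f x).im :=
  (Complex.imCLM.intervalIntegral_comp_comm h).symm

section
variable {f : ℂ → ℂ} {U : Set ℂ} {a b c d : ℝ}

theorem hline_log (hU : IsOpen U) (hf : DifferentiableOn ℂ f U) {x : ℝ} (hx : (x + c * I : ℂ) ∈ U)
    (h0 : f (x + c * I) ≠ 0) : HasDerivAt (fun x : ℝ => Real.log ‖f (x + c * I)‖)
      (logDeriv f (x + c * I)).re x := by
  have h1 := (hf.differentiableAt (hU.mem_nhds hx)).hasDerivAt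
  have h2 : HasDerivAt (fun x : ℝ => f (x + c * I)) (deriv f (x + c * I) * 1) x :=
    h1.comp x (hasDerivAt_hline c x)
  have := hasDerivAt_log_norm h2 h0
  simpa [logDeriv_apply] using this

theorem vline_log (hU : IsOpen U) (hf : DifferentiableOn ℂ f U) {y : ℝ} (hx : (a + y * I : ℂ) ∈ U)
    (h0 : f (a + y * I) ≠ 0) : HasDerivAt (fun y : ℝ => Real.log ‖f (a + y * I)‖)
      (-(logDeriv f (a + y * I)).im) y := by
  have h1 := (hf.differentiableAt (hU.mem_nhds hx)).hasDerivAt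
  have h2 : HasDerivAt (fun y : ℝ => f (a + y * I)) (deriv f (a + y * I) * I) y :=
    h1.comp y (hasDerivAt_vline a y)
  have := hasDerivAt_log_norm h2 h0
  rw [mul_comm, mul_div_assoc, I_mul_re] at this
  simpa [logDeriv_apply] using this

/-- Horizontal side. -/
noncomputable def hSide (f : ℂ → ℂ) (a b c : ℝ) : ℝ := ∫ x in a..b, x * (logDeriv f (x + c * I)).im
/-- Vertical side. -/
noncomputable def vSide (f : ℂ → ℂ) (b c d : ℝ) : ℝ :=
  ∫ y in c..d, (b * (logDeriv f (b + y * I)).re - Real.log ‖f (b + y * I)‖)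

theorem hline_im (hU : IsOpen U) (hf : DifferentiableOn ℂ f U) (hab : a ≤ b)
    (hL : IntervalIntegrable (fun x : ℝ => logDeriv f (x + c * I)) volume a b)
    (hUc : ∀ x ∈ Icc a b, (x + c * I : ℂ) ∈ U) (h0 : ∀ x ∈ Icc a b, f (x + c * I) ≠ 0) :
    (∫ x : ℝ in a..b, (x + c * I) * logDeriv f (x + c * I)).im =
      hSide f a b c + c * (Real.log ‖f (b + c * I)‖ - Real.log ‖f (a + c * I)‖) := by
  have h1 : ∫ x : ℝ in a..b, (logDeriv f (x + c * I)).re =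
      Real.log ‖f (b + c * I)‖ - Real.log ‖f (a + c * I)‖ := by
    refine intervalIntegral.integral_eq_sub_of_hasDerivAt
      (f := fun x : ℝ => Real.log ‖f (x + c * I)‖) (fun x hx => ?_) (ii_re hL)
    rw [uIcc_of_le hab] at hx
    exact hline_log hU hf (hUc x hx) (h0 x hx)
  have hi : IntervalIntegrable (fun x : ℝ => (x + c * I) * logDeriv f (x + c * I)) volume a b :=
    hL.continuousOn_mul (continuous_hline c).continuousOn
  rw [int_im hi, hSide, ← h1, ← intervalIntegral.integral_const_mul,
    ← intervalIntegral.integral_add]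
  · congr 1; ext x; simp
  · exact (ii_im hL).continuousOn_mul continuousOn_id
  · exact (ii_re hL).const_mul _

theorem vline_re (hU : IsOpen U) (hf : DifferentiableOn ℂ f U) (hcd : c ≤ d)
    (hL : IntervalIntegrable (fun y : ℝ => logDeriv f (b + y * I)) volume c d)
    (hUc : ∀ y ∈ Icc c d, (b + y * I : ℂ) ∈ U) (h0 : ∀ y ∈ Icc c d, f (b + y * I) ≠ 0) :
    (∫ y : ℝ in c..d, (b + y * I) * logDeriv f (b + y * I)).re =
      vSide f b c d + d * Real.log ‖f (b + d * I)‖ - c * Real.log ‖f (b + c * I)‖ := by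
  have hfc : IntervalIntegrable (fun y : ℝ => Real.log ‖f (b + y * I)‖) volume c d := by
    refine ContinuousOn.intervalIntegrable fun y hy => ?_
    rw [uIcc_of_le hcd] at hy
    exact (vline_log hU hf (hUc y hy) (h0 y hy)).continuousAt.continuousWithinAt
  have him : IntervalIntegrable (fun y : ℝ => y * (logDeriv f (b + y * I)).im) volume c d :=
    (ii_im hL).continuousOn_mul continuousOn_id
  have h1 : ∫ y : ℝ in c..d, (Real.log ‖f (b + y * I)‖ - y * (logDeriv f (b + y * I)).im) =
      d * Real.log ‖f (b + d * I)‖ - c * Real.log ‖f (b + c * I)‖ := by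
    refine intervalIntegral.integral_eq_sub_of_hasDerivAt
      (f := fun y : ℝ => y * Real.log ‖f (b + y * I)‖) (fun x hx => ?_) (hfc.sub him)
    rw [uIcc_of_le hcd] at hx
    have := (hasDerivAt_id x).mul (vline_log hU hf (hUc x hx) (h0 x hx))
    convert! this using 1
    simp; ring
  have hi : IntervalIntegrable (fun y : ℝ => (b + y * I) * logDeriv f (b + y * I)) volume c d :=
    hL.continuousOn_mul (continuous_vline b).continuousOn
  rw [int_re hi, vSide, add_sub_assoc, ← h1, ← intervalIntegral.integral_add]
  · congr 1; ext x; simp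
  · exact ((ii_re hL).const_mul _).sub hfc
  · exact hfc.sub him

theorem littlewood (hU : IsOpen U) (hf : DifferentiableOn ℂ f U)
    (hab : a ≤ b) (hcd : c ≤ d) (hUc : crect a b c d ⊆ U)
    (m : ℂ → ℕ) (Z : Finset ℂ)
    (hZ : ∀ z ∈ crect a b c d, f z = 0 ↔ z ∈ Z) (hZr : ∀ z ∈ Z, z ∈ crect a b c d)
    (hb : ∀ z ∈ rbdry a b c d, f z ≠ 0)
    (hm : ∀ ρ ∈ Z, ∃ g : ℂ → ℂ, AnalyticAt ℂ g ρ ∧ g ρ ≠ 0 ∧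
        ∀ᶠ s in nhds ρ, f s = (s - ρ) ^ (m ρ) * g s) :
    2 * Real.pi * ∑ ρ ∈ Z, (m ρ : ℝ) * ρ.re =
      vSide f b c d - vSide f a c d + hSide f a b c - hSide f a b d := by
  have key := congrArg Complex.im (rectInt_mul_logDeriv hU hf hab hcd hUc m Z hZ hZr hb hm)
  have hLc : ContinuousOn (logDeriv f) (rbdry a b c d) := by
    have hVo : IsOpen (U ∩ f ⁻¹' {0}ᶜ) :=
      hf.continuousOn.isOpen_inter_preimage hU isOpen_compl_singleton
    refine ((diffOn_logDeriv hVo (hf.mono inter_subset_left) fun z hz => hz.2).mono ?_).continuousOn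
    exact fun z hz => ⟨hUc hz.1, hb z hz⟩
  have e1 : (rectInt (fun z => z * logDeriv f z) a b c d).im =
      vSide f b c d - vSide f a c d + hSide f a b c - hSide f a b d := by
    unfold rectInt
    simp only [sub_im, add_im, I_mul_im]
    rw [hline_im hU hf hab (ii_bot hab hcd hLc) (fun x hx => hUc (mem_rbdry_bot hcd hx).1)
        (fun x hx => hb _ (mem_rbdry_bot hcd hx)),
      hline_im hU hf hab (ii_top hab hcd hLc) (fun x hx => hUc (mem_rbdry_top hcd hx).1)
        (fun x hx => hb _ (mem_rbdry_top hcd hx)),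
      vline_re hU hf hcd (ii_left hab hcd hLc) (fun x hx => hUc (mem_rbdry_left hab hx).1)
        (fun x hx => hb _ (mem_rbdry_left hab hx)),
      vline_re hU hf hcd (ii_right hab hcd hLc) (fun x hx => hUc (mem_rbdry_right hab hx).1)
        (fun x hx => hb _ (mem_rbdry_right hab hx))]
    ring
  rw [← e1, key]
  have : (2 * Real.pi * I * ∑ ρ ∈ Z, (m ρ : ℂ) * ρ) =
    I * ((2 * Real.pi : ℝ) * ∑ ρ ∈ Z, (m ρ : ℂ) * ρ) := by push_cast; ring
  rw [this, I_mul_im, re_ofReal_mul, re_sum]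
  simp
end
end Sg

end

section

namespace Sg
open Complex Set MeasureTheory Metric
set_option autoImplicit false

theorem zeros_finite {U : Set ℂ} (hU : IsOpen U) (hUp : IsPreconnected U) {f : ℂ → ℂ}
    (hf : DifferentiableOn ℂ f U) {c : ℂ} (hc : c ∈ U) (hfc : f c ≠ 0) {K : Set ℂ} (hK : IsCompact K)
    (hKU : K ⊆ U) : {z | z ∈ K ∧ f z = 0}.Finite := by
  by_contra hinf
  obtain ⟨z, hzK, hz⟩ := Set.Infinite.exists_accPt_of_subset_isCompact hinf hK (fun z hz => hz.1)
  have hfr := accPt_iff_frequently_nhdsNE.1 hz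
  have han : AnalyticOnNhd ℂ f U := hf.analyticOnNhd hU
  have := han.eqOn_zero_of_preconnected_of_frequently_eq_zero hUp (hKU hzK)
    (hfr.mono fun w hw => hw.2)
  exact hfc (this hc)

theorem exists_local_factor {U : Set ℂ} (hU : IsOpen U) (hUp : IsPreconnected U) {f : ℂ → ℂ}
    (hf : DifferentiableOn ℂ f U) {c : ℂ} (hc : c ∈ U) (hfc : f c ≠ 0) {ρ : ℂ} (hρ : ρ ∈ U) :
    ∃ g : ℂ → ℂ, AnalyticAt ℂ g ρ ∧ g ρ ≠ 0 ∧
        ∀ᶠ s in nhds ρ, f s = (s - ρ) ^ (analyticOrderNatAt f ρ) * g s := by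
  have han : AnalyticOnNhd ℂ f U := hf.analyticOnNhd hU
  have hnt : analyticOrderAt f ρ ≠ ⊤ := by
    intro h
    rw [analyticOrderAt_eq_top] at h
    have := han.eqOn_zero_of_preconnected_of_frequently_eq_zero hUp hρ
      (h.filter_mono nhdsWithin_le_nhds).frequently
    exact hfc (this hc)
  simpa [smul_eq_mul] using ((han ρ hρ).analyticOrderNatAt_eq_iff hnt).1 rfl

theorem norm_le_on_ball {h : ℂ → ℂ} {c : ℂ} {R R' B : ℝ} (hR : R < R') (hR0 : 0 < R)
    (hh : DifferentiableOn ℂ h (ball c R')) (hs : ∀ z ∈ sphere c R, ‖h z‖ ≤ B) {z : ℂ}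
    (hz : z ∈ closedBall c R) : ‖h z‖ ≤ B := by
  refine Complex.norm_le_of_forall_mem_frontier_norm_le (U := ball c R) isBounded_ball
    ?_ ?_ ?_
  · refine (hh.mono ?_).diffContOnCl
    rw [closure_ball c hR0.ne']; exact closedBall_subset_ball hR
  · rw [frontier_ball c hR0.ne']; exact hs
  · rwa [closure_ball c hR0.ne']

theorem logDeriv_bound {h : ℂ → ℂ} {c : ℂ} {r R M : ℝ} (hr : 0 < r) (hrR : r < R) (hM : 0 < M)
    (hh : DifferentiableOn ℂ h (ball c R)) (h0 : ∀ z ∈ ball c R, h z ≠ 0)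
    (hB : ∀ z ∈ ball c R, ‖h z‖ ≤ Real.exp M * ‖h c‖) {z : ℂ} (hz : ‖z - c‖ ≤ r) :
    ‖logDeriv h z‖ ≤ 8 * M * R / (R - r) ^ 2 := by
  have hR : 0 < R := hr.trans hrR
  have hcm : c ∈ ball c R := mem_ball_self hR
  obtain ⟨l, hlc, hl⟩ := ((diffOn_logDeriv isOpen_ball hh h0).isExactOn_ball).with_val_at c 0
  have hconst : ∀ z ∈ ball c R, h z * exp (-l z) = h c := by
    intro z hz
    have hd : ∀ w ∈ ball c R, HasDerivAt (fun w => h w * exp (-l w)) 0 w := by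
      intro w hw
      have h1 := (hh.differentiableAt (isOpen_ball.mem_nhds hw)).hasDerivAt
      have h2 := h1.mul (hl w hw).neg.cexp
      convert! h2 using 1
      rw [logDeriv_apply]
      have := h0 w hw
      field_simp
      simp
    have := (convex_ball c R).is_const_of_fderivWithin_eq_zero (𝕜 := ℂ)
      (f := fun w => h w * exp (-l w)) (fun w hw => (hd w hw).differentiableAt.differentiableWithinAt)
      (fun w hw => by
        have := (hd w hw).hasFDerivAt.hasFDerivWithinAt (s := ball c R)
        rw [this.fderivWithin (isOpen_ball.uniqueDiffWithinAt hw)]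
        ext; simp) hz hcm
    simpa [hlc] using this
  have hre : ∀ z ∈ ball c R, (l z).re ≤ M := by
    intro z hz
    have h1 := hconst z hz
    have h2 : h z = h c * exp (l z) := by
      rw [← h1, mul_assoc, ← Complex.exp_add]; simp
    have h3 := hB z hz
    rw [h2, norm_mul, mul_comm, Complex.norm_exp] at h3
    have h4 : 0 < ‖h c‖ := norm_pos_iff.2 (h0 c hcm)
    exact Real.exp_le_exp.1 (le_of_mul_le_mul_right h3 h4)
  set e := (R - r) / 2 with he
  have hepos : 0 < e := by rw [he]; linarith
  have hball : ∀ w ∈ closedBall z e, w ∈ ball c R ∧ ‖w - c‖ ≤ r + e := by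
    intro w hw
    rw [mem_closedBall, dist_eq_norm] at hw
    have : ‖w - c‖ ≤ r + e := by
      calc ‖w - c‖ = ‖(w - z) + (z - c)‖ := by ring_nf
        _ ≤ ‖w - z‖ + ‖z - c‖ := norm_add_le _ _
        _ ≤ r + e := by linarith
    refine ⟨?_, this⟩
    rw [mem_ball, dist_eq_norm]; rw [he] at this; linarith
  have hBC : ∀ w, w ∈ ball c R → ‖w - c‖ ≤ r + e → ‖l w‖ ≤ 2 * M * R / e := by
    intro w hw hwe
    have hmap : ∀ u ∈ ball (0 : ℂ) R, u + c ∈ ball c R := by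
      intro u hu; simpa [mem_ball, dist_eq_norm] using hu
    have hw0 : w - c ∈ ball (0 : ℂ) R := by simpa [mem_ball, dist_eq_norm] using hw
    have := Complex.borelCaratheodory_zero (f := fun u => l (u + c)) (z := w - c) hM
      (fun u hu => ((hl _ (hmap u hu)).comp_add_const u c).differentiableAt.differentiableWithinAt)
      (fun u hu => hre _ (hmap u hu)) hR hw0 (by simpa using hlc)
    simp only [sub_add_cancel] at this
    refine this.trans ?_
    have h1 : e ≤ R - ‖w - c‖ := by rw [he] at hwe ⊢; linarith
    have h2 : ‖w - c‖ ≤ R := by rw [he] at hwe; linarith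
    gcongr
  have hdc : DiffContOnCl ℂ l (ball z e) := by
    refine DifferentiableOn.diffContOnCl ?_
    rw [closure_ball z hepos.ne']
    exact fun w hw => (hl w (hball w hw).1).differentiableAt.differentiableWithinAt
  have hder := Complex.norm_deriv_le_of_forall_mem_sphere_norm_le (f := l) (c := z) (R := e)
    (C := 2 * M * R / e) hepos
    hdc
    (fun w hw => hBC w (hball w (sphere_subset_closedBall hw)).1
      (hball w (sphere_subset_closedBall hw)).2)
  rw [(hl z (hball z (mem_closedBall_self hepos.le)).1).deriv] at hder
  refine hder.trans (le_of_eq ?_)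
  rw [he]
  have : R - r ≠ 0 := by linarith
  field_simp; ring

theorem abs_inv_im (x T : ℝ) (ρ : ℂ) : |((x + T * I - ρ : ℂ)⁻¹).im| =
    |T - ρ.im| / ((x - ρ.re) ^ 2 + (T - ρ.im) ^ 2) := by
  rw [Complex.inv_im, abs_div, abs_neg]
  congr 1
  · simp
  · rw [abs_of_nonneg (normSq_nonneg _), normSq_apply]; simp; ring

theorem poisson_int (a b k β : ℝ) (hab : a ≤ b) :
    IntervalIntegrable (fun x : ℝ => |k| / ((x - β) ^ 2 + k ^ 2)) volume a b ∧
    ∫ x in a..b, |k| / ((x - β) ^ 2 + k ^ 2) ≤ Real.pi := by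
  by_cases hk : k = 0
  · simp [hk, Real.pi_pos.le]
  have hk' : 0 < |k| := abs_pos.2 hk
  have hintg : IntervalIntegrable (fun x : ℝ => |k| / ((x - β) ^ 2 + k ^ 2)) volume a b := by
    refine Continuous.intervalIntegrable (Continuous.div₀ (by fun_prop) (by fun_prop) fun x => ?_) _ _
    positivity
  refine ⟨hintg, ?_⟩
  rw [intervalIntegral.integral_eq_sub_of_hasDerivAt
    (f := fun x : ℝ => Real.arctan ((x - β) / |k|)) (fun x _ => ?_) hintg]
  · have h1 := Real.arctan_lt_pi_div_two ((b - β) / |k|)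
    have h2 := Real.neg_pi_div_two_lt_arctan ((a - β) / |k|)
    linarith
  · have := (((hasDerivAt_id x).sub_const β).div_const |k|).arctan
    convert! this using 1
    simp only [id]
    rw [div_pow, sq_abs]
    field_simp
    rw [sq_abs]; ring

end Sg

end

section

namespace Sg
open Complex Set MeasureTheory Metric
set_option autoImplicit false

theorem blaschke_norm {c z ρ : ℂ} {R : ℝ} (hR : 0 < R) (hz : z ∈ sphere c R) :
    ‖((R : ℂ) ^ 2 - (z - c) * (starRingEnd ℂ) (ρ - c)) / R‖ = ‖z - ρ‖ := by
  have h1 : ‖z - c‖ = R := by simpa [dist_eq_norm] using hz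
  have h2 : (R : ℂ) ^ 2 = (z - c) * (starRingEnd ℂ) (z - c) := by
    rw [Complex.mul_conj, Complex.normSq_eq_norm_sq, h1]; push_cast; ring
  rw [h2, ← mul_sub, ← map_sub, norm_div, norm_mul, Complex.norm_conj, h1]
  have : (z - c - (ρ - c)) = z - ρ := by ring
  rw [this]
  simp [abs_of_pos hR]
  field_simp

theorem blaschke_lower {c z ρ : ℂ} {R r : ℝ} (hr : 0 < r) (hrR : r < R) (hz : ‖z - c‖ ≤ r)
    (hρ : ‖ρ - c‖ ≤ R) : R * (R - r) ≤ ‖(R : ℂ) ^ 2 - (z - c) * (starRingEnd ℂ) (ρ - c)‖ := by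
  have h1 : ‖(R : ℂ) ^ 2‖ - ‖(z - c) * (starRingEnd ℂ) (ρ - c)‖ ≤ _ := norm_sub_norm_le _ _
  refine le_trans ?_ h1
  rw [norm_mul, Complex.norm_conj, norm_pow, Complex.norm_real, Real.norm_eq_abs, sq_abs]
  have : ‖z - c‖ * ‖ρ - c‖ ≤ r * R := by gcongr
  nlinarith

/-- Disc lemma. -/
theorem disc_lemma {f : ℂ → ℂ} {c : ℂ} {r R R' M W a b : ℝ} (hr : 0 < r) (hrR : r < R) (hRR : R < R')
    (hM : 0 < M) (hf : DifferentiableOn ℂ f (ball c R')) (hfc : f c ≠ 0)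
    (hB : ∀ z ∈ closedBall c R, ‖f z‖ ≤ Real.exp M * ‖f c‖)
    (hab : a ≤ b) (hseg : ∀ x ∈ Icc a b, ‖(x + c.im * I : ℂ) - c‖ ≤ r)
    (hseg0 : ∀ x ∈ Icc a b, f (x + c.im * I) ≠ 0) (hW : ∀ x ∈ Icc a b, |x| ≤ W) :
    |hSide f a b c.im| ≤ 80 * W * M * (R / (R - r)) ^ 2 := by
  classical
  have hR : 0 < R := hr.trans hrR
  have hR' : 0 < R' := hR.trans hRR
  have hW0 : 0 ≤ W := (abs_nonneg a).trans (hW a ⟨le_rfl, hab⟩)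
  set δ := R - r with hδ
  have hδp : 0 < δ := by rw [hδ]; linarith
  set R1 := (r + R) / 2 with hR1
  have hR1R : R1 < R := by rw [hR1]; linarith
  have hrR1 : r < R1 := by rw [hR1]; linarith
  have hR1p : 0 < R1 := hr.trans hrR1
  have hcU : c ∈ ball c R' := mem_ball_self hR'
  have hpre : IsPreconnected (ball c R') := (convex_ball c R').isPreconnected
  have hfin := zeros_finite isOpen_ball hpre hf hcU hfc (isCompact_closedBall c R1)
    (closedBall_subset_ball (hR1R.trans hRR))
  set Z := hfin.toFinset with hZ
  have hZmem : ∀ z, z ∈ Z ↔ z ∈ closedBall c R1 ∧ f z = 0 := fun z => by simp [hZ]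
  have hZn : ∀ z ∈ Z, ‖z - c‖ ≤ R1 := fun z hz => by
    have := ((hZmem z).1 hz).1; rwa [mem_closedBall, dist_eq_norm] at this
  have hZU : ∀ z ∈ Z, z ∈ ball c R' := fun z hz => by
    rw [mem_ball, dist_eq_norm]; have := hZn z hz; linarith
  set m : ℂ → ℕ := fun ρ => analyticOrderNatAt f ρ with hm
  obtain ⟨h0, hh0, hfe, hne⟩ := factor_zeros isOpen_ball hf m Z hZU
    (fun ρ hρ => exists_local_factor isOpen_ball hpre hf hcU hfc (hZU ρ hρ))
  have hne' : ∀ z ∈ closedBall c R1, h0 z ≠ 0 := by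
    intro z hz h
    by_cases hzZ : z ∈ Z
    · exact hne z hzZ h
    · exact hzZ ((hZmem z).2 ⟨hz, by
        rw [hfe z (closedBall_subset_ball (hR1R.trans hRR) hz), h, mul_zero]⟩)
  set q : ℂ → ℂ → ℂ := fun ρ z => ((R : ℂ) ^ 2 - (z - c) * (starRingEnd ℂ) (ρ - c)) / R with hq
  have hqd : ∀ ρ, Differentiable ℂ (q ρ) := fun ρ => by rw [hq]; fun_prop
  have hq0 : ∀ ρ ∈ Z, ∀ z ∈ ball c R, q ρ z ≠ 0 := by
    intro ρ hρ z hz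
    rw [mem_ball, dist_eq_norm] at hz
    by_cases hz' : ‖z - c‖ = 0
    · have : z = c := by rwa [norm_eq_zero, sub_eq_zero] at hz'
      simp [hq, this, hR.ne']
    have := blaschke_lower (norm_pos_iff.2 (norm_ne_zero_iff.1 hz')) hz le_rfl ((hZn ρ hρ).trans hR1R.le)
    have h2 : 0 < R * (R - ‖z - c‖) := mul_pos hR (by linarith)
    refine div_ne_zero (fun h => ?_) (by exact_mod_cast hR.ne')
    rw [h] at this; simp at this; linarith
  set h : ℂ → ℂ := fun z => (∏ ρ ∈ Z, (q ρ z) ^ (m ρ)) * h0 z with hh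
  have hhd : DifferentiableOn ℂ h (ball c R') := by
    refine DifferentiableOn.mul (Differentiable.differentiableOn ?_) hh0
    exact Differentiable.fun_finset_prod fun ρ _ => (hqd ρ).pow _
  have hsph : ∀ z ∈ sphere c R, ‖h z‖ ≤ Real.exp M * ‖f c‖ := by
    intro z hz
    have : ‖h z‖ = ‖f z‖ := by
      rw [hfe z (sphere_subset_closedBall.trans (closedBall_subset_ball hRR) hz), hh]
      simp only [norm_mul, norm_prod, norm_pow]
      congr 1
      refine Finset.prod_congr rfl fun ρ _ => ?_
      rw [hq]; simp only; rw [blaschke_norm hR hz]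
    rw [this]; exact hB z (sphere_subset_closedBall hz)
  have hhB : ∀ z ∈ closedBall c R, ‖h z‖ ≤ Real.exp M * ‖f c‖ := fun z hz =>
    norm_le_on_ball hRR hR hhd hsph hz
  set n : ℕ := ∑ ρ ∈ Z, m ρ with hn
  have hnpos : 0 < ‖f c‖ := norm_pos_iff.2 hfc
  have hcount : (R / R1) ^ n * ‖f c‖ ≤ ‖h c‖ := by
    rw [hfe c hcU, hh]
    simp only [norm_mul, norm_prod, norm_pow]
    rw [← mul_assoc, hn, ← Finset.prod_pow_eq_pow_sum, ← Finset.prod_mul_distrib]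
    refine mul_le_mul_of_nonneg_right ?_ (norm_nonneg _)
    refine Finset.prod_le_prod (fun ρ _ => by positivity) fun ρ hρ => ?_
    rw [← mul_pow]
    have : ‖q ρ c‖ = R := by simp [hq, abs_of_pos hR]; field_simp
    rw [this]
    refine pow_le_pow_left₀ (by positivity) ?_ _
    rw [div_mul_eq_mul_div, div_le_iff₀ hR1p, norm_sub_rev]
    exact mul_le_mul_of_nonneg_left (hZn ρ hρ) hR.le
  have h1le : 1 ≤ R / R1 := by rw [le_div_iff₀ hR1p]; linarith
  have hfh : ‖f c‖ ≤ ‖h c‖ := by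
    refine le_trans ?_ hcount
    exact le_mul_of_one_le_left hnpos.le (one_le_pow₀ h1le)
  have hn2 : (n : ℝ) * (δ / (2 * R)) ≤ M := by
    have h2 : (R / R1) ^ n ≤ Real.exp M := by
      have := hcount.trans (hhB c (mem_closedBall_self hR.le))
      exact le_of_mul_le_mul_right this hnpos
    have h3 : (n : ℝ) * Real.log (R / R1) ≤ M := by
      have := Real.log_le_log (by positivity) h2
      rwa [Real.log_pow, Real.log_exp] at this
    have h4 : δ / (2 * R) ≤ Real.log (R / R1) := by
      have := Real.one_sub_inv_le_log_of_pos (show 0 < R / R1 by positivity)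
      refine le_trans (le_of_eq ?_) this
      rw [hδ, inv_div, hR1]; field_simp; ring
    exact (mul_le_mul_of_nonneg_left h4 (Nat.cast_nonneg _)).trans h3
  have hn3 : (n : ℝ) ≤ 2 * M * (R / δ) := by
    have e : (n : ℝ) = (n : ℝ) * (δ / (2 * R)) * (2 * (R / δ)) := by field_simp
    rw [e]
    calc _ ≤ M * (2 * (R / δ)) := mul_le_mul_of_nonneg_right hn2 (by positivity)
      _ = _ := by ring
  have hh0' : ∀ z ∈ ball c R1, h z ≠ 0 := by
    intro z hz
    refine mul_ne_zero (Finset.prod_ne_zero_iff.2 fun ρ hρ => pow_ne_zero _ ?_)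
      (hne' z (ball_subset_closedBall hz))
    exact hq0 ρ hρ z (ball_subset_ball hR1R.le hz)
  have hLh : ∀ z, ‖z - c‖ ≤ r → ‖logDeriv h z‖ ≤ 32 * M * R / δ ^ 2 := by
    intro z hz
    have := logDeriv_bound hr hrR1 hM (hhd.mono (ball_subset_ball (hR1R.trans hRR).le)) hh0'
      (fun w hw => (hhB w (ball_subset_closedBall.trans (closedBall_subset_closedBall hR1R.le) hw)).trans
        (mul_le_mul_of_nonneg_left hfh (Real.exp_pos _).le)) hz
    refine this.trans ?_
    have e : R1 - r = δ / 2 := by rw [hR1, hδ]; ring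
    rw [e]
    have e2 : 8 * M * R1 / (δ / 2) ^ 2 = 32 * M * R1 / δ ^ 2 := by field_simp; ring
    rw [e2]; gcongr
  have hLq : ∀ ρ ∈ Z, ∀ z, ‖z - c‖ ≤ r → ‖logDeriv (q ρ) z‖ ≤ 1 / δ := by
    intro ρ hρ z hz
    have hder : deriv (q ρ) z = -(starRingEnd ℂ) (ρ - c) / R := by
      have : HasDerivAt (q ρ) ((-(1 * (starRingEnd ℂ) (ρ - c))) / R) z :=
        ((((hasDerivAt_id z).sub_const c).mul_const _).const_sub _).div_const _
      rw [this.deriv, one_mul]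
    rw [logDeriv_apply, hder, hq]
    simp only
    rw [div_div_div_cancel_right₀ (by exact_mod_cast hR.ne'), norm_div, norm_neg, Complex.norm_conj]
    have h1 := blaschke_lower hr hrR hz ((hZn ρ hρ).trans hR1R.le)
    rw [div_le_div_iff₀ (lt_of_lt_of_le (by positivity) h1) hδp, one_mul]
    refine le_trans ?_ h1
    exact mul_le_mul_of_nonneg_right ((hZn ρ hρ).trans hR1R.le) hδp.le
  -- formula for the logarithmic derivative
  have hLf : ∀ z, ‖z - c‖ ≤ r → f z ≠ 0 → logDeriv f z =
      (∑ ρ ∈ Z, (m ρ : ℂ) * (z - ρ)⁻¹) + logDeriv h z - ∑ ρ ∈ Z, (m ρ : ℂ) * logDeriv (q ρ) z := by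
    intro z hz hfz
    have hzU : z ∈ ball c R' := by rw [mem_ball, dist_eq_norm]; linarith
    have hzR : z ∈ ball c R := by rw [mem_ball, dist_eq_norm]; linarith
    have hzR1 : z ∈ closedBall c R1 := by rw [mem_closedBall, dist_eq_norm]; linarith
    have hzZ : z ∉ Z := fun hz' => hfz ((hZmem z).1 hz').2
    rw [logDeriv_factor isOpen_ball m Z hh0 hfe hzU hzZ (hne' z hzR1)]
    have hpq : ∀ ρ ∈ Z, (q ρ z) ^ (m ρ) ≠ 0 := fun ρ hρ => pow_ne_zero _ (hq0 ρ hρ z hzR)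
    have e1 : logDeriv h z = (∑ ρ ∈ Z, (m ρ : ℂ) * logDeriv (q ρ) z) + logDeriv h0 z := by
      rw [hh, logDeriv_mul (f := fun z => ∏ ρ ∈ Z, (q ρ z) ^ (m ρ)) z
        (Finset.prod_ne_zero_iff.2 hpq) (hne' z hzR1)
        (Differentiable.fun_finset_prod fun ρ _ => (hqd ρ).pow _).differentiableAt
        (hh0.differentiableAt (isOpen_ball.mem_nhds hzU))]
      congr 1
      rw [logDeriv_prod (f := fun ρ z => (q ρ z) ^ (m ρ)) hpq
        (fun ρ _ => ((hqd ρ).pow _).differentiableAt)]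
      exact Finset.sum_congr rfl fun ρ _ => logDeriv_fun_pow (hqd ρ).differentiableAt (m ρ)
    rw [e1]; ring
  set T := c.im with hT
  set K : ℝ := 32 * M * R / δ ^ 2 + n * (1 / δ) with hK
  have hpt : ∀ x ∈ Icc a b, |x * (logDeriv f (x + T * I)).im| ≤
      W * ((∑ ρ ∈ Z, (m ρ : ℝ) * (|T - ρ.im| / ((x - ρ.re) ^ 2 + (T - ρ.im) ^ 2))) + K) := by
    intro x hx
    rw [abs_mul]
    refine mul_le_mul (hW x hx) ?_ (abs_nonneg _) hW0
    rw [hLf _ (hseg x hx) (hseg0 x hx), sub_im, add_im, im_sum, im_sum]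
    have h1 : |∑ ρ ∈ Z, ((m ρ : ℂ) * (x + T * I - ρ : ℂ)⁻¹).im| ≤
        ∑ ρ ∈ Z, (m ρ : ℝ) * (|T - ρ.im| / ((x - ρ.re) ^ 2 + (T - ρ.im) ^ 2)) := by
      refine (Finset.abs_sum_le_sum_abs _ _).trans (Finset.sum_le_sum fun ρ _ => ?_)
      rw [← ofReal_natCast, im_ofReal_mul, abs_mul, abs_inv_im, Nat.abs_cast]
    have h2 : |(logDeriv h (x + T * I)).im| ≤ 32 * M * R / δ ^ 2 :=
      (Complex.abs_im_le_norm _).trans (hLh _ (hseg x hx))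
    have h3 : |∑ ρ ∈ Z, ((m ρ : ℂ) * logDeriv (q ρ) (x + T * I)).im| ≤ n * (1 / δ) := by
      refine (Finset.abs_sum_le_sum_abs _ _).trans ?_
      rw [hn]; push_cast
      rw [Finset.sum_mul]
      refine Finset.sum_le_sum fun ρ hρ => ?_
      rw [← ofReal_natCast, im_ofReal_mul, abs_mul, Nat.abs_cast]
      exact mul_le_mul_of_nonneg_left
        ((Complex.abs_im_le_norm _).trans (hLq ρ hρ _ (hseg x hx))) (Nat.cast_nonneg _)
    rw [hK]
    refine (abs_sub _ _).trans ?_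
    refine (add_le_add (abs_add_le _ _) le_rfl).trans ?_
    linarith
  have hii : ∀ ρ ∈ Z, IntervalIntegrable (fun x : ℝ => (m ρ : ℝ) *
      (|T - ρ.im| / ((x - ρ.re) ^ 2 + (T - ρ.im) ^ 2))) volume a b := fun ρ _ =>
    (poisson_int a b (T - ρ.im) ρ.re hab).1.const_mul _
  have hiis : IntervalIntegrable (fun x : ℝ => ∑ ρ ∈ Z, (m ρ : ℝ) *
      (|T - ρ.im| / ((x - ρ.re) ^ 2 + (T - ρ.im) ^ 2))) volume a b := by
    have := IntervalIntegrable.sum Z hii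
    simpa only [Finset.sum_fn] using this
  have hbound : |hSide f a b T| ≤ ∫ x in a..b,
      W * ((∑ ρ ∈ Z, (m ρ : ℝ) * (|T - ρ.im| / ((x - ρ.re) ^ 2 + (T - ρ.im) ^ 2))) + K) := by
    have := intervalIntegral.norm_integral_le_of_norm_le (μ := volume) hab
      (f := fun x : ℝ => x * (logDeriv f (x + T * I)).im)
      (g := fun x => W * ((∑ ρ ∈ Z, (m ρ : ℝ) *
        (|T - ρ.im| / ((x - ρ.re) ^ 2 + (T - ρ.im) ^ 2))) + K))
      (Filter.Eventually.of_forall fun x hx => hpt x ⟨hx.1.le, hx.2⟩)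
      ((hiis.add intervalIntegrable_const).const_mul _)
    exact this
  refine hbound.trans ?_
  rw [intervalIntegral.integral_const_mul, intervalIntegral.integral_add hiis intervalIntegrable_const,
    intervalIntegral.integral_finsetSum hii]
  have hs : ∑ ρ ∈ Z, ∫ x in a..b, (m ρ : ℝ) * (|T - ρ.im| / ((x - ρ.re) ^ 2 + (T - ρ.im) ^ 2)) ≤
      n * Real.pi := by
    rw [hn]; push_cast; rw [Finset.sum_mul]
    refine Finset.sum_le_sum fun ρ _ => ?_
    rw [intervalIntegral.integral_const_mul]
    exact mul_le_mul_of_nonneg_left (poisson_int a b (T - ρ.im) ρ.re hab).2 (Nat.cast_nonneg _)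
  have hba : b - a ≤ 2 * R := by
    have h1 := (Complex.abs_re_le_norm _).trans (hseg a ⟨le_rfl, hab⟩)
    have h2 := (Complex.abs_re_le_norm _).trans (hseg b ⟨hab, le_rfl⟩)
    simp at h1 h2
    have := abs_le.1 h1; have := abs_le.1 h2
    linarith
  set X := R / δ with hX
  have hX1 : 1 ≤ X := by rw [hX, le_div_iff₀ hδp, hδ]; linarith
  have hKb : (b - a) * K ≤ 68 * M * X ^ 2 := by
    have hK0 : 0 ≤ K := by rw [hK]; positivity
    calc (b - a) * K ≤ 2 * R * K := mul_le_mul_of_nonneg_right hba hK0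
      _ ≤ 2 * R * (32 * M * R / δ ^ 2 + 2 * M * (R / δ) * (1 / δ)) := by
        rw [hK]; gcongr
      _ = 68 * M * X ^ 2 := by rw [hX]; field_simp; ring
  have hpi : (n : ℝ) * Real.pi ≤ 8 * M * X ^ 2 := by
    have h4 : Real.pi ≤ 4 := Real.pi_le_four
    have hXX : X ≤ X ^ 2 := by nlinarith
    calc (n : ℝ) * Real.pi ≤ (2 * M * X) * 4 := by gcongr
      _ = 8 * M * X := by ring
      _ ≤ _ := by gcongr
  rw [intervalIntegral.integral_const, smul_eq_mul]
  calc _ ≤ W * (8 * M * X ^ 2 + 68 * M * X ^ 2) := by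
        refine mul_le_mul_of_nonneg_left (add_le_add (hs.trans hpi) hKb) hW0
    _ ≤ 80 * W * M * X ^ 2 := by
      have : 0 ≤ W * M * X ^ 2 := by positivity
      nlinarith

end Sg

end

section

namespace Sg
open Complex Set MeasureTheory Metric Filter Topology
set_option autoImplicit false

/-- Shifting a horizontal line of integration. -/
theorem strip_limit {f : ℂ → ℂ} {a b : ℝ} {K : ℂ} (hab : a ≤ b)
    (hrect : ∀ᶠ X : ℝ in atTop, rectInt f (-X) X a b = K)
    (ha : Integrable fun x : ℝ => f (x + a * I)) (hb : Integrable fun x : ℝ => f (x + b * I))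
    (B : ℝ → ℝ) (hB : Tendsto B atTop (𝓝 0))
    (hfB : ∀ᶠ X : ℝ in atTop, ∀ y ∈ Icc a b, ‖f (X + y * I)‖ ≤ B X ∧ ‖f (((-X : ℝ) : ℂ) + y * I)‖ ≤ B X) :
    (∫ x : ℝ, f (x + a * I)) - (∫ x : ℝ, f (x + b * I)) = K := by
  have h1 : Tendsto (fun X : ℝ => ∫ x in (-X)..X, f (x + a * I)) atTop (𝓝 (∫ x : ℝ, f (x + a * I))) :=
    intervalIntegral_tendsto_integral ha tendsto_neg_atTop_atBot tendsto_id
  have h2 : Tendsto (fun X : ℝ => ∫ x in (-X)..X, f (x + b * I)) atTop (𝓝 (∫ x : ℝ, f (x + b * I))) :=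
    intervalIntegral_tendsto_integral hb tendsto_neg_atTop_atBot tendsto_id
  have hB' : Tendsto (fun X => B X * |b - a|) atTop (𝓝 0) := by simpa using hB.mul_const |b - a|
  have h3 : Tendsto (fun X : ℝ => ∫ y in a..b, f (X + y * I)) atTop (𝓝 0) := by
    refine squeeze_zero_norm' ?_ hB'
    filter_upwards [hfB] with X hX
    refine intervalIntegral.norm_integral_le_of_norm_le_const fun y hy => (hX y ?_).1
    rw [uIoc_of_le hab] at hy; exact ⟨hy.1.le, hy.2⟩
  have h4 : Tendsto (fun X : ℝ => ∫ y in a..b, f (((-X : ℝ) : ℂ) + y * I)) atTop (𝓝 0) := by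
    refine squeeze_zero_norm' ?_ hB'
    filter_upwards [hfB] with X hX
    refine intervalIntegral.norm_integral_le_of_norm_le_const fun y hy => (hX y ?_).2
    rw [uIoc_of_le hab] at hy; exact ⟨hy.1.le, hy.2⟩
  have h5 := ((h1.sub h2).add (h3.const_mul I)).sub (h4.const_mul I)
  have h6 : Tendsto (fun X : ℝ => rectInt f (-X) X a b) atTop (𝓝 K) :=
    tendsto_const_nhds.congr' (hrect.mono fun X hX => hX.symm)
  have := tendsto_nhds_unique h6 h5
  rw [this]; simp

/-- Closed strip. -/
def cstrip (a b : ℝ) : Set ℂ := {z | a ≤ z.im ∧ z.im ≤ b}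
/-- Open strip. -/
def ostrip (a b : ℝ) : Set ℂ := {z | a < z.im ∧ z.im < b}

theorem strip_rect {h : ℂ → ℂ} {a b : ℝ} (hab : a ≤ b) (hc : ContinuousOn h (cstrip a b))
    (hd : DifferentiableOn ℂ h (ostrip a b)) {X : ℝ} (hX : 0 ≤ X) : rectInt h (-X) X a b = 0 := by
  refine rectInt_eq_zero h (by linarith) hab (hc.mono ?_) (hd.mono ?_)
  · rw [← crect_eq (by linarith) hab]; exact fun z hz => ⟨hz.2.2.1, hz.2.2.2⟩
  · intro z hz; rw [mem_reProdIm] at hz; exact ⟨hz.2.1, hz.2.2⟩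

theorem strip_rect_pole {f h : ℂ → ℂ} {a b : ℝ} {r p : ℂ} (hap : a < p.im) (hpb : p.im < b)
    (hc : ContinuousOn h (cstrip a b)) (hd : DifferentiableOn ℂ h (ostrip a b))
    (hf : ∀ z ∈ cstrip a b, z ≠ p → f z = r * (z - p)⁻¹ + h z) :
    ∀ᶠ X : ℝ in atTop, rectInt f (-X) X a b = 2 * Real.pi * I * r := by
  have hab : a ≤ b := (hap.trans hpb).le
  filter_upwards [eventually_gt_atTop |p.re|] with X hX
  have hX0 : 0 < X := (abs_nonneg _).trans_lt hX
  have hX' := abs_lt.1 hX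
  have hsub : ∀ z ∈ rbdry (-X) X a b, z ≠ p := by
    rintro z ⟨_, hz⟩ rfl
    rcases hz with h | h | h | h <;> linarith
  have hin : rbdry (-X) X a b ⊆ cstrip a b := fun z hz => ⟨hz.1.2.2.1, hz.1.2.2.2⟩
  rw [rectInt_congr (g := fun z => r * (z - p)⁻¹ + h z) (by linarith) hab
    (fun z hz => hf z (hin hz) (hsub z hz)), rectInt_add (f := fun z => r * (z - p)⁻¹) (by linarith) hab ?_ (hc.mono hin),
    rectInt_const_mul, rectInt_inv p hX'.1 hX'.2 hap hpb, strip_rect hab hc hd hX0.le]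
  · ring
  · exact continuousOn_const.mul (ContinuousOn.inv₀ (by fun_prop) fun z hz =>
      sub_ne_zero.2 (hsub z hz))

end Sg

end

section

namespace Sg
open Complex Set MeasureTheory Metric Filter Topology
set_option autoImplicit false

/-- `e^{iπ/4}`. -/
noncomputable def kap : ℂ := Complex.exp (Real.pi * Complex.I / 4)

theorem kap_eq : kap = ((√2 / 2 : ℝ) : ℂ) + ((√2 / 2 : ℝ) : ℂ) * I := by
  have : (Real.pi * I / 4 : ℂ) = ((Real.pi / 4 : ℝ) : ℂ) * I := by push_cast; ring
  rw [kap, this, Complex.exp_mul_I, ← ofReal_cos, ← ofReal_sin, Real.cos_pi_div_four,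
    Real.sin_pi_div_four]
theorem kap_re : kap.re = √2 / 2 := by rw [kap_eq]; simp
theorem kap_im : kap.im = √2 / 2 := by rw [kap_eq]; simp
theorem kap_norm : ‖kap‖ = 1 := by
  have : (Real.pi * I / 4 : ℂ) = ((Real.pi / 4 : ℝ) : ℂ) * I := by push_cast; ring
  rw [kap, this, Complex.norm_exp_ofReal_mul_I]
theorem kap_ne : kap ≠ 0 := Complex.exp_ne_zero _
theorem kap_sq : kap ^ 2 = I := by
  rw [kap, ← Complex.exp_nat_mul]
  have : ((2 : ℕ) * (Real.pi * I / 4) : ℂ) = Real.pi / 2 * I := by push_cast; ring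
  rw [this, Complex.exp_pi_div_two_mul_I]

/-- The denominator `e^{πix} - e^{-πix}`. -/
noncomputable def den (x : ℂ) : ℂ :=
  Complex.exp (Real.pi * Complex.I * x) - Complex.exp (-(Real.pi * Complex.I * x))

/-- The integrand. -/
noncomputable def Qf (s x : ℂ) : ℂ := x ^ (-s) * Complex.exp (Real.pi * Complex.I * x ^ 2) / den x

/-- The integral over the slope one line through `c`. -/
noncomputable def Lint (s : ℂ) (c : ℝ) : ℂ := kap * ∫ u : ℝ, Qf s (c + kap * u)

theorem R_eq_Lint (s : ℂ) : RiemannR s = -Lint s (1 / 2 : ℝ) := by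
  unfold RiemannR Lint
  rw [← integral_neg_eq_self (fun u : ℝ => Qf s (((1 / 2 : ℝ) : ℂ) + kap * u)), neg_mul]
  congr 2
  refine integral_congr_ae (Eventually.of_forall fun u => ?_)
  have : rline u = ((1 / 2 : ℝ) : ℂ) + kap * ((-u : ℝ) : ℂ) := by
    unfold rline kap; push_cast; ring
  simp only [Qf, den, ← this]

theorem kz_re (v y : ℝ) : (kap * (v + y * I)).re = √2 / 2 * (v - y) := by
  simp [kap_re, kap_im]; ring
theorem kz_im (v y : ℝ) : (kap * (v + y * I)).im = √2 / 2 * (v + y) := by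
  simp [kap_re, kap_im]; ring

theorem den_lower (x : ℂ) : Real.exp (Real.pi * |x.im|) - 1 ≤ ‖den x‖ := by
  have h1 : ‖Complex.exp (Real.pi * I * x)‖ = Real.exp (-(Real.pi * x.im)) := by
    rw [Complex.norm_exp]; simp
  have h2 : ‖Complex.exp (-(Real.pi * I * x))‖ = Real.exp (Real.pi * x.im) := by
    rw [Complex.norm_exp]; simp
  unfold den
  have hp := Real.pi_pos
  rcases le_total 0 x.im with h | h
  · rw [abs_of_nonneg h, norm_sub_rev]
    have := norm_sub_norm_le (Complex.exp (-(Real.pi * I * x))) (Complex.exp (Real.pi * I * x))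
    rw [h1, h2] at this
    have : Real.exp (-(Real.pi * x.im)) ≤ 1 := Real.exp_le_one_iff.2 (by nlinarith)
    linarith
  · rw [abs_of_nonpos h]
    have := norm_sub_norm_le (Complex.exp (Real.pi * I * x)) (Complex.exp (-(Real.pi * I * x)))
    rw [h1, h2] at this
    have h3 : Real.exp ((Real.pi * x.im)) ≤ 1 := Real.exp_le_one_iff.2 (by nlinarith)
    rw [mul_neg]; linarith

theorem den_ne_zero {x : ℂ} (hx : ∀ n : ℤ, x ≠ n) : den x ≠ 0 := by
  intro h
  rw [den, sub_eq_zero, Complex.exp_eq_exp_iff_exists_int] at h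
  obtain ⟨n, hn⟩ := h
  have hpi : (Real.pi : ℂ) ≠ 0 := by exact_mod_cast Real.pi_ne_zero
  refine hx n ?_
  have : (2 * Real.pi * I) * (x - n) = 0 := by linear_combination hn
  have h2 := (mul_eq_zero.1 this).resolve_left (by simp [hpi])
  exact sub_eq_zero.1 h2

theorem norm_cpow_neg (s x : ℂ) (hx : x ≠ 0) :
    ‖x ^ (-s)‖ = Real.exp (-s.re * Real.log ‖x‖ + s.im * arg x) := by
  rw [cpow_def_of_ne_zero hx, Complex.norm_exp]
  congr 1
  simp [log_re, log_im]; ring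

theorem norm_gauss (v y : ℝ) : ‖Complex.exp (Real.pi * I * (kap * (v + y * I)) ^ 2)‖ =
    Real.exp (-(Real.pi * (v ^ 2 - y ^ 2))) := by
  have : (Real.pi * I * (kap * (v + y * I)) ^ 2 : ℂ) = -(Real.pi * (v + y * I) ^ 2) := by
    rw [mul_pow, kap_sq]; linear_combination (Real.pi * (v + y * I) ^ 2 : ℂ) * I_sq
  rw [this, Complex.norm_exp]
  congr 1
  simp [pow_two]

theorem Qf_tail (s : ℂ) (Y : ℝ) (hY : 0 ≤ Y) : ∃ K : ℝ, 0 ≤ K ∧ ∀ v y : ℝ, |y| ≤ Y → Y + 1 ≤ |v| →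
    ‖Qf s (kap * (v + y * I))‖ ≤ K * Real.exp (-v ^ 2) := by
  refine ⟨Real.exp (|s.re| * Y + |s.im| * Real.pi + Real.pi * Y ^ 2 + |s.re| ^ 2), (Real.exp_pos _).le,
    fun v y hy hv => ?_⟩
  set x : ℂ := kap * (v + y * I) with hx
  have hxn : ‖x‖ = ‖(v + y * I : ℂ)‖ := by rw [hx, norm_mul, kap_norm, one_mul]
  have hx1 : |v| ≤ ‖x‖ := by
    rw [hxn]; have := Complex.abs_re_le_norm (v + y * I : ℂ); simpa using this
  have hx2 : ‖x‖ ≤ |v| + Y := by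
    rw [hxn]; refine (norm_add_le _ _).trans ?_; simp; exact hy
  have hxp : 1 ≤ ‖x‖ := by linarith
  have hx0 : x ≠ 0 := norm_pos_iff.1 (by linarith)
  have hden : 1 ≤ ‖den x‖ := by
    refine le_trans ?_ (den_lower x)
    have h1 : |x.im| = √2 / 2 * |v + y| := by
      rw [hx, kz_im, abs_mul, abs_of_nonneg (by positivity)]
    have h2 : 1 ≤ |v + y| := by
      have := abs_sub_abs_le_abs_sub v (-y)
      rw [abs_neg, sub_neg_eq_add] at this; linarith
    have h3 : (1 : ℝ) ≤ √2 := Real.one_le_sqrt.2 (by norm_num)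
    have h4 : 1 ≤ Real.pi * |x.im| := by
      rw [h1]
      have hpi := Real.pi_gt_three
      have h5 : 1 / 2 ≤ √2 / 2 * |v + y| := by nlinarith
      nlinarith
    have := Real.add_one_le_exp (Real.pi * |x.im|)
    linarith
  have hlog : |Real.log ‖x‖| ≤ |v| + Y := by
    rw [abs_of_nonneg (Real.log_nonneg hxp)]
    have := Real.log_le_sub_one_of_pos (by linarith : 0 < ‖x‖)
    linarith
  have harg := Complex.abs_arg_le_pi x
  rw [Qf, norm_div, norm_mul, norm_cpow_neg s x hx0, norm_gauss, ← Real.exp_add, ← Real.exp_add]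
  refine (div_le_self (Real.exp_pos _).le hden).trans (Real.exp_le_exp.2 ?_)
  have e1 : -s.re * Real.log ‖x‖ ≤ |s.re| * (|v| + Y) := by
    refine (le_abs_self _).trans ?_
    rw [abs_mul, abs_neg]; gcongr
  have e2 : s.im * arg x ≤ |s.im| * Real.pi := by
    refine (le_abs_self _).trans ?_
    rw [abs_mul]; gcongr
  have e3 : y ^ 2 ≤ Y ^ 2 := by rw [← sq_abs y]; gcongr
  have hpi := Real.pi_gt_three
  have e4 : v ^ 2 = |v| ^ 2 := (sq_abs v).symm
  nlinarith [sq_nonneg (|s.re| - |v|), sq_nonneg v, sq_nonneg y]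

theorem integrable_of_tail {f : ℝ → ℂ} (hf : Continuous f) {K V : ℝ}
    (h : ∀ v : ℝ, V ≤ |v| → ‖f v‖ ≤ K * Real.exp (-v ^ 2)) : Integrable f := by
  have hg : Integrable (fun v : ℝ => K * Real.exp (-v ^ 2)) := by
    have := (integrable_exp_neg_mul_sq (one_pos)).const_mul K
    simpa using this
  have hO1 : f =O[atTop] (fun v : ℝ => K * Real.exp (-v ^ 2)) := by
    refine Asymptotics.IsBigO.of_bound 1 ?_
    filter_upwards [eventually_ge_atTop V] with v hv
    rw [one_mul]
    exact (h v (hv.trans (le_abs_self v))).trans (le_abs_self _)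
  have hO2 : f =O[atBot] (fun v : ℝ => K * Real.exp (-v ^ 2)) := by
    refine Asymptotics.IsBigO.of_bound 1 ?_
    filter_upwards [eventually_le_atBot (-V)] with v hv
    rw [one_mul]
    exact (h v (by rw [← abs_neg]; exact (le_neg.2 hv).trans (le_abs_self _))).trans (le_abs_self _)
  exact hf.locallyIntegrable.integrable_of_isBigO_atBot_atTop hO2
    (hg.integrableAtFilter _) hO1 (hg.integrableAtFilter _)

theorem Qf_continuousAt (s : ℂ) {x : ℂ} (hx : x ∈ slitPlane) (hd : den x ≠ 0) :
    ContinuousAt (Qf s) x := by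
  unfold Qf
  refine ContinuousAt.div (ContinuousAt.mul ?_ (by fun_prop)) (by unfold den; fun_prop) hd
  exact ContinuousAt.cpow continuousAt_id continuousAt_const hx

theorem slit_of_pos {x : ℂ} (h : 0 < x.re - x.im) : x ∈ slitPlane := by
  by_cases him : x.im = 0
  · left; linarith
  · right; exact him

theorem den_ne_of_frac {x : ℂ} {n : ℤ} (h1 : (n : ℝ) < x.re - x.im) (h2 : x.re - x.im < n + 1) :
    den x ≠ 0 := by
  refine den_ne_zero fun k hk => ?_
  rw [hk] at h1 h2
  simp at h1 h2
  have h3 : k < n + 1 := by exact_mod_cast h2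
  omega

theorem kz_diff (v y : ℝ) : (kap * (v + y * I)).re - (kap * (v + y * I)).im = -(√2 * y) := by
  rw [kz_re, kz_im]; ring

/-- change to the rotated coordinate -/
theorem line_eq (c u : ℝ) : (c : ℂ) + kap * u =
    kap * (((u + c / √2 : ℝ) : ℂ) + ((-(c / √2) : ℝ) : ℂ) * I) := by
  have h2 : √2 ≠ 0 := by positivity
  have hs : √2 * √2 = 2 := Real.mul_self_sqrt (by norm_num)
  apply Complex.ext
  · rw [kz_re]; simp [kap_re]; field_simp; nlinarith
  · rw [kz_im]; simp [kap_im]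

theorem Lint_eq (s : ℂ) (c : ℝ) :
    Lint s c = kap * ∫ v : ℝ, Qf s (kap * (v + ((-(c / √2) : ℝ) : ℂ) * I)) := by
  unfold Lint
  congr 1
  simp_rw [line_eq]
  exact integral_add_right_eq_self (fun v : ℝ => Qf s (kap * (v + ((-(c / √2) : ℝ) : ℂ) * I))) (c / √2)

theorem Qf_integrable (s : ℂ) {y : ℝ} {n : ℕ} (h1 : (n : ℝ) < -(√2 * y)) (h2 : -(√2 * y) < n + 1) :
    Integrable fun v : ℝ => Qf s (kap * (v + y * I)) := by
  obtain ⟨K, _, hK⟩ := Qf_tail s |y| (abs_nonneg y)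
  refine integrable_of_tail ?_ (fun v hv => hK v y le_rfl hv)
  refine continuous_iff_continuousAt.2 fun v => ?_
  have hn : (0 : ℝ) ≤ n := Nat.cast_nonneg n
  have : ContinuousAt (Qf s) (kap * (v + y * I)) :=
    Qf_continuousAt s (slit_of_pos (by rw [kz_diff]; linarith))
      (den_ne_of_frac (n := (n : ℤ)) (by rw [kz_diff]; exact_mod_cast h1)
        (by rw [kz_diff]; exact_mod_cast h2))
  exact ContinuousAt.comp (f := fun v : ℝ => kap * ((v : ℂ) + y * I)) this (by fun_prop)

end Sg

end

section

namespace Sg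
open Complex Set MeasureTheory Metric Filter Topology
set_option autoImplicit false

theorem den_hasDerivAt (x : ℂ) : HasDerivAt den (Real.pi * I *
    (Complex.exp (Real.pi * Complex.I * x) + Complex.exp (-(Real.pi * Complex.I * x)))) x := by
  have h1 : HasDerivAt (fun x : ℂ => Real.pi * I * x) (Real.pi * I) x := by
    simpa using (hasDerivAt_id x).const_mul (Real.pi * I : ℂ)
  have := h1.cexp.sub h1.neg.cexp
  unfold den
  convert! this using 1
  simp only [Pi.neg_apply]; ring

theorem den_differentiable : Differentiable ℂ den := fun x => (den_hasDerivAt x).differentiableAt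

theorem exp_pi_nat (n : ℕ) : Complex.exp (Real.pi * I * n) = (-1) ^ n := by
  rw [mul_comm, Complex.exp_nat_mul, Complex.exp_pi_mul_I]

theorem den_nat (n : ℕ) : den n = 0 := by
  rw [den, Complex.exp_neg, exp_pi_nat]
  rcases Nat.even_or_odd n with h | h <;> simp [h]

theorem den_deriv_nat (n : ℕ) : deriv den n = 2 * Real.pi * I * (-1) ^ n := by
  rw [(den_hasDerivAt n).deriv, Complex.exp_neg, exp_pi_nat]
  rcases Nat.even_or_odd n with h | h <;> simp [h] <;> ring

/-- the open strip around `n` -/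
def nstrip (n : ℕ) : Set ℂ := {x | (n : ℝ) - 1 < x.re - x.im ∧ x.re - x.im < n + 1}

theorem nstrip_open (n : ℕ) : IsOpen (nstrip n) := by
  have h : Continuous fun x : ℂ => x.re - x.im := continuous_re.sub continuous_im
  exact (isOpen_lt continuous_const h).inter (isOpen_lt h continuous_const)

theorem Qf_pole (s : ℂ) {n : ℕ} (hn : 1 ≤ n) : ∃ h : ℂ → ℂ, DifferentiableOn ℂ h (nstrip n) ∧
    ∀ x ∈ nstrip n, x ≠ n → Qf s x = (n : ℂ) ^ (-s) / (2 * Real.pi * I) * (x - n)⁻¹ + h x := by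
  set d := dslope den n with hd
  have hnm : (n : ℂ) ∈ nstrip n := by simp [nstrip]
  have hdd : DifferentiableOn ℂ d (nstrip n) :=
    (differentiableOn_dslope ((nstrip_open n).mem_nhds hnm)).2 den_differentiable.differentiableOn
  have hd0 : d n = 2 * Real.pi * I * (-1) ^ n := by rw [hd, dslope_same, den_deriv_nat]
  have hpi : (2 * Real.pi * I : ℂ) ≠ 0 := by simp [Real.pi_ne_zero]
  have hdx : ∀ x, den x = (x - n) * d x := by
    intro x
    have := sub_smul_dslope den (n : ℂ) x
    rw [den_nat, sub_zero, smul_eq_mul] at this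
    exact this.symm
  have hdne : ∀ x ∈ nstrip n, d x ≠ 0 := by
    intro x hx
    by_cases hxn : x = n
    · rw [hxn, hd0]; exact mul_ne_zero hpi (by simp)
    · intro h0
      have h1 : den x = 0 := by rw [hdx, h0, mul_zero]
      refine den_ne_zero (fun k hk => hxn ?_) h1
      rw [hk] at hx ⊢
      obtain ⟨h2, h3⟩ := hx
      simp at h2 h3
      have h4 : k < (n : ℤ) + 1 := by exact_mod_cast h3
      have h5 : (n : ℤ) < k + 1 := by have : (n : ℝ) < k + 1 := by linarith
                                      exact_mod_cast this
      have : k = n := by omega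
      rw [this]; simp
  have hn1 : (1 : ℝ) ≤ n := by exact_mod_cast hn
  set G : ℂ → ℂ := fun x => x ^ (-s) * Complex.exp (Real.pi * Complex.I * x ^ 2) / d x with hG
  have hGd : DifferentiableOn ℂ G (nstrip n) := by
    intro x hx
    have hsl : x ∈ slitPlane := slit_of_pos (by have := hx.1; linarith)
    have hda : DifferentiableAt ℂ d x := hdd.differentiableAt ((nstrip_open n).mem_nhds hx)
    refine (DifferentiableAt.div (DifferentiableAt.mul ?_ (by fun_prop)) hda
      (hdne x hx)).differentiableWithinAt
    exact differentiableAt_id.cpow (differentiableAt_const _) hsl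
  have hGn : G n = (n : ℂ) ^ (-s) / (2 * Real.pi * I) := by
    have e1 : (Real.pi * I * (n : ℂ) ^ 2) = Real.pi * I * ((n ^ 2 : ℕ) : ℂ) := by push_cast; ring
    have e2 : ((-1 : ℂ)) ^ (n ^ 2) = (-1) ^ n := by
      rcases Nat.even_or_odd n with h | h
      · rw [Even.neg_one_pow (h.pow_of_ne_zero (by norm_num)), h.neg_one_pow]
      · rw [Odd.neg_one_pow h.pow, h.neg_one_pow]
    simp only [hG]
    rw [hd0, e1, exp_pi_nat, e2]
    have : ((-1 : ℂ)) ^ n ≠ 0 := by simp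
    field_simp
  refine ⟨dslope G n, (differentiableOn_dslope ((nstrip_open n).mem_nhds hnm)).2 hGd, ?_⟩
  intro x hx hxn
  have hxn' : x - n ≠ 0 := sub_ne_zero.2 hxn
  have e1 := sub_smul_dslope G (n : ℂ) x
  rw [smul_eq_mul] at e1
  have e2 : Qf s x = G x * (x - n)⁻¹ := by
    rw [Qf, hdx]; simp only [hG]
    have := hdne x hx
    field_simp
  rw [e2, ← hGn]
  field_simp
  linear_combination -e1

theorem Lint_step (s : ℂ) {n : ℕ} (hn : 1 ≤ n) :
    Lint s (n + 1 / 2 : ℝ) - Lint s (n - 1 / 2 : ℝ) = (n : ℂ) ^ (-s) := by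
  obtain ⟨h, hh, hQ⟩ := Qf_pole s hn
  have hs2 : (0 : ℝ) < √2 := by positivity
  have hss : √2 * √2 = 2 := Real.mul_self_sqrt (by norm_num)
  have hn1 : (1 : ℝ) ≤ n := by exact_mod_cast hn
  set a : ℝ := -((n + 1 / 2 : ℝ) / √2) with ha
  set b : ℝ := -((n - 1 / 2 : ℝ) / √2) with hb
  have hab : a ≤ b := by rw [ha, hb]; gcongr; linarith
  have hka : -(√2 * a) = n + 1 / 2 := by rw [ha]; field_simp
  have hkb : -(√2 * b) = n - 1 / 2 := by rw [hb]; field_simp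
  rw [Lint_eq, Lint_eq, ← mul_sub, ← ha, ← hb]
  set p : ℂ := kap⁻¹ * n with hp
  have hkp : kap * p = n := by rw [hp, mul_inv_cancel_left₀ kap_ne]
  have hpim : p.im = -(n / √2) := by
    have h1 := kz_diff p.re p.im
    rw [re_add_im, hkp] at h1
    simp at h1
    field_simp; linarith
  have hmaps : ∀ z ∈ cstrip a b, kap * z ∈ nstrip n := by
    rintro z ⟨h1, h2⟩
    have e := kz_diff z.re z.im
    rw [re_add_im] at e
    change (n : ℝ) - 1 < (kap * z).re - (kap * z).im ∧ (kap * z).re - (kap * z).im < n + 1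
    rw [e]
    have e1 : √2 * a ≤ √2 * z.im := by gcongr
    have e2 : √2 * z.im ≤ √2 * b := by gcongr
    constructor <;> linarith
  have hpole := strip_rect_pole (f := fun z => Qf s (kap * z)) (h := fun z => h (kap * z))
    (r := (n : ℂ) ^ (-s) / (2 * Real.pi * I) * kap⁻¹) (p := p) (a := a) (b := b)
    (by rw [hpim, ha]; gcongr; linarith) (by rw [hpim, hb]; gcongr; linarith)
    (hh.continuousOn.comp (by fun_prop) hmaps)
    (hh.comp (by fun_prop) (fun z hz => hmaps z ⟨hz.1.le, hz.2.le⟩))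
    (fun z hz hzp => by
      have hzn : kap * z ≠ n := by
        intro h; rw [← hkp] at h; exact hzp (mul_left_cancel₀ kap_ne h)
      rw [hQ _ (hmaps z hz) hzn]
      congr 1
      have : kap * z - n = kap * (z - p) := by rw [mul_sub, hkp]
      rw [this, mul_inv]; ring)
  set Y := |a| + |b| with hY
  obtain ⟨K, hK0, hK⟩ := Qf_tail s Y (by positivity)
  have hlim : Tendsto (fun X : ℝ => K * Real.exp (-X ^ 2)) atTop (𝓝 0) := by
    have : Tendsto (fun X : ℝ => Real.exp (-X ^ 2)) atTop (𝓝 0) :=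
      Real.tendsto_exp_neg_atTop_nhds_zero.comp (tendsto_pow_atTop (by norm_num))
    simpa using this.const_mul K
  obtain ⟨k, rfl⟩ : ∃ k, n = k + 1 := ⟨n - 1, by omega⟩
  have hfin := strip_limit hab hpole
    (Qf_integrable s (n := k + 1) (by rw [hka]; linarith) (by rw [hka]; linarith))
    (Qf_integrable s (n := k) (by rw [hkb]; push_cast; linarith) (by rw [hkb]; push_cast; linarith))
    (fun X => K * Real.exp (-X ^ 2)) hlim (by
      filter_upwards [eventually_ge_atTop (Y + 1)] with X hX y hy
      have hyY : |y| ≤ Y := by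
        rw [hY, abs_le]
        have := neg_abs_le a; have := le_abs_self b; have := abs_nonneg a; have := abs_nonneg b
        constructor <;> linarith [hy.1, hy.2]
      refine ⟨hK X y hyY (hX.trans (le_abs_self _)), ?_⟩
      have := hK (-X) y hyY (by rw [abs_neg]; exact hX.trans (le_abs_self _))
      simpa using this)
  rw [hfin]
  have hpi : (2 * Real.pi * I : ℂ) ≠ 0 := by simp [Real.pi_ne_zero]
  have := kap_ne
  field_simp

theorem R_eq_sum (s : ℂ) (N : ℕ) :
    RiemannR s = (∑ n ∈ Finset.Icc 1 N, (n : ℂ) ^ (-s)) - Lint s (N + 1 / 2 : ℝ) := by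
  induction N with
  | zero => rw [R_eq_Lint]; simp
  | succ N ih =>
    rw [ih, Finset.sum_Icc_succ_top (by omega), ← Lint_step s (n := N + 1) (by omega)]
    have : ((N + 1 : ℕ) : ℝ) - 1 / 2 = N + 1 / 2 := by push_cast; ring
    rw [this]; ring

end Sg

end

section

namespace Sg
open Complex Set MeasureTheory Metric Filter Topology
set_option autoImplicit false

theorem param_diff {L w : ℝ → ℂ} (hL : Continuous L) (hw : Continuous w)
    (hI : ∀ S : ℝ, 0 ≤ S → Integrable (fun u => Real.exp (S * ‖L u‖) * ‖w u‖)) :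
    Differentiable ℂ (fun s : ℂ => ∫ u : ℝ, Complex.exp (-s * L u) * w u) := by
  intro s₀
  have key := hasDerivAt_integral_of_dominated_loc_of_deriv_le (μ := volume)
    (F := fun (s : ℂ) (u : ℝ) => Complex.exp (-s * L u) * w u)
    (F' := fun (s : ℂ) (u : ℝ) => (-L u * Complex.exp (-s * L u)) * w u)
    (x₀ := s₀) (s := ball s₀ 1)
    (bound := fun u => Real.exp ((‖s₀‖ + 2) * ‖L u‖) * ‖w u‖)
    (ball_mem_nhds s₀ one_pos)
    (Eventually.of_forall fun s => (by fun_prop : Continuous _).aestronglyMeasurable)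
    ?_ (by fun_prop : Continuous _).aestronglyMeasurable ?_ (hI _ (by positivity)) ?_
  · exact key.2.differentiableAt
  · refine (hI ‖s₀‖ (norm_nonneg _)).mono' (by fun_prop : Continuous _).aestronglyMeasurable ?_
    refine Eventually.of_forall fun u => ?_
    rw [norm_mul]
    gcongr
    refine (norm_exp_le_exp_norm _).trans ?_
    rw [norm_mul, norm_neg]
  · refine Eventually.of_forall fun u s hs => ?_
    rw [norm_mul, norm_mul, norm_neg]
    gcongr
    have h1 : ‖Complex.exp (-s * L u)‖ ≤ Real.exp ((‖s₀‖ + 1) * ‖L u‖) := by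
      refine (norm_exp_le_exp_norm _).trans ?_
      rw [norm_mul, norm_neg]
      gcongr
      have := norm_sub_norm_le s s₀
      rw [mem_ball, dist_eq_norm] at hs
      linarith
    have h2 : ‖L u‖ ≤ Real.exp ‖L u‖ := by linarith [Real.add_one_le_exp ‖L u‖]
    calc ‖L u‖ * ‖Complex.exp (-s * L u)‖ ≤ Real.exp ‖L u‖ * Real.exp ((‖s₀‖ + 1) * ‖L u‖) := by
          gcongr
      _ = _ := by rw [← Real.exp_add]; ring_nf
  · refine Eventually.of_forall fun u s hs => ?_
    have h1 : HasDerivAt (fun s : ℂ => -s * L u) (-L u) s := by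
      simpa using (hasDerivAt_id s).neg.mul_const (L u)
    convert! h1.cexp.mul_const (w u) using 1
    ring

theorem R_differentiable : Differentiable ℂ RiemannR := by
  set y : ℝ := -((1 / 2 : ℝ) / √2) with hy
  have h2 : (0:ℝ) < √2 := by positivity
  have hyv : -(√2 * y) = 1 / 2 := by rw [hy]; field_simp
  set X : ℝ → ℂ := fun v => kap * (v + y * I) with hX
  have hXc : Continuous X := by fun_prop
  have hsl : ∀ v, X v ∈ slitPlane := fun v => slit_of_pos (by
    have := kz_diff v y
    rw [hyv] at this
    simp only [hX]; rw [this]; norm_num)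
  have hX0 : ∀ v, X v ≠ 0 := fun v => slitPlane_ne_zero (hsl v)
  have hden : ∀ v, den (X v) ≠ 0 := fun v => den_ne_of_frac (n := 0)
    (by have := kz_diff v y
        rw [hyv] at this
        simp only [hX]; rw [this]; norm_num)
    (by have := kz_diff v y
        rw [hyv] at this
        simp only [hX]; rw [this]; norm_num)
  have hq : ∀ s v, Qf s (X v) = Complex.exp (-s * Complex.log (X v)) *
      (Complex.exp (Real.pi * I * X v ^ 2) / den (X v)) := by
    intro s v
    rw [Qf, cpow_def_of_ne_zero (hX0 v), mul_div_assoc, mul_comm (Complex.log _)]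
  have key := param_diff (L := fun v => Complex.log (X v))
    (w := fun v => Complex.exp (Real.pi * I * X v ^ 2) / den (X v))
    (hXc.clog hsl) (Continuous.div (by fun_prop)
      (den_differentiable.continuous.comp hXc) hden) (fun S hS => ?_)
  · have e : RiemannR = fun s => -(kap * ∫ v : ℝ, Complex.exp (-s * Complex.log (X v)) *
      (Complex.exp (Real.pi * I * X v ^ 2) / den (X v))) := by
      funext s
      rw [R_eq_Lint, Lint_eq]
      simp_rw [← hq]
      rfl
    rw [e]
    exact (key.const_mul kap).neg
  · have i1 : ∀ s, Integrable fun v => Qf s (X v) := fun s =>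
      Qf_integrable s (n := 0) (by rw [hyv]; norm_num) (by rw [hyv]; norm_num)
    have i2 := (((i1 S).norm.add (i1 (-S)).norm).const_mul (Real.exp (S * Real.pi)))
    refine i2.mono' ?_ ?_
    · refine Continuous.aestronglyMeasurable ?_
      have a1 : Continuous fun v => Complex.log (X v) := hXc.clog hsl
      have a2 : Continuous fun v => Complex.exp (Real.pi * I * X v ^ 2) / den (X v) :=
        Continuous.div (by fun_prop) (den_differentiable.continuous.comp hXc) hden
      fun_prop
    · refine Eventually.of_forall fun v => ?_
      rw [Real.norm_of_nonneg (by positivity)]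
      simp only [Pi.add_apply, hq, norm_mul]
      rw [← add_mul, ← mul_assoc]
      gcongr
      rw [norm_exp, norm_exp]
      have e1 : ((-(S:ℂ)) * Complex.log (X v)).re = -(S * Real.log ‖X v‖) := by simp [log_re]
      have e2 : ((-(-(S:ℂ))) * Complex.log (X v)).re = S * Real.log ‖X v‖ := by simp [log_re]
      rw [e1, e2]
      have h3 := norm_le_abs_re_add_abs_im (Complex.log (X v))
      rw [log_re, log_im] at h3
      have h4 := abs_arg_le_pi (X v)
      calc Real.exp (S * ‖Complex.log (X v)‖) ≤ Real.exp (S * Real.pi + S * |Real.log ‖X v‖|) := by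
            gcongr; nlinarith
        _ = Real.exp (S * Real.pi) * Real.exp (S * |Real.log ‖X v‖|) := Real.exp_add _ _
        _ ≤ _ := by
          gcongr
          rcases abs_cases (Real.log ‖X v‖) with ⟨h, _⟩ | ⟨h, _⟩ <;> rw [h]
          · linarith [Real.exp_pos (-(S * Real.log ‖X v‖))]
          · rw [mul_neg]; linarith [Real.exp_pos ((S * Real.log ‖X v‖))]

end Sg

end

section

namespace Sg
open Complex Set MeasureTheory Metric Filter Topology
set_option autoImplicit false

theorem arg_line_le (y : ℝ) : arg (⟨1 + y, y⟩ : ℂ) ≤ y + y ^ 2 / 2 := by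
  set x : ℂ := ⟨1 + y, y⟩ with hx
  have hn : ‖x‖ ^ 2 = 1 + 2 * y + 2 * y ^ 2 := by
    rw [← normSq_eq_norm_sq, normSq_apply]; simp only [hx]; ring
  have hn0 : 0 < ‖x‖ := by
    have : 0 < ‖x‖ ^ 2 := by rw [hn]; nlinarith [sq_nonneg (y + 1)]
    exact norm_pos_iff.2 fun h => by rw [h] at this; norm_num at this
  rcases le_or_gt y (-1) with h1 | h1
  · have : arg x ≤ -(Real.pi / 2) := by
      by_contra hcon
      push Not at hcon
      have him : arg x < 0 := arg_neg_iff.2 (by simp only [hx]; linarith)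
      rcases neg_pi_div_two_lt_arg_iff.1 hcon with h | h
      · simp only [hx] at h; linarith
      · simp only [hx] at h; linarith
    have := Real.pi_gt_three
    nlinarith [sq_nonneg (y + 1)]
  · have hre : 0 ≤ x.re := by simp only [hx]; linarith
    have ha : |arg x| ≤ Real.pi / 2 := abs_arg_le_pi_div_two_iff.2 hre
    have hs : Real.sin (arg x) = y / ‖x‖ := by rw [sin_arg]
    have hpi := Real.pi_pos
    rcases le_or_gt 0 y with h0 | h0
    · have hx1 : 0 ≤ arg x := arg_nonneg_iff.2 h0
      have ht : Real.tan (arg x) = y / (1 + y) := by rw [tan_arg]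
      have hlt : arg x < Real.pi / 2 := by
        refine lt_of_le_of_ne (le_of_abs_le ha) fun h => ?_
        have := (abs_arg_lt_pi_div_two_iff (z := x)).2 (Or.inl (by simp only [hx]; linarith))
        rw [h, abs_of_pos (by positivity)] at this
        exact lt_irrefl _ this
      have := Real.le_tan hx1 hlt
      rw [ht] at this
      have h3 : y / (1 + y) ≤ y := div_le_self h0 (by linarith)
      nlinarith [sq_nonneg y]
    · have hx1 : arg x < 0 := arg_neg_iff.2 h0
      have h3 : Real.sin (-arg x) ≤ -arg x := Real.sin_le (by linarith)
      rw [Real.sin_neg, hs] at h3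
      have h4 : ‖x‖ ≤ 1 := by
        have : ‖x‖ ^ 2 ≤ 1 := by rw [hn]; nlinarith
        exact (sq_le_one_iff₀ hn0.le).1 this
      have h5 : -y ≤ -(y / ‖x‖) := by
        rw [← neg_div]
        exact le_div_self (by linarith) hn0 h4
      nlinarith [sq_nonneg y]

theorem arg_line_abs (y : ℝ) : |arg (⟨1 + y, y⟩ : ℂ)| ≤ 7 * |y| := by
  set x : ℂ := ⟨1 + y, y⟩ with hx
  have hp := Real.pi_lt_d2
  rcases le_or_gt (1 / 2) |y| with h | h
  · have := abs_arg_le_pi x; linarith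
  · have hy := abs_lt.1 h
    have hre : 0 ≤ x.re := by simp only [hx]; linarith
    have hn : ‖x‖ ^ 2 = 1 + 2 * y + 2 * y ^ 2 := by
      rw [← normSq_eq_norm_sq, normSq_apply]; simp only [hx]; ring
    have hn0 : 1 / 2 ≤ ‖x‖ := by
      have : (1 / 2) ^ 2 ≤ ‖x‖ ^ 2 := by rw [hn]; nlinarith [sq_nonneg (y + 1 / 2)]
      exact (sq_le_sq₀ (by norm_num) (norm_nonneg _)).1 this
    have ha : |arg x| ≤ Real.pi / 2 := abs_arg_le_pi_div_two_iff.2 hre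
    have h1 : 2 / Real.pi * |arg x| ≤ Real.sin |arg x| := Real.mul_le_sin (abs_nonneg _) ha
    have h2 : Real.sin |arg x| = |y| / ‖x‖ := by
      have hs : Real.sin (arg x) = y / ‖x‖ := by rw [sin_arg]
      rw [← abs_of_nonneg (norm_nonneg x), ← abs_div, ← hs]
      rcases abs_cases (arg x) with ⟨h, h'⟩ | ⟨h, h'⟩
      · rw [h, abs_of_nonneg (Real.sin_nonneg_of_nonneg_of_le_pi h' (by linarith [le_abs_self (arg x)]))]
      · rw [h, Real.sin_neg, abs_of_nonpos]
        have : 0 ≤ Real.sin (-arg x) := Real.sin_nonneg_of_nonneg_of_le_pi (by linarith) (by linarith)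
        rw [Real.sin_neg] at this; linarith
    rw [h2] at h1
    have h3 : |y| / ‖x‖ ≤ 2 * |y| := by
      rw [div_le_iff₀ (by linarith)]; nlinarith [abs_nonneg y]
    have h4 : 2 / Real.pi * |arg x| ≤ 2 * |y| := h1.trans h3
    have h5 : |arg x| ≤ Real.pi * |y| := by
      rw [div_mul_eq_mul_div, div_le_iff₀ Real.pi_pos] at h4; linarith
    nlinarith [abs_nonneg y]

theorem cosh_add_cos (y : ℝ) : 2 ≤ Real.cosh y + Real.cos y := by
  have h1 : Real.cosh y = 1 + 2 * Real.sinh (y / 2) ^ 2 := by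
    have := Real.cosh_two_mul (y / 2)
    rw [Real.cosh_sq] at this
    rw [show 2 * (y / 2) = y by ring] at this
    linarith
  have h2 := Real.one_sub_sq_div_two_le_cos (x := y)
  have h3 : (y / 2) ^ 2 ≤ Real.sinh (y / 2) ^ 2 := by
    rw [← sq_abs, ← sq_abs (Real.sinh _)]
    refine pow_le_pow_left₀ (abs_nonneg _) ?_ 2
    rw [Real.abs_sinh]
    exact Real.self_le_sinh_iff.2 (abs_nonneg _)
  nlinarith

theorem den_line (N : ℕ) (u : ℝ) : 1 ≤ ‖den (((N + 1 / 2 : ℝ) : ℂ) + kap * u)‖ := by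
  set x : ℂ := ((N + 1 / 2 : ℝ) : ℂ) + kap * u with hx
  set α : ℝ := Real.pi * (√2 / 2 * u) with hα
  have hre : Real.pi * x.re = N * Real.pi + (α + Real.pi / 2) := by
    rw [hα, hx]; simp [kap_re]; ring
  have him : Real.pi * x.im = α := by rw [hα, hx]; simp [kap_im]
  have e : den x = 2 * I * Complex.sin (Real.pi * x) := by
    rw [den, Complex.sin]
    have : (Real.pi * I * x : ℂ) = Real.pi * x * I := by ring
    rw [this, neg_mul]
    linear_combination (-(cexp (-(Real.pi * x * I)) - cexp (Real.pi * x * I)))  * I_sq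
  have e2 : (Real.pi * x : ℂ) = (Real.pi * x.re : ℝ) + (Real.pi * x.im : ℝ) * I := by
    apply Complex.ext <;> simp
  have e3 : ‖den x‖ ^ 2 = 4 * (Real.cos α ^ 2 + Real.sinh α ^ 2) := by
    rw [e, e2, norm_mul, mul_pow, hre, him, Complex.sin_add_mul_I, ← ofReal_cos, ← ofReal_sin,
      ← ofReal_cosh, ← ofReal_sinh, ← ofReal_mul, ← ofReal_mul, ← normSq_eq_norm_sq (_ + _),
      normSq_add_mul_I]
    have c1 : Real.cos (N * Real.pi + (α + Real.pi / 2)) ^ 2 = Real.sin α ^ 2 := by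
      rw [add_comm, Real.cos_add_nat_mul_pi, mul_pow, Real.cos_add_pi_div_two, ← pow_mul]; simp
    have c2 : Real.sin (N * Real.pi + (α + Real.pi / 2)) ^ 2 = Real.cos α ^ 2 := by
      rw [add_comm, Real.sin_add_nat_mul_pi, mul_pow, Real.sin_add_pi_div_two, ← pow_mul]; simp
    have c3 : ‖(2 * I : ℂ)‖ = 2 := by simp
    rw [mul_pow, mul_pow, c1, c2, c3, Real.cosh_sq, Real.sin_sq]; ring
  have h := cosh_add_cos (2 * α)
  rw [Real.cos_two_mul, Real.cosh_two_mul, Real.cosh_sq] at h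
  have : 1 ^ 2 ≤ ‖den x‖ ^ 2 := by rw [e3]; nlinarith
  exact (sq_le_sq₀ (by norm_num) (norm_nonneg _)).1 this

theorem Qf_line_bound {s : ℂ} {N : ℕ} {c : ℝ} (hc : c = N + 1 / 2)
    (ht : |s.im - 2 * Real.pi * c ^ 2| ≤ 16 * c) (u : ℝ) :
    ‖Qf s (c + kap * u)‖ ≤ Real.exp (-s.re * Real.log ‖(c + kap * u : ℂ)‖) *
      Real.exp (-(Real.pi / 2 * u ^ 2) + 80 * |u|) := by
  have hc0 : 0 < c := by rw [hc]; positivity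
  have hs2 : √2 * √2 = 2 := Real.mul_self_sqrt (by norm_num)
  set y : ℝ := √2 / 2 * u / c with hy
  have hx : (c + kap * u : ℂ) = (c : ℂ) * (⟨1 + y, y⟩ : ℂ) := by
    apply Complex.ext
    · simp [kap_re, hy]; field_simp
    · simp [kap_im, hy]; field_simp
  have hx0 : (c + kap * u : ℂ) ≠ 0 := by
    rw [hx]; refine mul_ne_zero (by exact_mod_cast hc0.ne') fun h => ?_
    have h1 := congrArg Complex.re h
    have h2 := congrArg Complex.im h
    simp at h1 h2; rw [h2] at h1; norm_num at h1
  have harg : arg (c + kap * u : ℂ) = arg (⟨1 + y, y⟩ : ℂ) := by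
    rw [hx, arg_real_mul _ hc0]
  have hg : ‖Complex.exp (Real.pi * I * (c + kap * u) ^ 2)‖ =
      Real.exp (-(√2 * Real.pi * c * u) - Real.pi * u ^ 2) := by
    rw [Complex.norm_exp]
    congr 1
    have : (Real.pi * I * (c + kap * u) ^ 2 : ℂ) =
        Real.pi * I * c ^ 2 + 2 * Real.pi * c * u * (I * kap) + Real.pi * u ^ 2 * (I * kap ^ 2) := by
      ring
    rw [this, kap_sq, I_mul_I, kap_eq]
    simp [pow_two]; ring
  have hd : 1 ≤ ‖den (c + kap * u)‖ := by rw [hc]; exact den_line N u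
  rw [Qf, norm_div, norm_mul, norm_cpow_neg s _ hx0, hg]
  refine (div_le_self (by positivity) hd).trans ?_
  rw [← Real.exp_add, ← Real.exp_add]
  refine Real.exp_le_exp.2 ?_
  rw [harg]
  have h1 := arg_line_le y
  have h2 := arg_line_abs y
  set φ := arg (⟨1 + y, y⟩ : ℂ)
  have hcy : c * y = √2 / 2 * u := by rw [hy]; field_simp
  have hcy2 : c ^ 2 * y ^ 2 = u ^ 2 / 2 := by
    rw [← mul_pow, hcy]; linear_combination (u ^ 2 / 4) * hs2
  set τ := s.im - 2 * Real.pi * c ^ 2 with hτ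
  have h3 : τ * φ ≤ 80 * |u| := by
    have hs15 : √2 ≤ 10 / 7 := by
      rw [Real.sqrt_le_left (by norm_num)]; norm_num
    calc τ * φ ≤ |τ| * |φ| := by rw [← abs_mul]; exact le_abs_self _
      _ ≤ (16 * c) * (7 * |y|) := by gcongr
      _ = 112 * |c * y| := by rw [abs_mul, abs_of_pos hc0]; ring
      _ = 112 * (√2 / 2 * |u|) := by rw [hcy, abs_mul, abs_of_pos (by positivity)]
      _ ≤ _ := by nlinarith [abs_nonneg u]
  have h4 : 2 * Real.pi * c ^ 2 * φ ≤ 2 * Real.pi * c ^ 2 * (y + y ^ 2 / 2) := by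
    gcongr
  have h5 : 2 * Real.pi * c ^ 2 * (y + y ^ 2 / 2) = √2 * Real.pi * c * u + Real.pi * u ^ 2 / 2 := by
    linear_combination (2 * Real.pi * c) * hcy + Real.pi * hcy2
  have h6 : s.im = τ + 2 * Real.pi * c ^ 2 := by rw [hτ]; ring
  rw [h6]; linarith

theorem norm_line_ge (c u : ℝ) (_hc : 0 < c) : c / √2 ≤ ‖(c + kap * u : ℂ)‖ := by
  have hs2 : √2 * √2 = 2 := Real.mul_self_sqrt (by norm_num)
  rw [line_eq, norm_mul, kap_norm, one_mul]
  have := abs_im_le_norm (((u + c / √2 : ℝ) : ℂ) + ((-(c / √2) : ℝ) : ℂ) * I)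
  simp only [add_im, ofReal_im, mul_im, ofReal_re, I_im, I_re, mul_one, mul_zero, zero_add, add_zero,
    abs_neg] at this
  exact (le_abs_self _).trans this

theorem norm_line_le (c u : ℝ) (hc : 0 < c) : ‖(c + kap * u : ℂ)‖ ≤ c + |u| := by
  refine (norm_add_le _ _).trans ?_
  rw [norm_mul, kap_norm, one_mul, norm_real, norm_real, Real.norm_eq_abs, Real.norm_eq_abs,
    abs_of_pos hc]

theorem integrable_gauss_abs (a b : ℝ) (ha : 0 < a) :
    Integrable fun u : ℝ => Real.exp (-(a * u ^ 2) + b * |u|) := by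
  have key : ∀ b : ℝ, Integrable fun u : ℝ => Real.exp (-(a * u ^ 2) + b * u) := by
    intro b
    have h := (integrable_exp_neg_mul_sq ha).comp_sub_right (b / (2 * a))
    refine (h.const_mul (Real.exp (b ^ 2 / (4 * a)))).congr (Eventually.of_forall fun u => ?_)
    simp only
    rw [← Real.exp_add]
    congr 1
    field_simp
    ring
  refine ((key b).add (key (-b))).mono' (by fun_prop : Continuous _).aestronglyMeasurable
    (Eventually.of_forall fun u => ?_)
  rw [Real.norm_of_nonneg (Real.exp_pos _).le]
  simp only [Pi.add_apply]
  rcases abs_cases u with ⟨h, _⟩ | ⟨h, _⟩ <;> rw [h]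
  · linarith [Real.exp_pos (-(a * u ^ 2) + -b * u)]
  · have e : b * -u = -b * u := by ring
    rw [e]; linarith [Real.exp_pos (-(a * u ^ 2) + b * u)]

theorem Lint_bound : ∃ C : ℝ, 0 < C ∧ ∀ (s : ℂ) (N : ℕ) (c : ℝ), c = N + 1 / 2 →
    |s.im - 2 * Real.pi * c ^ 2| ≤ 16 * c →
    (0 ≤ s.re → ‖Lint s c‖ ≤ C * Real.exp (-s.re * Real.log (c / √2))) ∧
    (-c ≤ s.re → s.re ≤ 0 → ‖Lint s c‖ ≤ C * Real.exp (-s.re * Real.log c)) := by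
  have hintg := integrable_gauss_abs (Real.pi / 2) 81 (by positivity)
  have gen : ∀ (s : ℂ) (c K : ℝ), (∀ u : ℝ, ‖Qf s (c + kap * u)‖ ≤
      K * Real.exp (-(Real.pi / 2 * u ^ 2) + 81 * |u|)) →
      ‖Lint s c‖ ≤ ((∫ u : ℝ, Real.exp (-(Real.pi / 2 * u ^ 2) + 81 * |u|)) + 1) * Real.exp (Real.log K) ∨ K ≤ 0 := by
    intro s c K hK
    by_cases hK0 : 0 < K
    · left
      rw [Lint, norm_mul, kap_norm, one_mul, Real.exp_log hK0]
      refine (norm_integral_le_of_norm_le (hintg.const_mul K) (Eventually.of_forall hK)).trans ?_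
      rw [integral_const_mul]
      nlinarith
    · right; linarith
  refine ⟨(∫ u : ℝ, Real.exp (-(Real.pi / 2 * u ^ 2) + 81 * |u|)) + 1, ?_, fun s N c hc ht => ⟨?_, ?_⟩⟩
  · have : 0 ≤ ∫ u : ℝ, Real.exp (-(Real.pi / 2 * u ^ 2) + 81 * |u|) :=
      integral_nonneg fun u => (Real.exp_pos _).le
    linarith
  · intro hσ
    have hc0 : 0 < c := by rw [hc]; positivity
    refine (gen s c (Real.exp (-s.re * Real.log (c / √2))) ?_).elim (fun h => ?_)
      (fun h => absurd h (not_le.2 (Real.exp_pos _)))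
    rotate_left
    · rwa [Real.log_exp] at h
    · intro u
      refine (Qf_line_bound hc ht u).trans ?_
      have h1 := Real.log_le_log (by positivity) (norm_line_ge c u hc0)
      gcongr 1
      · exact Real.exp_le_exp.2 (by nlinarith)
      · exact Real.exp_le_exp.2 (by nlinarith [abs_nonneg u])
  · intro hσ1 hσ2
    have hc0 : 0 < c := by rw [hc]; positivity
    refine (gen s c (Real.exp (-s.re * Real.log c)) ?_).elim (fun h => ?_)
      (fun h => absurd h (not_le.2 (Real.exp_pos _)))
    rotate_left
    · rwa [Real.log_exp] at h
    · intro u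
      refine (Qf_line_bound hc ht u).trans ?_
      rw [← Real.exp_add, ← Real.exp_add]
      refine Real.exp_le_exp.2 ?_
      have h0 : 0 < ‖(c + kap * u : ℂ)‖ := lt_of_lt_of_le (by positivity) (norm_line_ge c u hc0)
      have h1 := Real.log_le_log h0 (norm_line_le c u hc0)
      have h2 : Real.log (c + |u|) ≤ Real.log c + |u| / c := by
        have e : c + |u| = c * (1 + |u| / c) := by field_simp
        rw [e, Real.log_mul hc0.ne' (by positivity)]
        have := Real.log_le_sub_one_of_pos (x := 1 + |u| / c) (by positivity)
        linarith
      have h3 : -s.re * Real.log ‖(c + kap * u : ℂ)‖ ≤ -s.re * (Real.log c + |u| / c) := by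
        have := h1.trans h2
        gcongr; linarith
      have h4 : -s.re * (|u| / c) ≤ |u| := by
        calc -s.re * (|u| / c) ≤ c * (|u| / c) := by gcongr; linarith
          _ = |u| := by field_simp
      linarith

end Sg

end

section

namespace Sg
open Complex Set MeasureTheory Metric Filter Topology
set_option autoImplicit false

theorem choose_N {t : ℝ} (ht : 30 ≤ t) : ∃ (N : ℕ) (c : ℝ), c = N + 1 / 2 ∧ 2 ≤ N ∧
    |t - 2 * Real.pi * c ^ 2| ≤ 16 * c ∧ √t / 10 ≤ c ∧ c ≤ √t := by
  have hp1 := Real.pi_gt_d2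
  have hp2 := Real.pi_lt_d2
  set r := √(t / (2 * Real.pi)) with hr
  have hr2 : r ^ 2 = t / (2 * Real.pi) := Real.sq_sqrt (by positivity)
  have hr2' : 2 * Real.pi * r ^ 2 = t := by rw [hr2]; field_simp
  have hr0 : 0 ≤ r := Real.sqrt_nonneg _
  have hst : √t ^ 2 = t := Real.sq_sqrt (by linarith)
  have hst0 : 0 ≤ √t := Real.sqrt_nonneg _
  have hst5 : 5 ≤ √t := Real.le_sqrt_of_sq_le (by linarith)
  have hr22 : 2 ≤ r := by
    refine Real.le_sqrt_of_sq_le ?_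
    rw [le_div_iff₀ (by positivity)]; linarith
  have h1 : r ≤ √t / 2 := by
    refine abs_le_of_sq_le_sq' ?_ (by positivity) |>.2
    nlinarith
  have h2 : √t / 3 ≤ r := by
    refine abs_le_of_sq_le_sq' ?_ (by positivity) |>.2
    nlinarith
  have hN1 := Nat.floor_le hr0
  have hN2 := Nat.lt_floor_add_one r
  refine ⟨⌊r⌋₊, _, rfl, Nat.le_floor (by exact_mod_cast hr22), ?_, ?_, ?_⟩
  · set n : ℝ := (⌊r⌋₊ : ℝ)
    have hn0 : 2 ≤ n := by
      have : 2 ≤ ⌊r⌋₊ := Nat.le_floor (by exact_mod_cast hr22)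
      have h3 : ((2 : ℕ) : ℝ) ≤ (⌊r⌋₊ : ℝ) := Nat.cast_le.2 this
      rw [Nat.cast_ofNat] at h3
      exact h3
    have e1 : |r ^ 2 - (n + 1 / 2) ^ 2| ≤ (n + 1 / 2) + 1 / 4 := by
      rw [abs_le]; constructor <;> nlinarith
    have e2 : t - 2 * Real.pi * (n + 1 / 2) ^ 2 = 2 * Real.pi * (r ^ 2 - (n + 1 / 2) ^ 2) := by
      rw [← hr2']; ring
    rw [e2, abs_mul, abs_of_pos (by positivity)]
    calc 2 * Real.pi * |r ^ 2 - (n + 1 / 2) ^ 2| ≤ 2 * 3.15 * ((n + 1 / 2) + 1 / 4) := by gcongr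
      _ ≤ _ := by linarith
  · linarith
  · linarith

theorem norm_nat_cpow {n : ℕ} (hn : 1 ≤ n) (s : ℂ) :
    ‖(n : ℂ) ^ (-s)‖ = Real.exp (-s.re * Real.log n) := by
  have h0 : (0 : ℝ) < n := by exact_mod_cast hn
  rw [norm_natCast_cpow_of_pos (by omega), Real.rpow_def_of_pos h0, mul_comm]; simp

theorem choose_c {t : ℝ} (ht : 0 < t) : ∃ (N : ℕ) (c : ℝ), c = N + 1 / 2 ∧ 2 ≤ N ∧
    |t - 2 * Real.pi * c ^ 2| ≤ 16 * c := by
  have hp1 := Real.pi_gt_d2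
  have hp2 := Real.pi_lt_d2
  rcases le_or_gt 30 t with h | h
  · obtain ⟨N, c, h1, h2, h3, _⟩ := choose_N h
    exact ⟨N, c, h1, h2, h3⟩
  · refine ⟨2, _, rfl, le_rfl, ?_⟩
    rw [abs_le]; constructor <;> push_cast <;> nlinarith

theorem R_right : ∃ C : ℝ, 0 < C ∧ ∀ s : ℂ, 2 ≤ s.re → 0 < s.im →
    ‖RiemannR s - 1‖ ≤ C * Real.exp (-s.re / 2) := by
  obtain ⟨C, hC, hL⟩ := Lint_bound
  set S : ℝ := ∑' n : ℕ, 1 / (n : ℝ) ^ 2 with hS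
  have hsum : Summable fun n : ℕ => 1 / (n : ℝ) ^ 2 := Real.summable_one_div_nat_pow.2 (by norm_num)
  have hS0 : 0 ≤ S := tsum_nonneg fun n => by positivity
  refine ⟨C + 4 * S, by positivity, fun s hσ ht => ?_⟩
  obtain ⟨N, c, hc, hN, hτ⟩ := choose_c ht
  have hN' : (2 : ℝ) ≤ N := by exact_mod_cast hN
  rw [R_eq_sum s N, ← hc]
  have e1 : ∑ n ∈ Finset.Icc 1 N, (n : ℂ) ^ (-s) = 1 + ∑ n ∈ Finset.Icc 2 N, (n : ℂ) ^ (-s) := by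
    rw [← Finset.add_sum_Ioc_eq_sum_Icc (by omega)]
    simp; rfl
  rw [e1]
  have e2 : ‖Lint s c‖ ≤ C * Real.exp (-s.re / 2) := by
    refine ((hL s N c hc hτ).1 (by linarith)).trans ?_
    gcongr
    have h1 : (1 / 2 : ℝ) ≤ Real.log (c / √2) := by
      rw [Real.le_log_iff_exp_le (by rw [hc]; positivity)]
      refine abs_le_of_sq_le_sq' ?_ (by rw [hc]; positivity) |>.2
      rw [div_pow, Real.sq_sqrt (by norm_num), ← Real.exp_nat_mul]
      have := Real.exp_one_lt_d9
      norm_num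
      rw [hc]
      nlinarith
    nlinarith
  have e3 : ‖∑ n ∈ Finset.Icc 2 N, (n : ℂ) ^ (-s)‖ ≤ 4 * S * Real.exp (-s.re / 2) := by
    calc _ ≤ ∑ n ∈ Finset.Icc 2 N, ‖(n : ℂ) ^ (-s)‖ := norm_sum_le _ _
      _ ≤ ∑ n ∈ Finset.Icc 2 N, (4 * Real.exp (-s.re / 2)) * (1 / (n : ℝ) ^ 2) := by
          refine Finset.sum_le_sum fun n hn => ?_
          rw [Finset.mem_Icc] at hn
          have hn2 : (2 : ℝ) ≤ n := by exact_mod_cast hn.1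
          rw [norm_nat_cpow (by omega)]
          have e4 : (4 : ℝ) * (1 / (n : ℝ) ^ 2) = Real.exp (-2 * (Real.log n - Real.log 2)) := by
            rw [← Real.log_div (by positivity) (by norm_num), mul_comm (-2 : ℝ), Real.exp_mul,
              Real.exp_log (by positivity), Real.rpow_neg (by positivity)]
            norm_num
            field_simp; norm_num
          rw [mul_right_comm, e4, ← Real.exp_add]
          refine Real.exp_le_exp.2 ?_
          have h3 : Real.log 2 ≤ Real.log n := Real.log_le_log (by norm_num) hn2
          have h4 := Real.log_two_gt_d9
          nlinarith
      _ = (4 * Real.exp (-s.re / 2)) * ∑ n ∈ Finset.Icc 2 N, (1 / (n : ℝ) ^ 2) := by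
          rw [Finset.mul_sum]
      _ ≤ (4 * Real.exp (-s.re / 2)) * S := by
          gcongr
          exact hsum.sum_le_tsum _ (fun n _ => by positivity)
      _ = _ := by ring
  calc ‖1 + ∑ n ∈ Finset.Icc 2 N, (n : ℂ) ^ (-s) - Lint s c - 1‖
      = ‖∑ n ∈ Finset.Icc 2 N, (n : ℂ) ^ (-s) - Lint s c‖ := by congr 1; ring
    _ ≤ _ := norm_sub_le _ _
    _ ≤ _ := by linarith

theorem R_growth : ∃ C : ℝ, 0 < C ∧ ∀ s : ℂ, 30 ≤ s.im → -√s.im / 10 ≤ s.re →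
    ‖RiemannR s‖ ≤ C * Real.exp ((max (-s.re) 0 + 1) * Real.log s.im / 2) := by
  obtain ⟨C, hC, hL⟩ := Lint_bound
  refine ⟨1 + C, by positivity, fun s ht hσ => ?_⟩
  obtain ⟨N, c, hc, hN, hτ, hc1, hc2⟩ := choose_N ht
  have hN' : (2 : ℝ) ≤ N := by exact_mod_cast hN
  set A := max (-s.re) 0 with hA
  have hA0 : 0 ≤ A := le_max_right _ _
  have hA1 : -s.re ≤ A := le_max_left _ _
  have hlogc : Real.log c ≤ Real.log s.im / 2 := by
    rw [← Real.log_sqrt (by linarith)]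
    exact Real.log_le_log (by rw [hc]; positivity) hc2
  have hlog0 : 0 ≤ Real.log s.im / 2 := by
    have := Real.log_nonneg (by linarith : 1 ≤ s.im); linarith
  have hL' : ‖Lint s c‖ ≤ C * Real.exp (A * (Real.log s.im / 2)) := by
    rcases le_or_gt 0 s.re with h | h
    · refine ((hL s N c hc hτ).1 h).trans ?_
      refine mul_le_mul_of_nonneg_left (Real.exp_le_exp.2 ?_) hC.le
      have : 0 ≤ Real.log (c / √2) := by
        refine Real.log_nonneg ?_
        rw [le_div_iff₀ (by positivity), one_mul, Real.sqrt_le_left (by rw [hc]; positivity)]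
        rw [hc]; nlinarith
      nlinarith
    · refine ((hL s N c hc hτ).2 (by linarith) h.le).trans ?_
      refine mul_le_mul_of_nonneg_left (Real.exp_le_exp.2 ?_) hC.le
      have : 0 ≤ Real.log c := Real.log_nonneg (by rw [hc]; linarith)
      calc -s.re * Real.log c ≤ A * Real.log c := by gcongr
        _ ≤ _ := by gcongr
  have hsum : ‖∑ n ∈ Finset.Icc 1 N, (n : ℂ) ^ (-s)‖ ≤ √s.im * Real.exp (A * (Real.log s.im / 2)) := by
    calc _ ≤ ∑ n ∈ Finset.Icc 1 N, ‖(n : ℂ) ^ (-s)‖ := norm_sum_le _ _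
      _ ≤ ∑ n ∈ Finset.Icc 1 N, Real.exp (A * (Real.log s.im / 2)) := by
          refine Finset.sum_le_sum fun n hn => ?_
          rw [Finset.mem_Icc] at hn
          have hn1 : (1 : ℝ) ≤ n := by exact_mod_cast hn.1
          have hn2 : (n : ℝ) ≤ N := by exact_mod_cast hn.2
          rw [norm_nat_cpow hn.1]
          refine Real.exp_le_exp.2 ?_
          have h1 : 0 ≤ Real.log n := Real.log_nonneg hn1
          have h2 : Real.log n ≤ Real.log c := Real.log_le_log (by linarith) (by rw [hc]; linarith)
          calc -s.re * Real.log n ≤ A * Real.log n := by gcongr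
            _ ≤ _ := by gcongr; linarith
      _ = N * Real.exp (A * (Real.log s.im / 2)) := by simp
      _ ≤ _ := by gcongr; linarith
  have e : Real.exp ((A + 1) * Real.log s.im / 2) = √s.im * Real.exp (A * (Real.log s.im / 2)) := by
    have : √s.im = Real.exp (Real.log s.im / 2) := by
      rw [← Real.log_sqrt (by linarith), Real.exp_log (Real.sqrt_pos.2 (by linarith))]
    rw [this, ← Real.exp_add]; ring_nf
  rw [R_eq_sum s N, ← hc, e]
  have h1 : 1 ≤ √s.im := Real.one_le_sqrt.2 (by linarith)
  calc _ ≤ _ := norm_sub_le _ _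
    _ ≤ √s.im * Real.exp (A * (Real.log s.im / 2)) + C * (√s.im * Real.exp (A * (Real.log s.im / 2))) := by
        refine add_le_add hsum (hL'.trans ?_)
        gcongr
        exact le_mul_of_one_le_left (Real.exp_pos _).le h1
    _ = _ := by ring

end Sg

end

section

namespace Sg
open Complex Set MeasureTheory Metric Filter Topology
set_option autoImplicit false

theorem Qf_contAt_zero {s : ℂ} (hs : s.re ≤ -2) : ContinuousAt (Qf s) 0 := by
  set d := dslope den 0 with hd
  have hdd : DifferentiableAt ℂ d 0 := by
    have : DifferentiableOn ℂ d univ :=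
      (differentiableOn_dslope univ_mem).2 den_differentiable.differentiableOn
    exact this.differentiableAt univ_mem
  have hd0 : d 0 ≠ 0 := by
    have h1 := den_deriv_nat 0
    simp only [Nat.cast_zero, pow_zero, mul_one] at h1
    rw [hd, dslope_same, h1]; simp [Real.pi_ne_zero]
  have h0 : den 0 = 0 := by simp [den]
  have hdx : ∀ x, den x = x * d x := by
    intro x
    have := sub_smul_dslope den (0 : ℂ) x
    rw [h0, sub_zero, sub_zero, smul_eq_mul] at this
    exact this.symm
  have hz : -s - 1 ≠ 0 := by
    intro h
    have := congrArg Complex.re h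
    simp at this; linarith
  have e : Qf s = fun x => x ^ (-s - 1) * Complex.exp (Real.pi * Complex.I * x ^ 2) / d x := by
    funext x
    by_cases hx : x = 0
    · rw [hx, Qf, h0, zero_cpow hz]; simp
    · have : x ^ (-s) = x ^ (-s - 1) * x := by
        rw [cpow_sub _ _ hx, cpow_one]; field_simp
      rw [Qf, hdx, this]
      by_cases hdx0 : d x = 0
      · simp [hdx0]
      · field_simp
  rw [e]
  refine ContinuousAt.div (ContinuousAt.mul ?_ (by fun_prop)) hdd.continuousAt hd0
  have := continuousAt_cpow_zero_of_re_pos (z := -s - 1) (by simp; linarith)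
  exact ContinuousAt.comp (f := fun x : ℂ => (x, -s - 1)) (g := fun p : ℂ × ℂ => p.1 ^ p.2) this
    (by fun_prop)

theorem kz_slit {z : ℂ} (h1 : -(1 / √2) < z.im) (h2 : z.im ≤ 0) (h0 : z ≠ 0) :
    kap * z ∈ slitPlane ∧ den (kap * z) ≠ 0 := by
  have hs : (0 : ℝ) < √2 := by positivity
  have e1 := kz_re z.re z.im
  have e2 := kz_im z.re z.im
  have e3 := kz_diff z.re z.im
  rw [re_add_im] at e1 e2 e3
  rcases h2.lt_or_eq with h | h
  · refine ⟨slit_of_pos (by rw [e3]; nlinarith), den_ne_of_frac (n := 0) ?_ ?_⟩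
    · rw [e3]; push_cast; nlinarith
    · rw [e3]; push_cast
      have : √2 * (-(1 / √2)) < √2 * z.im := by gcongr
      have h3 : √2 * (-(1 / √2)) = -1 := by field_simp
      linarith
  · have hre : z.re ≠ 0 := fun hr => h0 (Complex.ext hr h)
    have him : (kap * z).im ≠ 0 := by
      rw [e2, h, add_zero]; exact mul_ne_zero (by positivity) hre
    refine ⟨Or.inr him, den_ne_zero fun n hn => him ?_⟩
    rw [hn]; simp

theorem Qf_contAt_strip {s : ℂ} (hs : s.re ≤ -2) {z : ℂ} (h1 : -(1 / √2) < z.im) (h2 : z.im ≤ 0) :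
    ContinuousAt (fun z => Qf s (kap * z)) z := by
  have : ContinuousAt (Qf s) (kap * z) := by
    by_cases h0 : z = 0
    · rw [h0, mul_zero]; exact Qf_contAt_zero hs
    · obtain ⟨a, b⟩ := kz_slit h1 h2 h0
      exact Qf_continuousAt s a b
  exact ContinuousAt.comp (f := fun z : ℂ => kap * z) this (by fun_prop)

theorem Qf_differentiableAt (s : ℂ) {x : ℂ} (hx : x ∈ slitPlane) (hd : den x ≠ 0) :
    DifferentiableAt ℂ (Qf s) x := by
  unfold Qf
  refine DifferentiableAt.div (DifferentiableAt.mul ?_ (by fun_prop)) (den_differentiable x) hd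
  exact differentiableAt_id.cpow (differentiableAt_const _) hx

theorem gauss_lim (K : ℝ) : Tendsto (fun X : ℝ => K * Real.exp (-X ^ 2)) atTop (𝓝 0) := by
  have : Tendsto (fun X : ℝ => Real.exp (-X ^ 2)) atTop (𝓝 0) :=
    Real.tendsto_exp_neg_atTop_nhds_zero.comp (tendsto_pow_atTop (by norm_num))
  simpa using this.const_mul K

theorem Qf_zero_integrable {s : ℂ} (hs : s.re ≤ -2) : Integrable fun v : ℝ => Qf s (kap * v) := by
  obtain ⟨K, _, hK⟩ := Qf_tail s 0 le_rfl
  refine integrable_of_tail (K := K) (V := 1) ?_ (fun v hv => ?_)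
  · refine continuous_iff_continuousAt.2 fun v => ?_
    have := Qf_contAt_strip hs (z := (v : ℂ)) (by simp) (by simp)
    exact ContinuousAt.comp (f := fun v : ℝ => (v : ℂ)) this (by fun_prop)
  · have := hK v 0 (by simp) (by linarith)
    simpa using this

theorem Lint_zero {s : ℂ} (hs : s.re ≤ -2) :
    Lint s (1 / 2 : ℝ) = kap * ∫ v : ℝ, Qf s (kap * v) := by
  rw [Lint_eq]
  congr 1
  set a : ℝ := -((1 / 2 : ℝ) / √2) with ha
  have hs2 : (0 : ℝ) < √2 := by positivity
  have ha0 : a < 0 := by rw [ha]; simp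
  have ha1 : -(1 / √2) < a := by rw [ha]; gcongr; norm_num
  have hav : -(√2 * a) = 1 / 2 := by rw [ha]; field_simp
  obtain ⟨K, _, hK⟩ := Qf_tail s |a| (abs_nonneg a)
  have key := strip_limit (f := fun z => Qf s (kap * z)) (a := a) (b := 0) (K := 0) ha0.le
    (by
      filter_upwards [eventually_ge_atTop 0] with X hX
      refine strip_rect ha0.le ?_ ?_ hX
      · exact fun z hz => (Qf_contAt_strip hs (ha1.trans_le hz.1) hz.2).continuousWithinAt
      · intro z hz
        obtain ⟨u, v⟩ := kz_slit (ha1.trans hz.1) hz.2.le (by rintro rfl; simpa using hz.2)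
        exact ((Qf_differentiableAt s u v).comp z (by fun_prop)).differentiableWithinAt)
    (Qf_integrable s (n := 0) (by rw [hav]; norm_num) (by rw [hav]; norm_num))
    (by simpa using Qf_zero_integrable hs)
    (fun X => K * Real.exp (-X ^ 2)) (gauss_lim K) (by
      filter_upwards [eventually_ge_atTop (|a| + 1)] with X hX y hy
      have hy2 : |y| ≤ |a| := by
        rw [abs_of_nonpos hy.2, abs_of_neg ha0]; linarith [hy.1]
      refine ⟨hK X y hy2 (hX.trans (le_abs_self _)), ?_⟩
      have := hK (-X) y hy2 (by rw [abs_neg X]; exact hX.trans (le_abs_self _))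
      simpa using this)
  simpa [sub_eq_zero] using key

/-- integrand in logarithmic coordinates -/
noncomputable def qf (s w : ℂ) : ℂ :=
  -(Complex.exp ((1 - s) * w + Real.pi * I * Complex.exp (2 * w)) / den (Complex.exp w))

noncomputable def Mf (s : ℂ) : ℂ := ∫ ξ : ℝ, qf s (ξ + ((Real.pi / 4 : ℝ) : ℂ) * I)

theorem kap_exp (ξ : ℝ) : Complex.exp (ξ + ((Real.pi / 4 : ℝ) : ℂ) * I) = kap * (Real.exp ξ : ℝ) := by
  rw [Complex.exp_add, kap, ofReal_exp, mul_comm]; congr 2; push_cast; ring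

theorem Qf_neg (s : ℂ) {v : ℝ} (hv : 0 < v) :
    Qf s (kap * ((-v : ℝ) : ℂ)) = -Complex.exp (I * Real.pi * s) * Qf s (kap * v) := by
  have hx0 : kap * (v : ℂ) ≠ 0 := mul_ne_zero kap_ne (by exact_mod_cast hv.ne')
  have e : kap * ((-v : ℝ) : ℂ) = -(kap * v) := by push_cast; ring
  have him : 0 < (kap * v : ℂ).im := by simp [kap_im]; positivity
  have hlog : Complex.log (-(kap * v)) = Complex.log (kap * v) - Real.pi * I := by
    rw [Complex.log, Complex.log, norm_neg, arg_neg_eq_arg_sub_pi_of_im_pos him]; push_cast; ring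
  have hden : den (-(kap * v)) = -den (kap * v) := by
    simp only [den, mul_neg, neg_neg]; ring
  rw [e, Qf, Qf, hden, cpow_def_of_ne_zero (neg_ne_zero.2 hx0), cpow_def_of_ne_zero hx0, hlog,
    neg_sq, div_neg]
  have : ((Complex.log (kap * v) - Real.pi * I) * -s) = Complex.log (kap * v) * -s + I * Real.pi * s := by
    ring
  rw [this, Complex.exp_add]; ring

theorem qf_eq_Qf (s : ℂ) (ξ : ℝ) : qf s (ξ + ((Real.pi / 4 : ℝ) : ℂ) * I) =
    -(kap * (Real.exp ξ * Qf s (kap * (Real.exp ξ : ℝ)))) := by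
  have hx0 : kap * (Real.exp ξ : ℂ) ≠ 0 := mul_ne_zero kap_ne (by exact_mod_cast (Real.exp_pos ξ).ne')
  set w : ℂ := ξ + ((Real.pi / 4 : ℝ) : ℂ) * I with hw
  have hl : Complex.log (Complex.exp w) = w := by
    have : w.im = Real.pi / 4 := by simp [hw]
    exact Complex.log_exp (by rw [this]; linarith [Real.pi_pos]) (by rw [this]; linarith [Real.pi_pos])
  have h1 : Complex.exp w = kap * (Real.exp ξ : ℝ) := kap_exp ξ
  rw [qf, Qf, cpow_def_of_ne_zero hx0, ← h1, hl, ← mul_assoc kap, ← h1]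
  have : Complex.exp (2 * w) = Complex.exp w ^ 2 := by rw [← Complex.exp_nat_mul]; simp
  rw [this, Complex.exp_add]
  have : (1 - s) * w = w + w * -s := by ring
  rw [this, Complex.exp_add]
  ring

theorem R_eq_M {s : ℂ} (hs : s.re ≤ -2) :
    RiemannR s = (1 - Complex.exp (I * Real.pi * s)) * Mf s := by
  rw [R_eq_Lint, Lint_zero hs]
  have hi := Qf_zero_integrable hs
  have e1 : ∫ v : ℝ, Qf s (kap * v) =
      (1 - Complex.exp (I * Real.pi * s)) * ∫ v in Ioi (0 : ℝ), Qf s (kap * v) := by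
    rw [← intervalIntegral.integral_Iic_add_Ioi (b := 0) hi.integrableOn hi.integrableOn,
      ← neg_zero, ← integral_comp_neg_Ioi, neg_zero]
    have : ∫ v in Ioi (0 : ℝ), Qf s (kap * ((-v : ℝ) : ℂ)) =
        ∫ v in Ioi (0 : ℝ), -Complex.exp (I * Real.pi * s) * Qf s (kap * v) :=
      setIntegral_congr_fun measurableSet_Ioi fun v hv => Qf_neg s hv
    rw [this, integral_const_mul]; ring
  have e2 : ∫ v in Ioi (0 : ℝ), Qf s (kap * v) =
      ∫ ξ : ℝ, (Real.exp ξ : ℂ) * Qf s (kap * (Real.exp ξ : ℝ)) := by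
    have := integral_image_eq_integral_abs_deriv_smul (s := univ) (f := Real.exp) (f' := Real.exp)
      MeasurableSet.univ (fun x _ => (Real.hasDerivAt_exp x).hasDerivWithinAt)
      Real.exp_injective.injOn (fun v : ℝ => Qf s (kap * v))
    rw [image_univ, Real.range_exp, setIntegral_univ] at this
    rw [this]
    refine integral_congr_ae (Eventually.of_forall fun ξ => ?_)
    simp only [abs_of_pos (Real.exp_pos ξ), Complex.real_smul]
  have e3 : Mf s = -(kap * ∫ v in Ioi (0 : ℝ), Qf s (kap * v)) := by
    rw [Mf, e2, ← integral_const_mul, ← integral_neg]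
    simp_rw [qf_eq_Qf]
  rw [e1, e3]; ring

theorem exp_tail (a k : ℝ) (ha : 1 ≤ a) (hk : 0 < k) : ∃ C : ℝ, 0 ≤ C ∧ ∀ ξ : ℝ,
    Real.exp (a * ξ - k * Real.exp (2 * ξ)) ≤ C * (1 + ξ ^ 2)⁻¹ := by
  refine ⟨2 * Real.exp ((a + 1) ^ 2 / (8 * k)), by positivity, fun ξ => ?_⟩
  have h1 : a * ξ - k * Real.exp (2 * ξ) ≤ (a + 1) ^ 2 / (8 * k) - |ξ| := by
    have h0 : 0 ≤ (a + 1) ^ 2 / (8 * k) := by positivity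
    rcases le_total 0 ξ with h | h
    · rw [abs_of_nonneg h]
      have h2 : 2 * ξ ^ 2 ≤ Real.exp (2 * ξ) := by
        have := Real.quadratic_le_exp_of_nonneg (by linarith : 0 ≤ 2 * ξ); nlinarith
      have h3 : (a + 1) * ξ - 2 * k * ξ ^ 2 ≤ (a + 1) ^ 2 / (8 * k) := by
        rw [le_div_iff₀ (by positivity)]; nlinarith [sq_nonneg ((a + 1) - 4 * k * ξ)]
      nlinarith
    · rw [abs_of_nonpos h]
      have : 0 < k * Real.exp (2 * ξ) := by positivity
      nlinarith
  refine (Real.exp_le_exp.2 h1).trans ?_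
  rw [Real.exp_sub, mul_comm (2 : ℝ), mul_assoc, div_eq_mul_inv]
  gcongr
  rw [← div_eq_mul_inv, inv_le_comm₀ (Real.exp_pos _) (by positivity), inv_div,
    div_le_iff₀ (by norm_num)]
  have := Real.quadratic_le_exp_of_nonneg (abs_nonneg ξ)
  rw [sq_abs] at this
  nlinarith [abs_nonneg ξ]

theorem norm_exp_e (y ξ : ℝ) (s : ℂ) :
    ‖Complex.exp ((1 - s) * (ξ + y * I) + Real.pi * I * Complex.exp (2 * (ξ + y * I)))‖ =
    Real.exp ((1 - s.re) * ξ + s.im * y - Real.pi * Real.exp (2 * ξ) * Real.sin (2 * y)) := by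
  rw [Complex.norm_exp]
  congr 1
  simp [Complex.exp_im]; ring

theorem exp_im' (y ξ : ℝ) : (Complex.exp (ξ + y * I)).im = Real.exp ξ * Real.sin y := by
  simp [Complex.exp_im]

theorem den_exp_lower {y ξ : ℝ} (h : 0 ≤ Real.sin y) :
    Real.pi * (Real.exp ξ * Real.sin y) ≤ ‖den (Complex.exp (ξ + y * I))‖ := by
  refine le_trans ?_ (den_lower _)
  rw [exp_im', abs_of_nonneg (by positivity)]
  linarith [Real.add_one_le_exp (Real.pi * (Real.exp ξ * Real.sin y))]

theorem qf_tail (s : ℂ) (hs : s.re ≤ -1) {α : ℝ} (h0 : 0 < α) (h1 : α ≤ Real.pi / 4) :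
    ∃ C : ℝ, 0 ≤ C ∧ ∀ ξ y : ℝ, α ≤ y → y ≤ Real.pi / 4 → ‖qf s (ξ + y * I)‖ ≤ C * (1 + ξ ^ 2)⁻¹ := by
  have hpi := Real.pi_pos
  have hsα : 0 < Real.sin α := Real.sin_pos_of_pos_of_lt_pi h0 (by linarith)
  have hs2α : 0 < Real.sin (2 * α) := Real.sin_pos_of_pos_of_lt_pi (by linarith) (by linarith)
  obtain ⟨C, hC, h⟩ := exp_tail (-s.re) (Real.pi * Real.sin (2 * α)) (by linarith) (by positivity)
  refine ⟨Real.exp (|s.im| * Real.pi) / (Real.pi * Real.sin α) * C, by positivity, fun ξ y hy1 hy2 => ?_⟩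
  have m1 : Real.sin α ≤ Real.sin y := Real.sin_le_sin_of_le_of_le_pi_div_two (by linarith) (by linarith) hy1
  have m2 : Real.sin (2 * α) ≤ Real.sin (2 * y) :=
    Real.sin_le_sin_of_le_of_le_pi_div_two (by linarith) (by linarith) (by linarith)
  rw [qf, norm_neg, norm_div, norm_exp_e]
  have hd := den_exp_lower (y := y) (ξ := ξ) (by linarith)
  have hd2 : Real.pi * (Real.exp ξ * Real.sin α) ≤ ‖den (Complex.exp (ξ + y * I))‖ := by
    refine le_trans ?_ hd; gcongr
  refine (div_le_div_of_nonneg_left (Real.exp_pos _).le (by positivity) hd2).trans ?_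
  have e1 : Real.exp ((1 - s.re) * ξ + s.im * y - Real.pi * Real.exp (2 * ξ) * Real.sin (2 * y)) ≤
      Real.exp ξ * (Real.exp (|s.im| * Real.pi) *
        Real.exp (-s.re * ξ - Real.pi * Real.sin (2 * α) * Real.exp (2 * ξ))) := by
    rw [← Real.exp_add, ← Real.exp_add]
    refine Real.exp_le_exp.2 ?_
    have a1 : s.im * y ≤ |s.im| * Real.pi := by
      refine (le_abs_self _).trans ?_
      rw [abs_mul, abs_of_nonneg (by linarith : 0 ≤ y)]; gcongr; linarith
    have a2 : Real.pi * Real.exp (2 * ξ) * Real.sin (2 * α) ≤ Real.pi * Real.exp (2 * ξ) * Real.sin (2 * y) := by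
      gcongr
    linarith
  rw [div_le_iff₀ (by positivity)]
  refine e1.trans ?_
  calc _ ≤ Real.exp ξ * (Real.exp (|s.im| * Real.pi) * (C * (1 + ξ ^ 2)⁻¹)) := by gcongr; exact h ξ
    _ = _ := by field_simp

theorem qf_diffAt (s : ℂ) {w : ℂ} (h0 : 0 < w.im) (h1 : w.im < Real.pi) : DifferentiableAt ℂ (qf s) w := by
  unfold qf
  refine (DifferentiableAt.div (by fun_prop) ?_ ?_).neg
  · exact (den_differentiable _).comp w (by fun_prop)
  · refine den_ne_zero fun n hn => ?_
    have : 0 < (Complex.exp w).im := by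
      rw [Complex.exp_im]; have := Real.sin_pos_of_pos_of_lt_pi h0 h1; positivity
    rw [hn] at this; simp at this

theorem qf_integrable (s : ℂ) (hs : s.re ≤ -1) {α : ℝ} (h0 : 0 < α) (h1 : α ≤ Real.pi / 4) :
    Integrable fun ξ : ℝ => qf s (ξ + α * I) := by
  obtain ⟨C, _, hC⟩ := qf_tail s hs h0 h1
  refine (integrable_inv_one_add_sq.const_mul C).mono' ?_ (Eventually.of_forall fun ξ => hC ξ α le_rfl h1)
  refine (continuous_iff_continuousAt.2 fun ξ => ?_).aestronglyMeasurable
  have := (qf_diffAt s (w := ξ + α * I) (by simpa using h0) (by simp; linarith [Real.pi_pos])).continuousAt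
  exact ContinuousAt.comp (f := fun ξ : ℝ => (ξ + α * I : ℂ)) this (by fun_prop)

theorem M_shift (s : ℂ) (hs : s.re ≤ -1) {α : ℝ} (h0 : 0 < α) (h1 : α ≤ Real.pi / 4) :
    Mf s = ∫ ξ : ℝ, qf s (ξ + α * I) := by
  obtain ⟨C, _, hC⟩ := qf_tail s hs h0 h1
  have hpi := Real.pi_pos
  have hcd : ∀ z ∈ cstrip α (Real.pi / 4), DifferentiableAt ℂ (qf s) z := fun z hz =>
    qf_diffAt s (h0.trans_le hz.1) (by linarith [hz.2])
  have key := strip_limit (f := qf s) (K := 0) h1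
    (by
      filter_upwards [eventually_ge_atTop 0] with X hX
      refine strip_rect h1 (fun z hz => (hcd z hz).continuousAt.continuousWithinAt)
        (fun z hz => (hcd z ⟨hz.1.le, hz.2.le⟩).differentiableWithinAt) hX)
    (qf_integrable s hs h0 h1) (qf_integrable s hs (by positivity) le_rfl)
    (fun X => C * (1 + X ^ 2)⁻¹)
    (by
      have : Tendsto (fun X : ℝ => (1 + X ^ 2)⁻¹) atTop (𝓝 0) :=
        tendsto_inv_atTop_zero.comp (tendsto_atTop_add_const_left _ _ (tendsto_pow_atTop (by norm_num)))
      simpa using this.const_mul C)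
    (by
      filter_upwards with X y hy
      refine ⟨hC X y hy.1 hy.2, ?_⟩
      have := hC (-X) y hy.1 hy.2
      simpa using this)
  rw [Mf, ← sub_eq_zero.1 key]

end Sg

end

section

namespace Sg
open Complex Set MeasureTheory Metric Filter Topology
set_option autoImplicit false

noncomputable def ell (s : ℂ) : ℂ := Complex.log (s / (2 * Real.pi * I)) / 2
noncomputable def eta (s : ℂ) : ℂ := Complex.exp (ell s)
noncomputable def gf (s : ℂ) : ℂ := Complex.exp (-s * ell s + s / 2)

theorem twopi_ne : (2 * Real.pi * I : ℂ) ≠ 0 := by simp [Real.pi_ne_zero]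

theorem sdiv_re (s : ℂ) : (s / (2 * Real.pi * I)).re = s.im / (2 * Real.pi) := by
  have : s / (2 * Real.pi * I) = ((1 / (2 * Real.pi) : ℝ) : ℂ) * (-I * s) := by
    have := twopi_ne
    push_cast
    field_simp
    linear_combination (s) * I_sq
  rw [this, re_ofReal_mul]; simp; ring

theorem sdiv_im (s : ℂ) : (s / (2 * Real.pi * I)).im = -s.re / (2 * Real.pi) := by
  have : s / (2 * Real.pi * I) = ((1 / (2 * Real.pi) : ℝ) : ℂ) * (-I * s) := by
    have := twopi_ne
    push_cast
    field_simp
    linear_combination (s) * I_sq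
  rw [this, im_ofReal_mul]; simp; ring

theorem eta_sq {s : ℂ} (hs : s ≠ 0) : s = 2 * Real.pi * I * eta s ^ 2 := by
  have h0 : s / (2 * Real.pi * I) ≠ 0 := div_ne_zero hs twopi_ne
  rw [eta, ← Complex.exp_nat_mul, ell]
  have : ((2 : ℕ) * (Complex.log (s / (2 * Real.pi * I)) / 2) : ℂ) = Complex.log (s / (2 * Real.pi * I)) := by
    push_cast; ring
  rw [this, Complex.exp_log h0]
  have := twopi_ne
  field_simp

theorem eta_ne (s : ℂ) : eta s ≠ 0 := Complex.exp_ne_zero _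

theorem ne_of_im {s : ℂ} (h : 0 < s.im) : s ≠ 0 := by rintro rfl; simp at h

theorem eta_norm {s : ℂ} (h : 0 < s.im) : 2 * Real.pi * ‖eta s‖ ^ 2 = ‖s‖ := by
  conv_rhs => rw [eta_sq (ne_of_im h)]
  simp [abs_of_pos Real.pi_pos]

theorem ell_im (s : ℂ) : (ell s).im = arg (s / (2 * Real.pi * I)) / 2 := by
  have : ell s = ((1 / 2 : ℝ) : ℂ) * Complex.log (s / (2 * Real.pi * I)) := by rw [ell]; push_cast; ring
  rw [this, im_ofReal_mul, log_im]; ring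

theorem ell_im_bounds {s : ℂ} (h : 0 < s.im) : |(ell s).im| < Real.pi / 4 := by
  have : |arg (s / (2 * Real.pi * I))| < Real.pi / 2 :=
    abs_arg_lt_pi_div_two_iff.2 (Or.inl (by rw [sdiv_re]; have := Real.pi_pos; positivity))
  rw [ell_im, abs_div, abs_of_pos (by norm_num : (0:ℝ) < 2)]; linarith

theorem ell_im_pos {s : ℂ} (_h : 0 < s.im) (hr : s.re < 0) : 0 < (ell s).im := by
  rw [ell_im]
  have h1 : 0 < (s / (2 * Real.pi * I)).im := by
    rw [sdiv_im]; have := Real.pi_pos; apply div_pos <;> linarith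
  have h2 : 0 ≤ arg (s / (2 * Real.pi * I)) := arg_nonneg_iff.2 h1.le
  have h3 : arg (s / (2 * Real.pi * I)) ≠ 0 := fun h => by
    rw [arg_eq_zero_iff] at h; linarith [h.2]
  have : 0 < arg (s / (2 * Real.pi * I)) := lt_of_le_of_ne h2 (Ne.symm h3)
  linarith

theorem eta_norm_eq (s : ℂ) : ‖eta s‖ = Real.exp (ell s).re := Complex.norm_exp _

theorem eta_re_im {s : ℂ} (h : 0 < s.im) :
    s.im = 2 * Real.pi * ((eta s).re ^ 2 - (eta s).im ^ 2) ∧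
    -s.re = 4 * Real.pi * (eta s).re * (eta s).im := by
  have e := eta_sq (ne_of_im h)
  constructor
  · conv_lhs => rw [e]
    simp [pow_two]
  · conv_lhs => rw [e]
    simp [pow_two]; ring

theorem eta_re_pos {s : ℂ} (h : 0 < s.im) : 0 < (eta s).re := by
  rw [eta, Complex.exp_re]
  have := abs_lt.1 (ell_im_bounds h)
  have h2 : 0 < Real.cos (ell s).im := Real.cos_pos_of_mem_Ioo ⟨by linarith [Real.pi_pos], by linarith [Real.pi_pos]⟩
  positivity

theorem eta_im_pos {s : ℂ} (h : 0 < s.im) (hr : s.re < 0) : 0 < (eta s).im := by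
  have h1 := (eta_re_im h).2
  have h2 := eta_re_pos h
  by_contra hcon
  push Not at hcon
  have : 4 * Real.pi * (eta s).re * (eta s).im ≤ 0 :=
    mul_nonpos_of_nonneg_of_nonpos (by have := Real.pi_pos; positivity) hcon
  linarith

theorem eta_norm_sq (s : ℂ) : ‖eta s‖ ^ 2 = (eta s).re ^ 2 + (eta s).im ^ 2 := by
  rw [← normSq_eq_norm_sq, normSq_apply]; ring

theorem eta_re_ge {s : ℂ} (h : 0 < s.im) : ‖eta s‖ / 2 ≤ (eta s).re := by
  have h0 := eta_re_pos h
  have h1 := (eta_re_im h).1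
  have h2 := eta_norm_sq s
  have h3 : (eta s).im ^ 2 < (eta s).re ^ 2 := by
    have := Real.pi_pos
    by_contra hcon
    push Not at hcon
    have : 2 * Real.pi * ((eta s).re ^ 2 - (eta s).im ^ 2) ≤ 0 :=
      mul_nonpos_of_nonneg_of_nonpos (by positivity) (by linarith)
    linarith
  refine abs_le_of_sq_le_sq' ?_ h0.le |>.2
  rw [div_pow, h2]; nlinarith [sq_nonneg (eta s).im]

/-- `p(w) = e^{2w}/2 - 1/2 - w`. -/
noncomputable def pf (w : ℂ) : ℂ := Complex.exp (2 * w) / 2 - 1 / 2 - w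
noncomputable def pr (x : ℝ) : ℝ := Real.exp (2 * x) / 2 - 1 / 2 - x

theorem pf_real (x : ℝ) : pf x = (pr x : ℂ) := by
  rw [pf, pr]; push_cast; rfl

theorem pr_nonneg (x : ℝ) : 0 ≤ pr x := by
  rw [pr]; linarith [Real.add_one_le_exp (2 * x)]

theorem qf_trans {s : ℂ} (hs : s ≠ 0) (w : ℂ) : qf s (ell s + w) =
    gf s * eta s * (-(Complex.exp (w + s * pf w) / den (eta s * Complex.exp w))) := by
  have e := eta_sq hs
  have e1 : Real.pi * I * eta s ^ 2 = s / 2 := by linear_combination (-1 / 2 : ℂ) * e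
  have e2 : Complex.exp (2 * (ell s + w)) = eta s ^ 2 * Complex.exp (2 * w) := by
    rw [mul_add, Complex.exp_add, eta, ← Complex.exp_nat_mul]; simp
  have e3 : Complex.exp (ell s + w) = eta s * Complex.exp w := by rw [Complex.exp_add, eta]
  have e4 : (1 - s) * (ell s + w) + Real.pi * I * Complex.exp (2 * (ell s + w)) =
      (-s * ell s + s / 2) + (ell s + (w + s * pf w)) := by
    rw [e2, pf]; linear_combination Complex.exp (2 * w) * e1
  rw [qf, e4, e3, Complex.exp_add, Complex.exp_add (ell s), gf, eta]; ring

theorem M_trans {s : ℂ} (ht : 0 < s.im) (hs : s.re ≤ -1) :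
    Integrable (fun ξ : ℝ => -(Complex.exp (ξ + s * pf ξ) / den (eta s * Complex.exp ξ))) ∧
    Mf s = gf s * eta s * ∫ ξ : ℝ, -(Complex.exp (ξ + s * pf ξ) / den (eta s * Complex.exp ξ)) := by
  have h0 := ell_im_pos ht (by linarith)
  have h1 := (abs_lt.1 (ell_im_bounds ht)).2
  have e : ∀ ξ : ℝ, qf s (((ξ + (ell s).re : ℝ) : ℂ) + (ell s).im * I) =
      gf s * eta s * (-(Complex.exp (ξ + s * pf ξ) / den (eta s * Complex.exp ξ))) := by
    intro ξ
    rw [← qf_trans (ne_of_im ht)]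
    congr 1
    conv_rhs => rw [← re_add_im (ell s)]
    push_cast; ring
  constructor
  · have := (qf_integrable s hs h0 h1.le).comp_add_right (ell s).re
    simp_rw [e] at this
    have h2 := this.const_mul (gf s * eta s)⁻¹
    refine h2.congr (Eventually.of_forall fun ξ => ?_)
    have : gf s * eta s ≠ 0 := mul_ne_zero (Complex.exp_ne_zero _) (eta_ne s)
    simp only
    rw [inv_mul_cancel_left₀ this]
  · rw [M_shift s hs h0 h1.le, ← integral_add_right_eq_self (fun ξ : ℝ => qf s (ξ + (ell s).im * I)) (ell s).re,
      ← integral_const_mul]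
    simp_rw [e]

theorem den_eta_lower {s : ℂ} (hy : 0 < (eta s).im) (ξ : ℝ) :
    Real.pi * ((eta s).im * Real.exp ξ) ≤ ‖den (eta s * Complex.exp ξ)‖ := by
  refine le_trans ?_ (den_lower _)
  have : (eta s * Complex.exp ξ).im = (eta s).im * Real.exp ξ := by
    rw [← ofReal_exp, im_mul_ofReal]
  rw [this, abs_of_pos (by positivity)]
  linarith [Real.add_one_le_exp (Real.pi * ((eta s).im * Real.exp ξ))]

theorem norm_e {s : ℂ} (ξ : ℝ) : ‖Complex.exp (ξ + s * pf ξ)‖ = Real.exp (ξ - (-s.re) * pr ξ) := by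
  rw [Complex.norm_exp, pf_real]; congr 1; simp

theorem int_e (a : ℝ) : Integrable fun ξ : ℝ => Real.exp (a * ξ - (|a| + 1) * pr ξ) := by
  obtain ⟨C, hC, h⟩ := exp_tail (a + (|a| + 1)) ((|a| + 1) / 2) (by linarith [neg_abs_le a]) (by positivity)
  refine ((integrable_inv_one_add_sq.const_mul C).const_mul (Real.exp ((|a| + 1) / 2))).mono' ?_
    (Eventually.of_forall fun ξ => ?_)
  · unfold pr; exact (by fun_prop : Continuous _).aestronglyMeasurable
  · rw [Real.norm_of_nonneg (Real.exp_pos _).le]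
    have e : a * ξ - (|a| + 1) * pr ξ = (|a| + 1) / 2 + ((a + (|a| + 1)) * ξ - (|a| + 1) / 2 * Real.exp (2 * ξ)) := by
      rw [pr]; ring
    rw [e, Real.exp_add]
    gcongr
    exact h ξ

theorem M_bound : ∃ C : ℝ, 0 < C ∧ ∀ s : ℂ, 0 < s.im → s.re ≤ -1 →
    ‖Mf s‖ ≤ C * (‖gf s‖ * (‖eta s‖ / (eta s).im)) := by
  have hI := int_e 0
  simp only [zero_mul, abs_zero, zero_add, one_mul, zero_sub] at hI
  refine ⟨(∫ ξ, Real.exp (-pr ξ)) / Real.pi + 1, ?_, fun s ht hs => ?_⟩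
  · have : 0 ≤ ∫ ξ, Real.exp (-pr ξ) := integral_nonneg fun _ => (Real.exp_pos _).le
    have := Real.pi_pos; positivity
  have hy := eta_im_pos ht (by linarith)
  have hpi := Real.pi_pos
  rw [(M_trans ht hs).2, norm_mul, norm_mul]
  have key : ‖∫ ξ : ℝ, -(Complex.exp (ξ + s * pf ξ) / den (eta s * Complex.exp ξ))‖ ≤
      ∫ ξ : ℝ, (1 / (Real.pi * (eta s).im)) * Real.exp (-pr ξ) := by
    refine norm_integral_le_of_norm_le (hI.const_mul _) (Eventually.of_forall fun ξ => ?_)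
    rw [norm_neg, norm_div, norm_e]
    refine (div_le_div_of_nonneg_left (Real.exp_pos _).le (by positivity) (den_eta_lower hy ξ)).trans ?_
    rw [div_le_iff₀ (by positivity), Real.exp_sub]
    have h1 : Real.exp (-(-s.re * pr ξ)) ≤ Real.exp (-pr ξ) :=
      Real.exp_le_exp.2 (by nlinarith [pr_nonneg ξ])
    calc Real.exp ξ / Real.exp (-s.re * pr ξ) = Real.exp ξ * Real.exp (-(-s.re * pr ξ)) := by
          rw [Real.exp_neg (-s.re * pr ξ)]; rfl
      _ ≤ Real.exp ξ * Real.exp (-pr ξ) := by gcongr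
      _ = _ := by field_simp
  rw [integral_const_mul] at key
  calc _ ≤ ‖gf s‖ * ‖eta s‖ * (1 / (Real.pi * (eta s).im) * ∫ ξ, Real.exp (-pr ξ)) := by gcongr
    _ = ((∫ ξ, Real.exp (-pr ξ)) / Real.pi) * (‖gf s‖ * (‖eta s‖ / (eta s).im)) := by field_simp
    _ ≤ _ := by gcongr; linarith

end Sg

end

section

namespace Sg
open Complex Set MeasureTheory Metric Filter Topology
set_option autoImplicit false

/-- exponent of the saddle point integral -/
noncomputable def Ef (s w : ℂ) : ℂ :=
  w + s * pf w + Real.pi * I * (eta s * (Complex.exp w - 1))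

noncomputable def Jf (s : ℂ) : ℂ := ∫ ξ : ℝ, Complex.exp (Ef s ξ)

theorem Ef_real (s : ℂ) (ξ : ℝ) : Complex.exp (Ef s ξ) =
    Complex.exp (-(Real.pi * I * eta s)) * (Complex.exp (ξ + s * pf ξ) *
      Complex.exp (Real.pi * I * (eta s * Complex.exp ξ))) := by
  rw [← Complex.exp_add, ← Complex.exp_add, Ef]; congr 1; ring

theorem norm_ey (s : ℂ) (ξ : ℝ) : ‖Complex.exp (Real.pi * I * (eta s * Complex.exp ξ))‖ =
    Real.exp (-(Real.pi * ((eta s).im * Real.exp ξ))) := by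
  have h : (eta s * Complex.exp ξ).im = (eta s).im * Real.exp ξ := by
    rw [← ofReal_exp, im_mul_ofReal]
  rw [Complex.norm_exp]; congr 1
  rw [mul_assoc, re_ofReal_mul, I_mul_re, h]; ring

theorem J_integrable {s : ℂ} (ht : 0 < s.im) (hs : s.re ≤ -2) :
    Integrable fun ξ : ℝ => Complex.exp (Ef s ξ) := by
  have hI := int_e 1
  simp only [one_mul, abs_one] at hI
  have hy := eta_im_pos ht (by linarith)
  refine (hI.const_mul ‖Complex.exp (-(Real.pi * I * eta s))‖).mono' ?_ (Eventually.of_forall fun ξ => ?_)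
  · unfold Ef pf; exact (by fun_prop : Continuous _).aestronglyMeasurable
  · rw [Ef_real, norm_mul, norm_mul, norm_e, norm_ey]
    gcongr
    have h1 : Real.exp (-(Real.pi * ((eta s).im * Real.exp ξ))) ≤ 1 :=
      Real.exp_le_one_iff.2 (by have := Real.pi_pos; have : 0 ≤ Real.pi * ((eta s).im * Real.exp ξ) := by positivity
                                linarith)
    refine (mul_le_of_le_one_right (Real.exp_pos _).le h1).trans (Real.exp_le_exp.2 ?_)
    nlinarith [pr_nonneg ξ]

theorem M_sub_J : ∃ C : ℝ, 0 < C ∧ ∀ s : ℂ, 0 < s.im → s.re ≤ -2 → 60 ≤ ‖eta s‖ → 1 ≤ (eta s).im →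
    ‖Mf s / (gf s * Complex.exp (Real.pi * I * eta s)) - eta s * Jf s‖ ≤
      C * (‖eta s‖ * Real.exp (-(Real.pi / 2 * (eta s).im))) := by
  have hI := int_e 0
  simp only [zero_mul, abs_zero, zero_add, one_mul, zero_sub] at hI
  refine ⟨(∫ ξ, Real.exp (-pr ξ)) + 1, ?_, fun s ht hs hη hy1 => ?_⟩
  · have : 0 ≤ ∫ ξ, Real.exp (-pr ξ) := integral_nonneg fun _ => (Real.exp_pos _).le
    positivity
  have hpi := Real.pi_gt_three
  have hpi4 := Real.pi_lt_four
  set y := (eta s).im with hy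
  have hx := eta_re_ge ht
  have hA : 360 * y ≤ -s.re := by
    rw [(eta_re_im ht).2, ← hy]
    have : 4 * 3 * 30 * y ≤ 4 * Real.pi * (eta s).re * y := by gcongr; linarith
    linarith
  obtain ⟨i1, e1⟩ := M_trans ht (by linarith)
  have hg : gf s ≠ 0 := Complex.exp_ne_zero _
  set E := Complex.exp (Real.pi * I * eta s) with hE
  have hE0 : E ≠ 0 := Complex.exp_ne_zero _
  have e2 : Mf s / (gf s * E) - eta s * Jf s = eta s * ∫ ξ : ℝ,
      (E⁻¹ * (-(Complex.exp (ξ + s * pf ξ) / den (eta s * Complex.exp ξ))) - Complex.exp (Ef s ξ)) := by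
    rw [integral_sub (i1.const_mul _) (J_integrable ht hs), integral_const_mul, e1, Jf]
    field_simp
  have hEn : ‖E⁻¹‖ = Real.exp (Real.pi * y) := by
    rw [hE, ← Complex.exp_neg, Complex.norm_exp]; simp [hy]
  rw [e2, norm_mul]
  have key : ‖∫ ξ : ℝ, (E⁻¹ * (-(Complex.exp (ξ + s * pf ξ) / den (eta s * Complex.exp ξ))) -
      Complex.exp (Ef s ξ))‖ ≤ ∫ ξ, Real.exp (-(Real.pi / 2 * y)) * Real.exp (-pr ξ) := by
    refine norm_integral_le_of_norm_le (hI.const_mul _) (Eventually.of_forall fun ξ => ?_)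
    set Y := eta s * Complex.exp ξ with hY
    have hd := den_eta_lower (by linarith : 0 < (eta s).im) ξ
    have hd0 : den Y ≠ 0 := norm_pos_iff.1 (lt_of_lt_of_le (by positivity) hd)
    have hden : den Y = Complex.exp (Real.pi * I * Y) - (Complex.exp (Real.pi * I * Y))⁻¹ := by
      rw [den, Complex.exp_neg]
    have hez : Complex.exp (Real.pi * I * Y) ≠ 0 := Complex.exp_ne_zero _
    have e3 : E⁻¹ * (-(Complex.exp (ξ + s * pf ξ) / den Y)) - Complex.exp (Ef s ξ) =
        -(E⁻¹ * Complex.exp (ξ + s * pf ξ) * (Complex.exp (Real.pi * I * Y)) ^ 2 / den Y) := by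
      rw [Ef_real, ← hY, Complex.exp_neg, ← hE]
      have h3 : den Y * Complex.exp (Real.pi * I * Y) = Complex.exp (Real.pi * I * Y) ^ 2 - 1 := by
        rw [hden]; field_simp
      field_simp
      linear_combination (-1 : ℂ) * h3
    rw [e3, norm_neg, norm_div, norm_mul, norm_mul, hEn, norm_e, norm_pow, norm_ey, ← hy]
    refine (div_le_div_of_nonneg_left (by positivity) (by positivity) hd).trans ?_
    rw [div_le_iff₀ (by positivity), ← hy]
    have h1 : Real.exp ξ ≤ Real.pi * (y * Real.exp ξ) := by
      have h11 : 1 ≤ Real.pi * y := by nlinarith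
      calc Real.exp ξ = 1 * Real.exp ξ := (one_mul _).symm
        _ ≤ (Real.pi * y) * Real.exp ξ := by gcongr
        _ = _ := by ring
    refine le_trans ?_ (mul_le_mul_of_nonneg_left h1 (by positivity))
    rw [← Real.exp_nat_mul, ← Real.exp_add, ← Real.exp_add, ← Real.exp_add, ← Real.exp_add]
    refine Real.exp_le_exp.2 ?_
    push_cast
    have hp := pr_nonneg ξ
    have hev : 0 < Real.exp ξ := Real.exp_pos _
    rcases le_or_gt (3 / 4) (Real.exp ξ) with h | h
    · have h2 : Real.pi * (y * (3 / 4)) ≤ Real.pi * (y * Real.exp ξ) := by gcongr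
      nlinarith
    · have h2 : 1 / 32 ≤ pr ξ := by
        have e5 : Real.exp (2 * ξ) = Real.exp ξ ^ 2 := by rw [← Real.exp_nat_mul]; simp
        rw [pr, e5]
        have := Real.add_one_le_exp ξ
        nlinarith
      have h3 : 0 ≤ Real.pi * (y * Real.exp ξ) := by positivity
      have h4 : (360 * y - 1) * (1 / 32) ≤ (-s.re - 1) * pr ξ := by gcongr; linarith
      have h5 : Real.pi * y ≤ 4 * y := by gcongr
      nlinarith
  rw [integral_const_mul] at key
  calc _ ≤ ‖eta s‖ * (Real.exp (-(Real.pi / 2 * y)) * ∫ ξ, Real.exp (-pr ξ)) := by gcongr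
    _ = (∫ ξ, Real.exp (-pr ξ)) * (‖eta s‖ * Real.exp (-(Real.pi / 2 * y))) := by ring
    _ ≤ _ := by gcongr; linarith

end Sg

end

section

namespace Sg
open Complex Set MeasureTheory Metric Filter Topology
set_option autoImplicit false

/-- height of the deformed path -/
noncomputable def psi (ξ : ℝ) : ℝ := ξ / (4 * (1 + ξ ^ 2))
noncomputable def psi' (ξ : ℝ) : ℝ := (1 - ξ ^ 2) / (4 * (1 + ξ ^ 2) ^ 2)
noncomputable def gam (ξ : ℝ) : ℂ := ξ + psi ξ * I
noncomputable def gam' (ξ : ℝ) : ℂ := 1 + psi' ξ * I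

theorem psi_abs (ξ : ℝ) : |psi ξ| = |ξ| / (4 * (1 + ξ ^ 2)) := by
  rw [psi, abs_div, abs_of_pos (by positivity : (0 : ℝ) < 4 * (1 + ξ ^ 2))]

theorem psi_le (ξ : ℝ) : |psi ξ| ≤ |ξ| / 4 := by
  rw [psi_abs, div_le_div_iff₀ (by positivity) (by norm_num)]
  nlinarith [abs_nonneg ξ, mul_nonneg (abs_nonneg ξ) (sq_nonneg ξ)]

theorem psi_le' (ξ : ℝ) : |psi ξ| ≤ 1 / 8 := by
  rw [psi_abs, div_le_div_iff₀ (by positivity) (by norm_num)]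
  nlinarith [sq_nonneg (|ξ| - 1), sq_abs ξ]

theorem psi_ge {ξ : ℝ} (h : |ξ| ≤ 1) : |ξ| / 8 ≤ |psi ξ| := by
  rw [psi_abs, div_le_div_iff₀ (by norm_num) (by positivity)]
  have : ξ ^ 2 ≤ 1 := by rw [← sq_abs]; nlinarith [abs_nonneg ξ]
  nlinarith [abs_nonneg ξ, mul_nonneg (abs_nonneg ξ) (sub_nonneg.2 this)]

theorem psi_mul (ξ : ℝ) : 0 ≤ psi ξ * ξ := by
  rw [psi, div_mul_eq_mul_div]
  exact div_nonneg (mul_self_nonneg ξ) (by positivity)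

theorem psi'_le (ξ : ℝ) : |psi' ξ| ≤ 1 / 4 := by
  rw [psi', abs_div, abs_of_pos (by positivity : (0 : ℝ) < 4 * (1 + ξ ^ 2) ^ 2),
    div_le_div_iff₀ (by positivity) (by norm_num)]
  have : |1 - ξ ^ 2| ≤ 1 + ξ ^ 2 := abs_le.2 ⟨by nlinarith [sq_nonneg ξ], by nlinarith [sq_nonneg ξ]⟩
  nlinarith [sq_nonneg ξ, sq_nonneg (ξ ^ 2)]

theorem psi_hasDerivAt (ξ : ℝ) : HasDerivAt psi (psi' ξ) ξ := by
  have h := (hasDerivAt_id ξ).div ((((hasDerivAt_id ξ).pow 2).const_add 1).const_mul 4)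
    (by simp only [id]; positivity : (4 * (1 + id ξ ^ 2) : ℝ) ≠ 0)
  refine h.congr_deriv ?_
  simp only [id, psi', Pi.pow_apply]
  have : (1 + ξ ^ 2) ≠ 0 := by positivity
  field_simp
  push_cast
  ring

theorem gam_hasDerivAt (ξ : ℝ) : HasDerivAt gam (gam' ξ) ξ := by
  have h1 : HasDerivAt (fun x : ℝ => (x : ℂ)) 1 ξ := ofRealCLM.hasDerivAt
  exact h1.add ((psi_hasDerivAt ξ).ofReal_comp.mul_const I)

theorem gam_re (ξ : ℝ) : (gam ξ).re = ξ := by simp [gam]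
theorem gam_im (ξ : ℝ) : (gam ξ).im = psi ξ := by simp [gam]

theorem gam'_norm (ξ : ℝ) : ‖gam' ξ‖ ≤ 2 := by
  rw [gam']
  refine (norm_add_le _ _).trans ?_
  have := psi'_le ξ
  simp only [norm_one, norm_mul, norm_I, mul_one, norm_real, Real.norm_eq_abs]
  linarith

theorem gam_norm (ξ : ℝ) : ‖gam ξ‖ ≤ 5 / 4 * |ξ| := by
  rw [gam]
  refine (norm_add_le _ _).trans ?_
  have := psi_le ξ
  simp only [norm_mul, norm_I, mul_one, norm_real, Real.norm_eq_abs]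
  linarith

theorem psi_continuous : Continuous psi :=
  continuous_iff_continuousAt.2 fun x => (psi_hasDerivAt x).continuousAt
theorem gam_continuous : Continuous gam :=
  continuous_iff_continuousAt.2 fun x => (gam_hasDerivAt x).continuousAt
theorem psi'_continuous : Continuous psi' := by
  unfold psi'
  exact Continuous.div (by fun_prop) (by fun_prop) fun x => by positivity
theorem gam'_continuous : Continuous gam' := by
  unfold gam'
  have := psi'_continuous
  fun_prop

theorem pf_re (w : ℂ) : (pf w).re = Real.exp (2 * w.re) * Real.cos (2 * w.im) / 2 - 1 / 2 - w.re := by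
  have : pf w = ((1 / 2 : ℝ) : ℂ) * Complex.exp (2 * w) - ((1 / 2 : ℝ) : ℂ) - w := by
    rw [pf]; push_cast; ring
  rw [this, sub_re, sub_re, re_ofReal_mul, ofReal_re, Complex.exp_re]; simp; ring

theorem pf_im (w : ℂ) : (pf w).im = Real.exp (2 * w.re) * Real.sin (2 * w.im) / 2 - w.im := by
  have : pf w = ((1 / 2 : ℝ) : ℂ) * Complex.exp (2 * w) - ((1 / 2 : ℝ) : ℂ) - w := by
    rw [pf]; push_cast; ring
  rw [this, sub_im, sub_im, im_ofReal_mul, ofReal_im, Complex.exp_im]; simp; ring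

theorem pf_small {ξ : ℝ} (h : |ξ| ≤ 1) :
    ξ ^ 2 / 16 ≤ (pf (gam ξ)).re ∧ ξ ^ 2 / 16 ≤ (pf (gam ξ)).im := by
  rw [pf_re, pf_im, gam_re, gam_im]
  have hb := abs_le.1 h
  have p1 := psi_le ξ
  have p2 := psi_ge h
  have hc := Real.one_sub_sq_div_two_le_cos (x := 2 * psi ξ)
  have hps : psi ξ ^ 2 ≤ ξ ^ 2 / 16 := by
    rw [← sq_abs, ← sq_abs ξ]; nlinarith [abs_nonneg (psi ξ), abs_nonneg ξ]
  have hc' : 1 - ξ ^ 2 / 8 ≤ Real.cos (2 * psi ξ) := by nlinarith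
  have hx2 : ξ ^ 2 ≤ 1 := by nlinarith
  rcases le_total 0 ξ with h0 | h0
  · have hps0 : 0 ≤ psi ξ := by rw [psi]; positivity
    rw [abs_of_nonneg h0] at *
    rw [abs_of_nonneg hps0] at *
    have he := Real.quadratic_le_exp_of_nonneg (by positivity : 0 ≤ 2 * ξ)
    constructor
    · have : (1 + 2 * ξ + (2 * ξ) ^ 2 / 2) * (1 - ξ ^ 2 / 8) ≤
        Real.exp (2 * ξ) * Real.cos (2 * psi ξ) := by gcongr; nlinarith
      have h3 : 0 ≤ ξ ^ 2 * (1 - ξ) := mul_nonneg (sq_nonneg _) (by linarith)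
      have h4 : 0 ≤ ξ ^ 2 * (1 - ξ ^ 2) := mul_nonneg (sq_nonneg _) (by linarith)
      nlinarith
    · have hs : 2 * psi ξ * (1 - ξ ^ 2 / 16) ≤ Real.sin (2 * psi ξ) := by
        rcases hps0.eq_or_lt with h1 | h1
        · rw [← h1]; simp
        · have := Real.sin_gt_sub_cube (by positivity : 0 < 2 * psi ξ)
          nlinarith [mul_nonneg hps0 (sub_nonneg.2 hps), mul_nonneg hps0 (sq_nonneg (psi ξ))]
      have : (1 + 2 * ξ) * (2 * psi ξ * (1 - ξ ^ 2 / 16)) ≤ Real.exp (2 * ξ) * Real.sin (2 * psi ξ) := by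
        gcongr
        · exact mul_nonneg (by positivity) (by linarith)
        · nlinarith
      have h5 : ξ ≤ (1 + 2 * ξ) * (1 - ξ ^ 2 / 16) - 1 := by nlinarith [mul_nonneg h0 (sub_nonneg.2 hx2), mul_nonneg h0 (sub_nonneg.2 hb.2)]
      have h6 : psi ξ * ξ ≤ psi ξ * ((1 + 2 * ξ) * (1 - ξ ^ 2 / 16) - 1) := by gcongr
      nlinarith
  · obtain ⟨a, rfl⟩ : ∃ a, ξ = -a := ⟨-ξ, by ring⟩
    have ha : 0 ≤ a := by linarith
    have hpn : psi (-a) = -psi a := by rw [psi, psi]; ring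
    have hps0 : 0 ≤ psi a := by rw [psi]; positivity
    rw [hpn] at hc hc' hps p1 p2 ⊢
    rw [abs_neg, abs_neg, abs_of_nonneg ha, abs_of_nonneg hps0] at p1 p2
    rw [abs_neg, abs_of_nonneg ha] at h
    have e2 : Real.exp (2 * -a) = Real.exp (-a) ^ 2 := by rw [← Real.exp_nat_mul]; simp
    constructor
    · have he : (1 - a) ^ 2 ≤ Real.exp (2 * -a) := by
        rw [e2]
        have := Real.add_one_le_exp (-a)
        have : 0 ≤ 1 - a := by linarith
        gcongr; linarith
      have he1 : Real.exp (2 * -a) ≤ 1 := Real.exp_le_one_iff.2 (by linarith)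
      have : Real.exp (2 * -a) * (1 - (-a) ^ 2 / 8) ≤ Real.exp (2 * -a) * Real.cos (2 * -psi a) := by gcongr
      nlinarith
    · have he : Real.exp (2 * -a) * (1 + 2 * a) ≤ 1 := by
        have h1 := Real.add_one_le_exp (2 * a)
        have h2 : Real.exp (2 * -a) * Real.exp (2 * a) = 1 := by rw [← Real.exp_add]; simp
        rw [← h2]; gcongr; linarith
      have hs : Real.sin (2 * psi a) ≤ 2 * psi a := Real.sin_le (by positivity)
      have h3 : Real.exp (2 * -a) * Real.sin (2 * psi a) ≤ Real.exp (2 * -a) * (2 * psi a) := by gcongr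
      have h4 : 2 * a / 3 ≤ 1 - Real.exp (2 * -a) := by
        have := Real.exp_pos (2 * -a)
        nlinarith
      have h5 : psi a * (2 * a / 3) ≤ psi a * (1 - Real.exp (2 * -a)) := by gcongr
      have h6 : Real.sin (2 * -psi a) = - Real.sin (2 * psi a) := by rw [mul_neg, Real.sin_neg]
      rw [h6]
      nlinarith

theorem pf_large {ξ v : ℝ} (h : 1 ≤ |ξ|) (hv : |v| ≤ 1 / 8) (hvx : 0 ≤ v * ξ) :
    |ξ| / 2 ≤ (pf (ξ + v * I)).re ∧ 0 ≤ (pf (ξ + v * I)).im := by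
  rw [pf_re, pf_im]
  simp only [add_re, ofReal_re, mul_re, I_re, mul_zero, ofReal_im, I_im, zero_mul, sub_zero, add_zero,
    add_im, mul_im, mul_one, zero_add]
  have hc := Real.one_sub_sq_div_two_le_cos (x := 2 * v)
  have hv2 : v ^ 2 ≤ 1 / 64 := by rw [← sq_abs]; nlinarith [abs_nonneg v]
  have hpi := Real.pi_gt_three
  have hpi4 := Real.pi_lt_four
  rcases le_total 0 ξ with h0 | h0
  · rw [abs_of_nonneg h0] at *
    have hv0 : 0 ≤ v := by
      by_contra hh; push Not at hh; nlinarith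
    rw [abs_of_nonneg hv0] at *
    have he := Real.quadratic_le_exp_of_nonneg (by positivity : 0 ≤ 2 * ξ)
    constructor
    · have : (1 + 2 * ξ + (2 * ξ) ^ 2 / 2) * (15 / 16) ≤ Real.exp (2 * ξ) * Real.cos (2 * v) := by
        gcongr; nlinarith
      nlinarith
    · have hs := Real.mul_le_sin (by positivity : 0 ≤ 2 * v) (by linarith)
      have : Real.pi * (2 / Real.pi * (2 * v)) ≤ Real.exp (2 * ξ) * Real.sin (2 * v) := by
        gcongr; nlinarith
      have e : Real.pi * (2 / Real.pi * (2 * v)) = 4 * v := by field_simp; ring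
      linarith
  · have hv0 : v ≤ 0 := by
      by_contra hh; push Not at hh
      rw [abs_of_nonpos h0] at h; nlinarith
    rw [abs_of_nonpos h0] at *
    rw [abs_of_nonpos hv0] at *
    constructor
    · have : 0 ≤ Real.exp (2 * ξ) * Real.cos (2 * v) := by
        have : 0 ≤ Real.cos (2 * v) := by nlinarith
        positivity
      linarith
    · have hs : Real.sin (2 * -v) ≤ 2 * -v := Real.sin_le (by linarith)
      have hs0 : 0 ≤ Real.sin (2 * -v) := Real.sin_nonneg_of_nonneg_of_le_pi (by linarith) (by linarith)
      have h6 : Real.sin (2 * v) = - Real.sin (2 * -v) := by rw [mul_neg, Real.sin_neg, neg_neg]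
      have he1 : Real.exp (2 * ξ) ≤ 1 := Real.exp_le_one_iff.2 (by linarith)
      rw [h6]
      nlinarith [mul_le_of_le_one_left hs0 he1]

theorem Ef_re (s w : ℂ) : (Ef s w).re = w.re - (-s.re) * (pf w).re - s.im * (pf w).im
    - Real.pi * ((eta s * (Complex.exp w - 1)).im) := by
  rw [Ef, add_re, add_re, mul_re, mul_assoc, re_ofReal_mul, I_mul_re]; ring

theorem Ef_small {s : ℂ} (ht : 0 < s.im) (hs : s.re ≤ -2) {ξ : ℝ} (h : |ξ| ≤ 1) :
    ‖Complex.exp (Ef s (gam ξ))‖ ≤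
      Real.exp (1 - (‖eta s‖ * ξ) ^ 2 / 4 + 16 * |‖eta s‖ * ξ|) := by
  rw [Complex.norm_exp]
  refine Real.exp_le_exp.2 ?_
  obtain ⟨h1, h2⟩ := pf_small h
  rw [Ef_re, gam_re]
  have hpi := Real.pi_gt_three
  have hpi4 := Real.pi_lt_d2
  have h3 : ‖Complex.exp (gam ξ) - 1‖ ≤ 5 * |ξ| := by
    have := Complex.norm_exp_sub_sum_le_norm_mul_exp (gam ξ) 1
    simp only [Finset.sum_range_one, pow_zero, Nat.factorial_zero, Nat.cast_one, div_one, pow_one] at this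
    refine this.trans ?_
    have h4 := gam_norm ξ
    have h5 : Real.exp ‖gam ξ‖ ≤ 4 := by
      calc _ ≤ Real.exp (5 / 4) := Real.exp_le_exp.2 (by linarith)
        _ ≤ 4 := by
          have e4 : Real.exp (5 / 4) ^ 4 = Real.exp 1 ^ 5 := by
            rw [← Real.exp_nat_mul, ← Real.exp_nat_mul]; norm_num
          have h6 : Real.exp 1 ^ 5 ≤ 2.7182818286 ^ 5 := by
            gcongr; exact Real.exp_one_lt_d9.le
          by_contra hh
          push Not at hh
          have : (4 : ℝ) ^ 4 < Real.exp (5 / 4) ^ 4 := by gcongr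
          rw [e4] at this
          have : (4 : ℝ) ^ 4 < 2.7182818286 ^ 5 := by linarith
          norm_num at this
    calc _ ≤ (5 / 4 * |ξ|) * 4 := by gcongr
      _ = _ := by ring
  have h4 : |(eta s * (Complex.exp (gam ξ) - 1)).im| ≤ ‖eta s‖ * (5 * |ξ|) := by
    refine (abs_im_le_norm _).trans ?_
    rw [norm_mul]; gcongr
  have h4' := (abs_le.1 h4).1
  have h5 : ‖s‖ ≤ -s.re + s.im := by
    have := norm_le_abs_re_add_abs_im s
    rwa [abs_of_nonpos (by linarith), abs_of_pos ht] at this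
  rw [← eta_norm ht] at h5
  have h6 : (-s.re) * (ξ ^ 2 / 16) ≤ (-s.re) * (pf (gam ξ)).re := by gcongr; linarith
  have h7 : s.im * (ξ ^ 2 / 16) ≤ s.im * (pf (gam ξ)).im := by gcongr
  have h8 : 2 * Real.pi * ‖eta s‖ ^ 2 * (ξ ^ 2 / 16) ≤ (-s.re + s.im) * (ξ ^ 2 / 16) := by gcongr
  have h9 : 4 * ((‖eta s‖ ^ 2) * (ξ ^ 2 / 16)) ≤ 2 * Real.pi * (‖eta s‖ ^ 2 * (ξ ^ 2 / 16)) := by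
    gcongr; linarith
  have h10 : Real.pi * (‖eta s‖ * (5 * |ξ|)) ≤ 3.15 * (‖eta s‖ * (5 * |ξ|)) := by gcongr
  have h11 : Real.pi * (-(‖eta s‖ * (5 * |ξ|))) ≤ Real.pi * (eta s * (Complex.exp (gam ξ) - 1)).im := by gcongr
  rw [abs_mul, abs_of_nonneg (norm_nonneg (eta s)), mul_pow]
  have h12 := (abs_le.1 h).2
  have h13 : 0 ≤ ‖eta s‖ * |ξ| := by positivity
  nlinarith

theorem Ef_large {s : ℂ} (ht : 0 < s.im) (hs : s.re ≤ -2) (hη : 60 ≤ ‖eta s‖) (hy : 1 ≤ (eta s).im)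
    {ξ v : ℝ} (h : 1 ≤ |ξ|) (hv : |v| ≤ 1 / 8) (hvx : 0 ≤ v * ξ) :
    ‖Complex.exp (Ef s (ξ + v * I))‖ ≤ Real.exp (-|‖eta s‖ * ξ|) := by
  rw [Complex.norm_exp]
  refine Real.exp_le_exp.2 ?_
  obtain ⟨h1, h2⟩ := pf_large h hv hvx
  have hpi := Real.pi_gt_three
  have hx := eta_re_ge ht
  have hA := (eta_re_im ht).2
  rw [Ef_re]
  set x0 := (eta s).re with hx0
  set y0 := (eta s).im with hy0
  have hre : (ξ + v * I : ℂ).re = ξ := by simp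
  have him : (eta s * (Complex.exp (ξ + v * I) - 1)).im =
      Real.exp ξ * (x0 * Real.sin v + y0 * Real.cos v) - y0 := by
    rw [mul_im, sub_im, sub_re, Complex.exp_re, Complex.exp_im]; simp [← hx0, ← hy0]; ring
  rw [hre, him]
  have hc := Real.one_sub_sq_div_two_le_cos (x := v)
  have hv2 : v ^ 2 ≤ 1 / 64 := by rw [← sq_abs]; nlinarith [abs_nonneg v]
  have hc0 : 0 ≤ y0 * Real.cos v := mul_nonneg (by linarith) (by nlinarith)
  have hx30 : 30 ≤ x0 := by linarith
  have hlow : -x0 / 8 ≤ Real.exp ξ * (x0 * Real.sin v + y0 * Real.cos v) := by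
    rcases le_total 0 ξ with h0 | h0
    · have hv0 : 0 ≤ v := by
        by_contra hh; push Not at hh; rw [abs_of_nonneg h0] at h; nlinarith
      have : 0 ≤ Real.sin v := Real.sin_nonneg_of_nonneg_of_le_pi hv0 (by linarith [(abs_le.1 hv).2])
      have : 0 ≤ Real.exp ξ * (x0 * Real.sin v + y0 * Real.cos v) := by positivity
      linarith
    · have he1 : Real.exp ξ ≤ 1 := Real.exp_le_one_iff.2 (by linarith)
      have hs1 : -(1 / 8) ≤ Real.sin v := by
        have := Real.abs_sin_le_abs (x := v)
        have := (abs_le.1 (this.trans hv)).1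
        linarith
      have : -x0 / 8 ≤ x0 * Real.sin v + y0 * Real.cos v := by nlinarith
      have he0 := Real.exp_pos ξ
      nlinarith
  have h3 : 4 * Real.pi * x0 * y0 * (|ξ| / 2) ≤ (-s.re) * (pf (ξ + v * I)).re := by
    rw [← hA]; gcongr; linarith
  have h4 : 0 ≤ s.im * (pf (ξ + v * I)).im := by positivity
  have h5 : Real.pi * (-x0 / 8 - y0) ≤ Real.pi * (Real.exp ξ * (x0 * Real.sin v + y0 * Real.cos v) - y0) := by
    gcongr
  have h6 : ξ ≤ |ξ| := le_abs_self _
  rw [abs_mul, abs_of_nonneg (norm_nonneg (eta s))]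
  have h7 : ‖eta s‖ * |ξ| ≤ (2 * x0) * |ξ| := by gcongr; linarith
  set a := |ξ| with ha
  have g1 : x0 ≤ x0 * y0 := by nlinarith
  have g2 : x0 * y0 ≤ x0 * y0 * a := by nlinarith [mul_pos (by linarith : 0 < x0) (by linarith : 0 < y0)]
  have g3 : x0 * a ≤ x0 * y0 * a := by gcongr
  have g4 : 30 * y0 ≤ x0 * y0 := by gcongr
  have g5 : 30 * a ≤ x0 * a := by gcongr
  have g6 : Real.pi * (x0 / 8 + y0) ≤ Real.pi * ((1 / 8 + 1 / 30) * (x0 * y0 * a)) := by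
    gcongr; linarith
  have g7 : 3 * (x0 * y0 * a) ≤ Real.pi * (x0 * y0 * a) := by gcongr
  nlinarith

end Sg

end

section

namespace Sg
open Complex Set MeasureTheory Metric Filter Topology
set_option autoImplicit false

/-- dominating function -/
noncomputable def bd (x : ℝ) : ℝ :=
  2 * Real.exp 1 * Real.exp (-(1 / 4 * x ^ 2) + 16 * |x|) + 4 * (1 + x ^ 2)⁻¹

theorem bd_integrable : Integrable bd :=
  ((integrable_gauss_abs (1 / 4) 16 (by norm_num)).const_mul _).add (integrable_inv_one_add_sq.const_mul _)

theorem exp_neg_abs_le (x : ℝ) : Real.exp (-|x|) ≤ 2 * (1 + x ^ 2)⁻¹ := by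
  have := Real.quadratic_le_exp_of_nonneg (abs_nonneg x)
  rw [Real.exp_neg, ← div_eq_mul_inv, le_div_iff₀ (by positivity), inv_mul_le_iff₀ (by positivity)]
  nlinarith [sq_abs x, abs_nonneg x]

theorem Ef_path {s : ℂ} (ht : 0 < s.im) (hs : s.re ≤ -2) (hη : 60 ≤ ‖eta s‖) (hy : 1 ≤ (eta s).im)
    (ξ : ℝ) : ‖Complex.exp (Ef s (gam ξ)) * gam' ξ‖ ≤ bd (‖eta s‖ * ξ) := by
  rw [norm_mul]
  have h2 := gam'_norm ξ
  rcases le_total |ξ| 1 with h | h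
  · have h1 := Ef_small ht hs h
    calc _ ≤ Real.exp (1 - (‖eta s‖ * ξ) ^ 2 / 4 + 16 * |‖eta s‖ * ξ|) * 2 := by gcongr
      _ = 2 * Real.exp 1 * Real.exp (-(1 / 4 * (‖eta s‖ * ξ) ^ 2) + 16 * |‖eta s‖ * ξ|) := by
          rw [mul_assoc, ← Real.exp_add, mul_comm]; congr 2; ring
      _ ≤ _ := by rw [bd]; have : 0 ≤ 4 * (1 + (‖eta s‖ * ξ) ^ 2)⁻¹ := by positivity
                  linarith
  · have h1 := Ef_large ht hs hη hy h (psi_le' ξ) (psi_mul ξ)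
    have h1' : ‖Complex.exp (Ef s (gam ξ))‖ ≤ Real.exp (-|‖eta s‖ * ξ|) := h1
    calc _ ≤ (2 * (1 + (‖eta s‖ * ξ) ^ 2)⁻¹) * 2 := by
          gcongr; exact h1'.trans (exp_neg_abs_le _)
      _ ≤ _ := by
          rw [bd]
          have : 0 ≤ 2 * Real.exp 1 * Real.exp (-(1 / 4 * (‖eta s‖ * ξ) ^ 2) + 16 * |‖eta s‖ * ξ|) := by positivity
          linarith

theorem Ef_diff (s : ℂ) : Differentiable ℂ fun w => Complex.exp (Ef s w) := by
  unfold Ef pf; fun_prop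

theorem path_cont (s : ℂ) : Continuous fun ξ : ℝ => Complex.exp (Ef s (gam ξ)) * gam' ξ :=
  ((Ef_diff s).continuous.comp gam_continuous).mul gam'_continuous

theorem path_integrable {s : ℂ} (ht : 0 < s.im) (hs : s.re ≤ -2) (hη : 60 ≤ ‖eta s‖) (hy : 1 ≤ (eta s).im) :
    Integrable fun ξ : ℝ => Complex.exp (Ef s (gam ξ)) * gam' ξ := by
  refine (bd_integrable.comp_mul_left' (by linarith : ‖eta s‖ ≠ 0)).mono' (path_cont s).aestronglyMeasurable
    (Eventually.of_forall fun ξ => Ef_path ht hs hη hy ξ)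

theorem J_deform {s : ℂ} (ht : 0 < s.im) (hs : s.re ≤ -2) (hη : 60 ≤ ‖eta s‖) (hy : 1 ≤ (eta s).im) :
    Jf s = ∫ ξ : ℝ, Complex.exp (Ef s (gam ξ)) * gam' ξ := by
  have t1 := intervalIntegral_tendsto_integral (J_integrable ht hs) tendsto_neg_atTop_atBot tendsto_id
  have t2 := intervalIntegral_tendsto_integral (path_integrable ht hs hη hy) tendsto_neg_atTop_atBot tendsto_id
  have t3 := t1.sub t2
  have t4 : Tendsto (fun N : ℝ => (∫ ξ in (-N)..N, Complex.exp (Ef s ξ)) -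
      ∫ ξ in (-N)..N, Complex.exp (Ef s (gam ξ)) * gam' ξ) atTop (𝓝 0) := by
    refine squeeze_zero_norm' (a := fun N : ℝ => 2 * Real.exp (-N)) ?_ ?_
    · filter_upwards [eventually_ge_atTop 1] with N hN
      obtain ⟨F, hF⟩ := ((Ef_diff s).differentiableOn (s := ball 0 (2 * N + 2))).isExactOn_ball
      have mem : ∀ (ξ v : ℝ), |ξ| ≤ N → |v| ≤ 1 / 8 → (ξ + v * I : ℂ) ∈ ball (0 : ℂ) (2 * N + 2) := by
        intro ξ v h1 h2
        rw [mem_ball_zero_iff]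
        refine (norm_add_le _ _).trans_lt ?_
        simp only [norm_mul, norm_I, mul_one, norm_real, Real.norm_eq_abs]; linarith
      have hle : -N ≤ N := by linarith
      have i1 : ∫ ξ in (-N)..N, Complex.exp (Ef s ξ) = F N - F ((-N : ℝ) : ℂ) := by
        refine intervalIntegral.integral_eq_sub_of_hasDerivAt (f := fun ξ : ℝ => F ξ) (fun ξ hξ => ?_) ?_
        · rw [uIcc_of_le hle] at hξ
          have := mem ξ 0 (abs_le.2 hξ) (by norm_num)
          rw [ofReal_zero, zero_mul, add_zero] at this
          exact (hF _ this).comp_ofReal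
        · exact ((Ef_diff s).continuous.comp continuous_ofReal).intervalIntegrable _ _
      have i2 : ∫ ξ in (-N)..N, Complex.exp (Ef s (gam ξ)) * gam' ξ = F (gam N) - F (gam (-N)) := by
        refine intervalIntegral.integral_eq_sub_of_hasDerivAt (f := fun ξ : ℝ => F (gam ξ)) (fun ξ hξ => ?_)
          ((path_cont s).intervalIntegrable _ _)
        rw [uIcc_of_le hle] at hξ
        exact (hF _ (mem ξ _ (abs_le.2 hξ) (psi_le' ξ))).comp_of_eq ξ (gam_hasDerivAt ξ) rfl
      have vert : ∀ ξ : ℝ, |ξ| = N → ‖F (gam ξ) - F ξ‖ ≤ Real.exp (-N) := by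
        intro ξ hξ
        have key : ∀ w ∈ segment ℝ (ξ : ℂ) (gam ξ), ∃ v : ℝ, w = ξ + v * I ∧ |v| ≤ 1 / 8 ∧ 0 ≤ v * ξ := by
          intro w hw
          rw [segment_eq_image'] at hw
          obtain ⟨θ, hθ, rfl⟩ := hw
          refine ⟨θ * psi ξ, ?_, ?_, ?_⟩
          · simp [gam]; ring
          · rw [abs_mul, abs_of_nonneg hθ.1]
            nlinarith [psi_le' ξ, abs_nonneg (psi ξ), hθ.2]
          · rw [mul_assoc]; exact mul_nonneg hθ.1 (psi_mul ξ)
        have := Convex.norm_image_sub_le_of_norm_hasDerivWithin_le (f := F) (C := Real.exp (-N))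
          (s := segment ℝ (ξ : ℂ) (gam ξ)) (x := ξ) (y := gam ξ)
          (f' := fun w => Complex.exp (Ef s w)) (fun w hw => ?_) (fun w hw => ?_) (convex_segment _ _)
          (left_mem_segment _ _ _) (right_mem_segment _ _ _)
        · refine this.trans ?_
          have h1 : ‖gam ξ - ξ‖ ≤ 1 := by
            rw [gam, add_sub_cancel_left]
            simp only [norm_mul, norm_I, mul_one, norm_real, Real.norm_eq_abs]
            linarith [psi_le' ξ]
          exact mul_le_of_le_one_right (Real.exp_pos _).le h1
        · obtain ⟨v, rfl, h1, h2⟩ := key w hw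
          exact (hF _ (mem ξ v hξ.le h1)).hasDerivWithinAt
        · obtain ⟨v, rfl, h1, h2⟩ := key w hw
          refine (Ef_large ht hs hη hy (by linarith) h1 h2).trans (Real.exp_le_exp.2 ?_)
          rw [abs_mul, hξ, abs_of_nonneg (norm_nonneg _)]
          nlinarith
      rw [i1, i2]
      have v1 := vert N (abs_of_nonneg (by linarith))
      have v2 := vert (-N) (by rw [abs_neg, abs_of_nonneg (by linarith)])
      calc _ = ‖(F (gam (-N)) - F ((-N : ℝ) : ℂ)) - (F (gam N) - F N)‖ := by congr 1; ring
        _ ≤ _ := (norm_sub_le _ _).trans (by linarith)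
    · have := (Real.tendsto_exp_neg_atTop_nhds_zero).const_mul 2
      simpa using this
  have := tendsto_nhds_unique t3 t4
  rw [sub_eq_zero] at this
  exact this

/-- saddle constant -/
noncomputable def c1 : ℂ := Complex.exp (Real.pi * I / 4) / (Real.sqrt 2 : ℝ) * Complex.exp (-(Real.pi * I / 8))

noncomputable def k0 : ℂ := 1 + I / 4

theorem k0_re_im (ω : ℂ) : (ω * k0).re = ω.re - ω.im / 4 ∧ (ω * k0).im = ω.im + ω.re / 4 := by
  have : k0 = ⟨1, 1 / 4⟩ := by rw [k0]; apply Complex.ext <;> simp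
  rw [this]; constructor <;> simp <;> ring

theorem eiq : Complex.exp (Real.pi * I / 4) = ((Real.sqrt 2 : ℝ) / 2 : ℝ) * (1 + I) := by
  have : (Real.pi * I / 4 : ℂ) = ((Real.pi / 4 : ℝ) : ℂ) * I := by push_cast; ring
  rw [this, Complex.exp_mul_I, ← ofReal_cos, ← ofReal_sin, Real.cos_pi_div_four, Real.sin_pi_div_four]
  ring

theorem gaussG {ω : ℂ} (h1 : 0 < ω.im) (h2 : ω.im < ω.re) :
    ∫ x : ℝ, ω * (k0 * Complex.exp (2 * Real.pi * I * (ω * k0) ^ 2 * x ^ 2 + Real.pi * I * (ω * k0) * x)) = c1 := by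
  set κ := ω * k0 with hκ
  obtain ⟨e1, e2⟩ := k0_re_im ω
  rw [← hκ] at e1 e2
  have hr : 0 < κ.re := by rw [e1]; linarith
  have hi : 0 < κ.im := by rw [e2]; linarith
  have hκ0 : κ ≠ 0 := by intro h; rw [h] at hr; simp at hr
  have hb : (2 * Real.pi * I * κ ^ 2).re < 0 := by
    have : (2 * Real.pi * I * κ ^ 2).re = -(4 * Real.pi * (κ.re * κ.im)) := by
      have : (2 * Real.pi * I * κ ^ 2) = ((2 * Real.pi : ℝ) : ℂ) * (I * (κ * κ)) := by push_cast; ring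
      rw [this, re_ofReal_mul, I_mul_re, mul_im]; ring
    rw [this]
    have := Real.pi_pos
    have : 0 < 4 * Real.pi * (κ.re * κ.im) := by positivity
    linarith
  have hintg := integral_cexp_quadratic hb (Real.pi * I * κ) 0
  simp only [add_zero] at hintg
  have hpi : (Real.pi : ℂ) ≠ 0 := ofReal_ne_zero.2 Real.pi_ne_zero
  have hs2 : ((Real.sqrt 2 : ℝ) : ℂ) ^ 2 = 2 := by
    rw [← ofReal_pow, Real.sq_sqrt (by norm_num)]; norm_num
  have hs0 : ((Real.sqrt 2 : ℝ) : ℂ) ≠ 0 := by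
    intro h; rw [h] at hs2; norm_num at hs2
  have hroot : (Real.pi / -(2 * Real.pi * I * κ ^ 2) : ℂ) ^ (1 / 2 : ℂ) = (1 + I) / 2 / κ := by
    have : (Real.pi / -(2 * Real.pi * I * κ ^ 2) : ℂ) = ((1 + I) / 2 / κ) ^ 2 := by
      have hI := I_sq
      have : (1 + I) ^ 2 = 2 * I := by linear_combination hI
      field_simp
      linear_combination (-I) * this - 2 * hI
    rw [this, one_div]
    refine sq_cpow_two_inv ?_
    have e3 : (1 + I) / 2 / κ = ((1 / (2 * normSq κ) : ℝ) : ℂ) * ((1 + I) * (starRingEnd ℂ) κ) := by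
      rw [div_eq_mul_inv, Complex.inv_def]; push_cast; field_simp
    rw [e3, re_ofReal_mul]
    have := normSq_pos.2 hκ0
    refine mul_pos (by positivity) ?_
    simp; linarith
  rw [integral_const_mul, integral_const_mul, hintg, hroot, ← mul_assoc, ← hκ]
  have e4 : (0 - (Real.pi * I * κ) ^ 2 / (4 * (2 * Real.pi * I * κ ^ 2)) : ℂ) = -(Real.pi * I / 8) := by
    have hI := I_ne_zero
    field_simp; ring
  rw [e4, c1, eiq]
  push_cast
  field_simp

theorem G_bound {ω : ℂ} (h0 : ‖ω‖ = 1) (h1 : 0 < ω.im) (h2 : ω.im < ω.re) (x : ℝ) :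
    ‖Complex.exp (2 * Real.pi * I * (ω * k0) ^ 2 * x ^ 2 + Real.pi * I * (ω * k0) * x)‖ ≤
      Real.exp (-(1 / 4 * x ^ 2) + 16 * |x|) := by
  set κ := ω * k0 with hκ
  obtain ⟨e1, e2⟩ := k0_re_im ω
  rw [← hκ] at e1 e2
  have hn : ω.re ^ 2 + ω.im ^ 2 = 1 := by
    have := Complex.sq_norm ω
    rw [h0, normSq_apply] at this; nlinarith
  rw [Complex.norm_exp]
  refine Real.exp_le_exp.2 ?_
  have e3 : (2 * Real.pi * I * κ ^ 2 * x ^ 2 + Real.pi * I * κ * x : ℂ).re =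
      -(4 * Real.pi * (κ.re * κ.im) * x ^ 2) - Real.pi * κ.im * x := by
    have : (2 * Real.pi * I * κ ^ 2 * x ^ 2 + Real.pi * I * κ * x : ℂ) =
      ((2 * Real.pi * x ^ 2 : ℝ) : ℂ) * (I * (κ * κ)) + ((Real.pi * x : ℝ) : ℂ) * (I * κ) := by push_cast; ring
    rw [this, add_re, re_ofReal_mul, re_ofReal_mul, I_mul_re, I_mul_re, mul_im]; ring
  rw [e3]
  have hpi := Real.pi_gt_three
  have hpi4 := Real.pi_lt_four
  have hr1 : ω.re ≤ 1 := by nlinarith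
  have hr : 1 / 2 ≤ ω.re ^ 2 := by nlinarith
  have hk : 3 / 32 ≤ κ.re * κ.im := by
    have : (3 / 4 * ω.re) * (ω.re / 4) ≤ κ.re * κ.im := by
      have : 0 < ω.re := by linarith
      gcongr <;> linarith
    nlinarith
  have hk2 : |κ.im| ≤ 2 := by rw [e2, abs_of_pos (by linarith)]; linarith
  have g1 : 4 * 3 * (3 / 32) * x ^ 2 ≤ 4 * Real.pi * (κ.re * κ.im) * x ^ 2 := by gcongr
  have g2 : |Real.pi * κ.im * x| ≤ 8 * |x| := by
    rw [abs_mul, abs_mul, abs_of_pos Real.pi_pos]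
    have : Real.pi * |κ.im| ≤ 4 * 2 := by gcongr
    nlinarith [abs_nonneg x]
  have := (abs_le.1 g2).1
  nlinarith [abs_nonneg x, sq_nonneg x]

theorem lim_w (x : ℝ) : Tendsto (fun r : ℝ => gam (x / r)) atTop (𝓝 0) := by
  have h : Tendsto (fun r : ℝ => x / r) atTop (𝓝 0) := tendsto_const_nhds.div_atTop tendsto_id
  have := gam_continuous.continuousAt.tendsto.comp h
  have e : gam 0 = 0 := by simp [gam, psi]
  rwa [e] at this

theorem lim_w' (x : ℝ) : Tendsto (fun r : ℝ => gam' (x / r)) atTop (𝓝 k0) := by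
  have h : Tendsto (fun r : ℝ => x / r) atTop (𝓝 0) := tendsto_const_nhds.div_atTop tendsto_id
  have := gam'_continuous.continuousAt.tendsto.comp h
  have e : gam' 0 = k0 := by rw [gam', psi', k0]; push_cast; ring
  rwa [e] at this

theorem lim_rw (x : ℝ) : Tendsto (fun r : ℝ => (r : ℂ) * gam (x / r)) atTop (𝓝 (k0 * x)) := by
  have h : Tendsto (fun r : ℝ => x / r) atTop (𝓝 0) := tendsto_const_nhds.div_atTop tendsto_id
  have hc : Continuous fun u : ℝ => (x : ℂ) + ((x / (4 * (1 + u ^ 2)) : ℝ) : ℂ) * I := by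
    have : Continuous fun u : ℝ => x / (4 * (1 + u ^ 2)) :=
      Continuous.div (by fun_prop) (by fun_prop) fun x => by positivity
    fun_prop
  have := hc.continuousAt.tendsto.comp h
  have e : (x : ℂ) + ((x / (4 * (1 + (0 : ℝ) ^ 2)) : ℝ) : ℂ) * I = k0 * x := by
    rw [k0]; push_cast; ring
  rw [e] at this
  refine this.congr' ?_
  filter_upwards [eventually_gt_atTop 0] with r hr
  have hr' : (r : ℂ) ≠ 0 := ofReal_ne_zero.2 hr.ne'
  have e2 : r * psi (x / r) = x / (4 * (1 + (x / r) ^ 2)) := by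
    rw [psi]; field_simp
  simp only [Function.comp]
  rw [← e2, gam]; push_cast; field_simp

theorem lim_rp (x : ℝ) : Tendsto (fun r : ℝ => (r : ℂ) ^ 2 * pf (gam (x / r))) atTop (𝓝 ((k0 * x) ^ 2)) := by
  have h1 := (lim_rw x).pow 2
  have h2 : Tendsto (fun r : ℝ => (r : ℂ) ^ 2 * pf (gam (x / r)) - ((r : ℂ) * gam (x / r)) ^ 2) atTop (𝓝 0) := by
    refine squeeze_zero_norm (a := fun r : ℝ => 4 * ‖(r : ℂ) * gam (x / r)‖ ^ 2 * ‖gam (x / r)‖ *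
      Real.exp (2 * ‖gam (x / r)‖)) (fun r => ?_) ?_
    · set w := gam (x / r)
      have h3 := Complex.norm_exp_sub_sum_le_norm_mul_exp (2 * w) 3
      have e : Complex.exp (2 * w) - ∑ m ∈ Finset.range 3, (2 * w) ^ m / (m.factorial : ℂ) = 2 * (pf w - w ^ 2) := by
        rw [pf]; simp [Finset.sum_range_succ, Nat.factorial]; ring
      rw [e] at h3
      simp only [norm_mul, Complex.norm_ofNat] at h3
      calc _ = ‖(r : ℂ)‖ ^ 2 * ‖pf w - w ^ 2‖ := by rw [← norm_pow, ← norm_mul]; congr 1; ring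
        _ ≤ ‖(r : ℂ)‖ ^ 2 * ((2 * ‖w‖) ^ 3 * Real.exp (2 * ‖w‖) / 2) := by gcongr; linarith
        _ = _ := by rw [norm_mul]; ring
    · have := (((((lim_rw x).norm.pow 2).const_mul 4).mul (lim_w x).norm)).mul
        ((Real.continuous_exp.tendsto _).comp ((lim_w x).norm.const_mul 2))
      simpa using this
  simpa using h2.add h1

theorem lim_re (x : ℝ) : Tendsto (fun r : ℝ => (r : ℂ) * (Complex.exp (gam (x / r)) - 1)) atTop (𝓝 (k0 * x)) := by
  have h1 := lim_rw x
  have h2 : Tendsto (fun r : ℝ => (r : ℂ) * (Complex.exp (gam (x / r)) - 1) - ((r : ℂ) * gam (x / r))) atTop (𝓝 0) := by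
    refine squeeze_zero_norm (a := fun r : ℝ => ‖(r : ℂ) * gam (x / r)‖ * ‖gam (x / r)‖ *
      Real.exp (‖gam (x / r)‖)) (fun r => ?_) ?_
    · set w := gam (x / r)
      have h3 := Complex.norm_exp_sub_sum_le_norm_mul_exp w 2
      have e : Complex.exp w - ∑ m ∈ Finset.range 2, w ^ m / (m.factorial : ℂ) = Complex.exp w - 1 - w := by
        simp [Finset.sum_range_succ, Nat.factorial]; ring
      rw [e] at h3
      calc _ = ‖(r : ℂ)‖ * ‖Complex.exp w - 1 - w‖ := by rw [← norm_mul]; congr 1; ring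
        _ ≤ ‖(r : ℂ)‖ * (‖w‖ ^ 2 * Real.exp (‖w‖)) := by gcongr
        _ = _ := by rw [norm_mul]; ring
    · have := (((lim_rw x).norm.mul (lim_w x).norm)).mul
        ((Real.continuous_exp.tendsto _).comp (lim_w x).norm)
      simpa using this
  simpa using h2.add h1

end Sg

end

section

namespace Sg
open Complex Set MeasureTheory Metric Filter Topology
set_option autoImplicit false

noncomputable def om (s : ℂ) : ℂ := eta s / (‖eta s‖ : ℝ)

theorem om_facts {s : ℂ} (ht : 0 < s.im) (hs : s.re < 0) :
    ‖om s‖ = 1 ∧ 0 < (om s).im ∧ (om s).im < (om s).re ∧ eta s = om s * (‖eta s‖ : ℝ) := by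
  have h0 : 0 < ‖eta s‖ := norm_pos_iff.2 (eta_ne s)
  have h0' : ((‖eta s‖ : ℝ) : ℂ) ≠ 0 := ofReal_ne_zero.2 h0.ne'
  have hx := eta_re_pos ht
  have hy := eta_im_pos ht hs
  have h1 := (eta_re_im ht).1
  have hlt : (eta s).im < (eta s).re := by
    have : 0 < (eta s).re ^ 2 - (eta s).im ^ 2 := by
      by_contra hh; push Not at hh
      nlinarith [Real.pi_pos]
    nlinarith
  refine ⟨?_, ?_, ?_, ?_⟩
  · rw [om, norm_div, norm_real, norm_norm, div_self h0.ne']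
  · rw [om, div_ofReal_im]; positivity
  · rw [om, div_ofReal_im, div_ofReal_re]; gcongr
  · rw [om]; field_simp

def reg : Set ℂ := {s | 0 < s.im ∧ s.re ≤ -2 ∧ 1 ≤ (eta s).im}

noncomputable def Lf : Filter ℂ := comap (fun s => ‖eta s‖) atTop ⊓ 𝓟 reg

instance : Lf.IsCountablyGenerated := by unfold Lf; infer_instance

theorem Lf_reg : ∀ᶠ s in Lf, s ∈ reg := by
  unfold Lf
  exact (eventually_principal.2 fun s hs => hs : ∀ᶠ s in 𝓟 reg, s ∈ reg).filter_mono inf_le_right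

theorem Lf_eta : Tendsto (fun s => ‖eta s‖) Lf atTop := by
  unfold Lf
  exact tendsto_comap.mono_left inf_le_left

noncomputable def Df (s : ℂ) (x : ℝ) : ℂ :=
  om s * (Complex.exp (Ef s (gam (x / ‖eta s‖))) * gam' (x / ‖eta s‖)) -
  om s * (k0 * Complex.exp (2 * Real.pi * I * (om s * k0) ^ 2 * x ^ 2 + Real.pi * I * (om s * k0) * x))

theorem k0_norm : ‖k0‖ ≤ 2 := by
  rw [k0]
  refine (norm_add_le _ _).trans ?_
  simp; norm_num

theorem Df_bound {s : ℂ} (h : s ∈ reg) (hη : 60 ≤ ‖eta s‖) (x : ℝ) :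
    ‖Df s x‖ ≤ bd x + 2 * Real.exp (-(1 / 4 * x ^ 2) + 16 * |x|) := by
  obtain ⟨ht, hs, hy⟩ := h
  obtain ⟨o1, o2, o3, o4⟩ := om_facts ht (by linarith)
  refine (norm_sub_le _ _).trans ?_
  have h1 := Ef_path ht hs hη hy (x / ‖eta s‖)
  rw [mul_div_cancel₀ _ (by linarith)] at h1
  have h2 := G_bound o1 o2 o3 x
  rw [norm_mul (om s), norm_mul (om s), norm_mul k0, o1, one_mul, one_mul]
  have := k0_norm
  gcongr

theorem Df_lim (x : ℝ) : Tendsto (fun s => Df s x) Lf (𝓝 0) := by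
  have a0 := (lim_w x).comp Lf_eta
  have a1 := (lim_w' x).comp Lf_eta
  have a2 := ((lim_rp x).sub_const ((k0 * x) ^ 2)).comp Lf_eta
  have a3 := ((lim_re x).sub_const (k0 * x)).comp Lf_eta
  rw [sub_self] at a2 a3
  simp only [Function.comp_def] at a0 a1 a2 a3
  set δ : ℂ → ℂ := fun s => gam (x / ‖eta s‖) +
    2 * Real.pi * I * om s ^ 2 * (((‖eta s‖ : ℝ) : ℂ) ^ 2 * pf (gam (x / ‖eta s‖)) - (k0 * x) ^ 2) +
    Real.pi * I * om s * (((‖eta s‖ : ℝ) : ℂ) * (Complex.exp (gam (x / ‖eta s‖)) - 1) - k0 * x) with hδ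
  have hδ0 : Tendsto δ Lf (𝓝 0) := by
    refine squeeze_zero_norm' (a := fun s => ‖gam (x / ‖eta s‖)‖ +
      8 * ‖((‖eta s‖ : ℝ) : ℂ) ^ 2 * pf (gam (x / ‖eta s‖)) - (k0 * x) ^ 2‖ +
      4 * ‖((‖eta s‖ : ℝ) : ℂ) * (Complex.exp (gam (x / ‖eta s‖)) - 1) - k0 * x‖) ?_ ?_
    · filter_upwards [Lf_reg] with s hs
      obtain ⟨o1, -⟩ := om_facts hs.1 (by linarith [hs.2.1])
      have hpi := Real.pi_lt_four
      refine (norm_add_le _ _).trans (add_le_add ((norm_add_le _ _).trans (add_le_add le_rfl ?_)) ?_)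
      · rw [norm_mul]; gcongr
        simp [o1, abs_of_pos Real.pi_pos]; linarith
      · rw [norm_mul]; gcongr
        simp [o1, abs_of_pos Real.pi_pos]; linarith
    · have := (a0.norm.add (a2.norm.const_mul 8)).add (a3.norm.const_mul 4)
      simpa using this
  have h5 : Tendsto (fun s => Complex.exp (δ s) * gam' (x / ‖eta s‖) - k0) Lf (𝓝 0) := by
    have := (((Complex.continuous_exp.tendsto 0).comp hδ0).mul a1).sub_const k0
    simpa using this
  refine squeeze_zero_norm' (a := fun s => Real.exp (-(1 / 4 * x ^ 2) + 16 * |x|) *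
    ‖Complex.exp (δ s) * gam' (x / ‖eta s‖) - k0‖) ?_ ?_
  · filter_upwards [Lf_reg] with s hs
    obtain ⟨o1, o2, o3, o4⟩ := om_facts hs.1 (by linarith [hs.2.1])
    have h2 := G_bound o1 o2 o3 x
    have e1 : Ef s (gam (x / ‖eta s‖)) =
        (2 * Real.pi * I * (om s * k0) ^ 2 * x ^ 2 + Real.pi * I * (om s * k0) * x) + δ s := by
      have e2 : s = 2 * Real.pi * I * (om s * (‖eta s‖ : ℝ)) ^ 2 := by
        rw [← o4]; exact eta_sq (ne_of_im hs.1)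
      have e3 : Ef s (gam (x / ‖eta s‖)) = gam (x / ‖eta s‖) +
          (2 * Real.pi * I * (om s * (‖eta s‖ : ℝ)) ^ 2) * pf (gam (x / ‖eta s‖)) +
          Real.pi * I * ((om s * (‖eta s‖ : ℝ)) * (Complex.exp (gam (x / ‖eta s‖)) - 1)) := by
        rw [Ef, ← o4, ← eta_sq (ne_of_im hs.1)]
      rw [e3, hδ]; ring
    have e4 : Df s x = om s * (Complex.exp (2 * Real.pi * I * (om s * k0) ^ 2 * x ^ 2 +
        Real.pi * I * (om s * k0) * x) * (Complex.exp (δ s) * gam' (x / ‖eta s‖) - k0)) := by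
      rw [Df, e1, Complex.exp_add]; ring
    rw [e4, norm_mul, norm_mul, o1, one_mul]
    gcongr
  · simpa using h5.norm.const_mul (Real.exp (-(1 / 4 * x ^ 2) + 16 * |x|))

theorem J_lim' : Tendsto (fun s => eta s * Jf s) Lf (𝓝 c1) := by
  have hI := bd_integrable.add ((integrable_gauss_abs (1 / 4) 16 (by norm_num)).const_mul 2)
  have hge : ∀ᶠ s in Lf, 60 ≤ ‖eta s‖ := Lf_eta.eventually_ge_atTop 60
  have cont1 : ∀ s, Continuous fun x : ℝ => om s * (Complex.exp (Ef s (gam (x / ‖eta s‖))) * gam' (x / ‖eta s‖)) :=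
    fun s => continuous_const.mul ((path_cont s).comp (continuous_id.div_const ‖eta s‖))
  have cont2 : ∀ s, Continuous fun x : ℝ => om s * (k0 * Complex.exp
      (2 * Real.pi * I * (om s * k0) ^ 2 * x ^ 2 + Real.pi * I * (om s * k0) * x)) := by
    intro s; fun_prop
  have h := tendsto_integral_filter_of_dominated_convergence (μ := volume) (F := Df) (f := fun _ => (0 : ℂ))
    (l := Lf) _ ?_ ?_ hI ?_
  · rw [integral_zero] at h
    have h2 : (fun s => eta s * Jf s - c1) =ᶠ[Lf] fun s => ∫ x, Df s x := by
      filter_upwards [Lf_reg, hge] with s hs hη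
      obtain ⟨ht, hs, hy⟩ := hs
      obtain ⟨o1, o2, o3, o4⟩ := om_facts ht (by linarith)
      have hr : ‖eta s‖ ≠ 0 := by linarith
      have i1 : Integrable fun x : ℝ => om s * (Complex.exp (Ef s (gam (x / ‖eta s‖))) * gam' (x / ‖eta s‖)) :=
        ((path_integrable ht hs hη hy).comp_div hr).const_mul _
      have i2 : Integrable fun x : ℝ => om s * (k0 * Complex.exp
          (2 * Real.pi * I * (om s * k0) ^ 2 * x ^ 2 + Real.pi * I * (om s * k0) * x)) := by
        refine ((integrable_gauss_abs (1 / 4) 16 (by norm_num)).const_mul 2).mono'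
          (cont2 s).aestronglyMeasurable (Eventually.of_forall fun x => ?_)
        rw [norm_mul, o1, one_mul, norm_mul]
        have := k0_norm
        have := G_bound o1 o2 o3 x
        gcongr
      unfold Df
      rw [integral_sub i1 i2, gaussG o2 o3, integral_const_mul,
        Measure.integral_comp_div (fun ξ : ℝ => Complex.exp (Ef s (gam ξ)) * gam' ξ),
        ← J_deform ht hs hη hy, abs_of_nonneg (norm_nonneg _), real_smul, ← mul_assoc, ← o4]
    have h3 := (h.congr' h2.symm).add_const c1
    simpa using h3
  · exact Eventually.of_forall fun s => ((cont1 s).sub (cont2 s)).aestronglyMeasurable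
  · filter_upwards [Lf_reg, hge] with s hs hη
    exact Eventually.of_forall fun x => Df_bound hs hη x
  · exact Eventually.of_forall fun x => Df_lim x

theorem J_lim (ε : ℝ) (hε : 0 < ε) : ∃ R0 : ℝ, ∀ s : ℂ, 0 < s.im → s.re ≤ -2 → 1 ≤ (eta s).im →
    R0 ≤ ‖eta s‖ → ‖eta s * Jf s - c1‖ < ε := by
  have h := (Metric.tendsto_nhds.1 J_lim') ε hε
  unfold Lf at h
  rw [eventually_inf_principal, eventually_comap] at h
  obtain ⟨R0, hR⟩ := eventually_atTop.1 h
  refine ⟨R0, fun s h1 h2 h3 h4 => ?_⟩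
  have := hR _ h4 s rfl ⟨h1, h2, h3⟩
  rwa [dist_eq_norm] at this

theorem c1_ne : c1 ≠ 0 := by
  rw [c1]
  refine mul_ne_zero (div_ne_zero (Complex.exp_ne_zero _) (ofReal_ne_zero.2 (by positivity))) (Complex.exp_ne_zero _)

theorem c1_norm : ‖c1‖ = 1 / Real.sqrt 2 := by
  have e1 : (Real.pi * I / 4 : ℂ) = ((Real.pi / 4 : ℝ) : ℂ) * I := by push_cast; ring
  have e2 : (-(Real.pi * I / 8) : ℂ) = ((-(Real.pi / 8) : ℝ) : ℂ) * I := by push_cast; ring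
  rw [c1, e1, e2, norm_mul, norm_div, norm_exp_ofReal_mul_I, norm_exp_ofReal_mul_I, norm_real,
    Real.norm_of_nonneg (Real.sqrt_nonneg _), mul_one]

/-- main term of `M` -/
noncomputable def G1 (s : ℂ) : ℂ := c1 * (gf s * Complex.exp (Real.pi * I * eta s))

theorem G1_ne (s : ℂ) : G1 s ≠ 0 :=
  mul_ne_zero c1_ne (mul_ne_zero (Complex.exp_ne_zero _) (Complex.exp_ne_zero _))

/-- `M` is asymptotic to `G1` -/
theorem M_lim (ε : ℝ) (hε : 0 < ε) : ∃ R0 : ℝ, ∀ s : ℂ, 0 < s.im → s.re ≤ -2 → R0 ≤ ‖eta s‖ →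
    2 * Real.log ‖eta s‖ ≤ (eta s).im → ‖Mf s / G1 s - 1‖ < ε := by
  obtain ⟨C, hC, hM⟩ := M_sub_J
  have hc := norm_pos_iff.2 c1_ne
  obtain ⟨R1, hR1⟩ := J_lim (ε * ‖c1‖ / 2) (by positivity)
  refine ⟨max R1 (max 60 (4 * C / (ε * ‖c1‖))), fun s ht hs hη hy => ?_⟩
  have g1 := (le_max_left _ _).trans hη
  have g2 := ((le_max_left _ _).trans (le_max_right _ _)).trans hη
  have g3 := ((le_max_right _ _).trans (le_max_right _ _)).trans hη
  have hr : 0 < ‖eta s‖ := by linarith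
  have hlog : 1 ≤ Real.log ‖eta s‖ := by
    rw [Real.le_log_iff_exp_le hr]; linarith [Real.exp_one_lt_d9]
  have hpi := Real.pi_gt_three
  have h1 := hM s ht hs g2 (by linarith)
  have h2 := hR1 s ht hs (by linarith) g1
  have h3 : ‖eta s‖ * Real.exp (-(Real.pi / 2 * (eta s).im)) ≤ 1 / ‖eta s‖ := by
    have : Real.exp (-(Real.pi / 2 * (eta s).im)) ≤ Real.exp (-(2 * Real.log ‖eta s‖)) := by
      refine Real.exp_le_exp.2 ?_
      nlinarith
    have e : Real.exp (-(2 * Real.log ‖eta s‖)) = 1 / ‖eta s‖ ^ 2 := by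
      rw [Real.exp_neg, two_mul, Real.exp_add, Real.exp_log hr]; field_simp
    rw [e] at this
    calc _ ≤ ‖eta s‖ * (1 / ‖eta s‖ ^ 2) := by gcongr
      _ = _ := by field_simp
  have h4 : C * (1 / ‖eta s‖) ≤ ε * ‖c1‖ / 4 := by
    rw [mul_one_div, div_le_iff₀ hr]
    rw [div_le_iff₀ (by positivity)] at g3
    linarith
  have h5 : C * (‖eta s‖ * Real.exp (-(Real.pi / 2 * (eta s).im))) ≤ C * (1 / ‖eta s‖) := by gcongr
  have e1 : Mf s / G1 s - 1 = ((Mf s / (gf s * Complex.exp (Real.pi * I * eta s)) - eta s * Jf s) +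
      (eta s * Jf s - c1)) / c1 := by
    have : gf s * Complex.exp (Real.pi * I * eta s) ≠ 0 :=
      mul_ne_zero (Complex.exp_ne_zero _) (Complex.exp_ne_zero _)
    have := c1_ne
    rw [G1]; field_simp; ring
  rw [e1, norm_div, div_lt_iff₀ hc]
  have h6 := norm_add_le (Mf s / (gf s * Complex.exp (Real.pi * I * eta s)) - eta s * Jf s) (eta s * Jf s - c1)
  have : 0 < ε * ‖c1‖ := by positivity
  linarith

end Sg

end

section

namespace Sg
open Complex Set MeasureTheory Metric Filter Topology
set_option autoImplicit false

def hp : Set ℂ := {s | 0 < s.im}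
theorem hp_open : IsOpen hp := isOpen_lt continuous_const continuous_im

theorem ell_hasDerivAt {s : ℂ} (h : 0 < s.im) : HasDerivAt ell (1 / (2 * s)) s := by
  have h0 := ne_of_im h
  have hsl : s / (2 * Real.pi * I) ∈ slitPlane := by
    left; rw [sdiv_re]; have := Real.pi_pos; positivity
  have h1 := ((hasDerivAt_id s).div_const (2 * Real.pi * I)).clog hsl
  have h2 := h1.div_const 2
  refine h2.congr_deriv ?_
  have := twopi_ne
  simp only [id]
  field_simp

theorem eta_hasDerivAt {s : ℂ} (h : 0 < s.im) : HasDerivAt eta (eta s / (2 * s)) s := by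
  refine (ell_hasDerivAt h).cexp.congr_deriv ?_
  rw [eta]; ring

theorem gf_hasDerivAt {s : ℂ} (h : 0 < s.im) : HasDerivAt gf (gf s * (-ell s)) s := by
  have h0 := ne_of_im h
  have h1 := (((hasDerivAt_id s).neg.mul (ell_hasDerivAt h)).add ((hasDerivAt_id s).div_const 2)).cexp
  have h2 : HasDerivAt gf _ s := h1
  refine h2.congr_deriv ?_
  have e : gf s = Complex.exp (-s * ell s + s / 2) := rfl
  rw [e]
  simp only [Pi.add_apply, Pi.mul_apply, Pi.neg_apply, id]
  congr 1
  field_simp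
  ring

theorem G1_hasDerivAt {s : ℂ} (h : 0 < s.im) :
    HasDerivAt G1 (G1 s * (-ell s + Real.pi * I * (eta s / (2 * s)))) s := by
  have h1 := ((gf_hasDerivAt h).mul (((eta_hasDerivAt h).const_mul (Real.pi * I : ℂ)).cexp)).const_mul c1
  have h2 : HasDerivAt G1 _ s := h1
  refine h2.congr_deriv ?_
  rw [G1]; ring

theorem G1_logDeriv {s : ℂ} (h : 0 < s.im) :
    logDeriv G1 s = -ell s + Real.pi * I * (eta s / (2 * s)) := by
  rw [logDeriv_apply, (G1_hasDerivAt h).deriv, mul_div_cancel_left₀ _ (G1_ne s)]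

theorem G1_diff : DifferentiableOn ℂ G1 hp :=
  fun _ h => (G1_hasDerivAt h).differentiableAt.differentiableWithinAt

noncomputable def Ff (s : ℂ) : ℂ := RiemannR s / G1 s

theorem Ff_diff : DifferentiableOn ℂ Ff hp :=
  R_differentiable.differentiableOn.div G1_diff fun s _ => G1_ne s

theorem R_eq_GF (s : ℂ) : RiemannR s = G1 s * Ff s := by
  rw [Ff, mul_div_cancel₀ _ (G1_ne s)]

theorem norm_eis (s : ℂ) : ‖Complex.exp (I * Real.pi * s)‖ = Real.exp (-(Real.pi * s.im)) := by
  rw [Complex.norm_exp]; congr 1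
  have : I * Real.pi * s = (Real.pi : ℂ) * (I * s) := by ring
  rw [this, re_ofReal_mul, I_mul_re]; ring

theorem eis_ne {s : ℂ} (h : 0 < s.im) : 1 - Complex.exp (I * Real.pi * s) ≠ 0 := by
  intro hh
  have h1 := norm_eis s
  rw [← sub_eq_zero.1 hh, norm_one] at h1
  have : Real.exp (-(Real.pi * s.im)) < 1 := Real.exp_lt_one_iff.2 (by have := Real.pi_pos; nlinarith)
  linarith

theorem log_le_sqrt {r : ℝ} (h : 0 < r) : Real.log r ≤ 2 * √r := by
  have h1 := Real.log_sqrt h.le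
  have h2 := Real.log_le_sub_one_of_pos (Real.sqrt_pos.2 h)
  linarith

/-- region where the saddle asymptotics hold: far left -/
theorem y0_far {s : ℂ} (ht : 0 < s.im) (hs : s.im ≤ -s.re) (hr : 576 ≤ ‖eta s‖) :
    2 * Real.log ‖eta s‖ ≤ (eta s).im := by
  have hpi := Real.pi_pos
  obtain ⟨e1, e2⟩ := eta_re_im ht
  have hx := eta_re_ge ht
  have hy := eta_im_pos ht (by linarith)
  have h0 : 0 < (eta s).re := by linarith
  have h1 : (eta s).re / 3 ≤ (eta s).im := by
    by_contra hh; push Not at hh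
    rw [e1, e2] at hs
    have h2 : (eta s).re ^ 2 - (eta s).im ^ 2 ≤ 2 * ((eta s).re * (eta s).im) := by
      by_contra h3; push Not at h3
      nlinarith
    nlinarith
  have h3 := log_le_sqrt (by linarith : 0 < ‖eta s‖)
  have h4 : 24 ≤ √‖eta s‖ := Real.le_sqrt_of_sq_le (by linarith)
  have h5 := Real.sq_sqrt (norm_nonneg (eta s))
  nlinarith

theorem y0_near {s : ℂ} (ht : 1 ≤ s.im) (hs : -s.re ≤ s.im) (hs0 : s.re ≤ 0)
    (ha : 8 * √s.im * Real.log s.im ≤ -s.re) : 2 * Real.log ‖eta s‖ ≤ (eta s).im := by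
  have hpi := Real.pi_gt_three
  have hpi4 := Real.pi_lt_four
  have ht0 : 0 < s.im := by linarith
  obtain ⟨e1, e2⟩ := eta_re_im ht0
  have hn := eta_norm ht0
  have hns : ‖s‖ ≤ 2 * s.im := by
    refine (norm_le_abs_re_add_abs_im s).trans ?_
    rw [abs_of_nonpos hs0, abs_of_pos ht0]; linarith
  have hr0 : 0 < ‖eta s‖ := norm_pos_iff.2 (eta_ne s)
  have hx0 := eta_re_pos ht0
  have hrt : Real.pi * ‖eta s‖ ^ 2 ≤ s.im := by nlinarith
  have hlt : 0 ≤ Real.log s.im := Real.log_nonneg ht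
  have hl : 2 * Real.log ‖eta s‖ ≤ Real.log s.im := by
    have : 2 * Real.log ‖eta s‖ = Real.log (‖eta s‖ ^ 2) := by rw [Real.log_pow]; norm_num
    rw [this]
    refine Real.log_le_log (by positivity) ?_
    nlinarith [sq_nonneg ‖eta s‖]
  have hx : 4 * Real.pi * (eta s).re ≤ 8 * √s.im := by
    have h1 : (eta s).re ≤ ‖eta s‖ := re_le_norm _
    have h2 : 4 * Real.pi * ‖eta s‖ ≤ 8 * √s.im := by
      rw [← abs_of_nonneg (by positivity : 0 ≤ 4 * Real.pi * ‖eta s‖),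
        ← abs_of_nonneg (by positivity : 0 ≤ 8 * √s.im)]
      refine sq_le_sq.1 ?_
      rw [mul_pow, mul_pow, mul_pow, Real.sq_sqrt ht0.le]
      nlinarith
    refine le_trans ?_ h2
    gcongr
  refine hl.trans ?_
  rw [e2] at ha
  have h3 : 4 * Real.pi * (eta s).re * Real.log s.im ≤ 4 * Real.pi * (eta s).re * (eta s).im := by
    refine le_trans ?_ ha
    gcongr
  exact le_of_mul_le_mul_left h3 (by positivity)

theorem eta_large {s : ℂ} (h : 0 < s.im) {R0 : ℝ} (hR : 0 ≤ R0) (hs : 7 * R0 ^ 2 ≤ ‖s‖) : R0 ≤ ‖eta s‖ := by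
  have hn := eta_norm h
  have hpi4 := Real.pi_lt_d2
  by_contra hh; push Not at hh
  have h1 : ‖eta s‖ ^ 2 < R0 ^ 2 := by gcongr
  have : 2 * Real.pi * ‖eta s‖ ^ 2 ≤ 6.3 * ‖eta s‖ ^ 2 := by gcongr; linarith
  nlinarith [sq_nonneg ‖eta s‖]

theorem F_near_one (ε : ℝ) (hε : 0 < ε) : ∃ T0 : ℝ, 0 < T0 ∧ ∀ s : ℂ, T0 ≤ s.im →
    8 * √s.im * Real.log s.im ≤ -s.re → ‖Ff s - 1‖ < ε := by
  obtain ⟨R0, hR0⟩ := M_lim (min (ε / 3) 1) (by positivity)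
  obtain ⟨R1, hR1⟩ : ∃ R1, R1 = max R0 576 := ⟨_, rfl⟩
  have hR1' : 576 ≤ R1 := by rw [hR1]; exact le_max_right _ _
  refine ⟨7 * R1 ^ 2 + 3 / ε, by positivity, fun s ht ha => ?_⟩
  have h3e : 0 < 3 / ε := by positivity
  have ht1 : 7 * R1 ^ 2 ≤ s.im := by linarith
  have ht2 : 3 / ε ≤ s.im := by nlinarith
  have hbig : 4 ≤ s.im := by nlinarith
  have hpos : 0 < s.im := by linarith
  have hη : R1 ≤ ‖eta s‖ := eta_large hpos (by linarith) (ht1.trans (im_le_norm s))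
  have hlog : 1 ≤ Real.log s.im := by
    rw [Real.le_log_iff_exp_le hpos]; linarith [Real.exp_one_lt_d9]
  have hsq : 2 ≤ √s.im := Real.le_sqrt_of_sq_le (by linarith)
  have hs2 : s.re ≤ -2 := by nlinarith
  have hy : 2 * Real.log ‖eta s‖ ≤ (eta s).im := by
    rcases le_total (-s.re) s.im with h | h
    · exact y0_near (by linarith) h (by linarith) ha
    · exact y0_far hpos h (by linarith)
  have hM := hR0 s hpos hs2 (((le_max_left _ _).trans hR1.symm.le).trans hη) hy
  have e : Ff s - 1 = (1 - Complex.exp (I * Real.pi * s)) * (Mf s / G1 s - 1) - Complex.exp (I * Real.pi * s) := by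
    rw [Ff, R_eq_M hs2]; ring
  have he : ‖Complex.exp (I * Real.pi * s)‖ ≤ ε / 3 := by
    rw [norm_eis, Real.exp_neg]
    rw [inv_le_comm₀ (Real.exp_pos _) (by positivity)]
    have h1 := Real.add_one_le_exp (Real.pi * s.im)
    have h2 := Real.pi_gt_three
    rw [inv_div]; nlinarith
  have he1 : ‖Complex.exp (I * Real.pi * s)‖ ≤ 1 := by
    rw [norm_eis]; exact Real.exp_le_one_iff.2 (by have := Real.pi_pos; nlinarith)
  have hM3 := hM.trans_le (min_le_left _ _)
  rw [e]
  refine (norm_sub_le _ _).trans_lt ?_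
  rw [norm_mul]
  have h4 : ‖1 - Complex.exp (I * Real.pi * s)‖ ≤ 2 := by
    refine (norm_sub_le _ _).trans ?_
    rw [norm_one]; linarith
  have h5 : ‖1 - Complex.exp (I * Real.pi * s)‖ * ‖Mf s / G1 s - 1‖ ≤ 2 * ‖Mf s / G1 s - 1‖ := by gcongr
  linarith

theorem R_left_ne : ∃ A0 : ℝ, 0 < A0 ∧ ∀ s : ℂ, 0 < s.im → s.im ≤ -s.re → A0 ≤ -s.re → RiemannR s ≠ 0 := by
  obtain ⟨R0, hR0⟩ := M_lim 1 (by positivity)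
  obtain ⟨R1, hR1⟩ : ∃ R1, R1 = max R0 576 := ⟨_, rfl⟩
  have hR1' : 576 ≤ R1 := by rw [hR1]; exact le_max_right _ _
  refine ⟨7 * R1 ^ 2, by positivity, fun s ht h1 h2 => ?_⟩
  have hs2 : s.re ≤ -2 := by nlinarith
  have hη : R1 ≤ ‖eta s‖ := eta_large ht (by linarith) (h2.trans ((neg_le_abs _).trans (abs_re_le_norm s)))
  have hM := hR0 s ht hs2 (((le_max_left _ _).trans hR1.symm.le).trans hη) (y0_far ht h1 (by linarith))
  rw [R_eq_M hs2]
  refine mul_ne_zero (eis_ne ht) fun h => ?_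
  rw [h] at hM; simp at hM

theorem R_right_ne : ∃ σ : ℝ, 2 ≤ σ ∧ ∀ s : ℂ, 0 < s.im → σ ≤ s.re → RiemannR s ≠ 0 := by
  obtain ⟨C, hC, h⟩ := R_right
  refine ⟨2 * (C + 1), by linarith, fun s ht hs h0 => ?_⟩
  have := h s (by linarith) ht
  rw [h0] at this
  simp only [zero_sub, norm_neg, norm_one] at this
  have h1 : Real.exp (-s.re / 2) ≤ Real.exp (-(C + 1)) := Real.exp_le_exp.2 (by linarith)
  have h2 := Real.add_one_le_exp (C + 1)
  have h3 : Real.exp (-(C + 1)) * Real.exp (C + 1) = 1 := by rw [← Real.exp_add]; simp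
  have h4 := Real.exp_pos (-(C + 1))
  nlinarith

theorem zeros_fin (T : ℝ) : {ρ : ℂ | RiemannR ρ = 0 ∧ 0 < ρ.im ∧ ρ.im ≤ T}.Finite := by
  obtain ⟨A0, hA0, hl⟩ := R_left_ne
  obtain ⟨σ, hσ, hr⟩ := R_right_ne
  have hK : IsCompact (Icc (-(max A0 T)) σ ×ℂ Icc 0 T) := isCompact_Icc.reProdIm isCompact_Icc
  refine (zeros_finite isOpen_univ isPreconnected_univ R_differentiable.differentiableOn (mem_univ (⟨σ, 1⟩ : ℂ))
    (hr _ (by simp) (by simp)) hK (subset_univ _)).subset ?_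
  rintro ρ ⟨h0, h1, h2⟩
  refine ⟨?_, h0⟩
  rw [mem_reProdIm]
  refine ⟨⟨?_, ?_⟩, h1.le, h2⟩
  · by_contra hh; push Not at hh
    have g1 := le_max_left A0 T
    have g2 := le_max_right A0 T
    exact hl ρ h1 (by linarith) (by linarith) h0
  · by_contra hh; push Not at hh
    exact hr ρ h1 hh.le h0

end Sg

end

section

namespace Sg
open Complex Set MeasureTheory Metric Filter Topology
set_option autoImplicit false

theorem near_one {f : ℂ → ℂ} {z : ℂ} {r ε : ℝ} (hr : 0 < r)
    (hf : ∀ w ∈ closedBall z r, DifferentiableAt ℂ f w)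
    (hB : ∀ w ∈ closedBall z r, ‖f w - 1‖ ≤ ε) (hε : ε ≤ 1 / 2) :
    f z ≠ 0 ∧ ‖logDeriv f z‖ ≤ 2 * ε / r ∧ |Real.log ‖f z‖| ≤ 2 * ε := by
  have hz := hB z (mem_closedBall_self hr.le)
  have hε0 : 0 ≤ ε := (norm_nonneg _).trans hz
  have h1 : ‖f z‖ ≤ 1 + ε := by
    have := norm_add_le (f z - 1) 1
    rw [sub_add_cancel, norm_one] at this; linarith
  have h2 : 1 - ε ≤ ‖f z‖ := by
    have := norm_sub_norm_le (1 : ℂ) (f z)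
    rw [norm_one, norm_sub_rev] at this; linarith
  have h0 : 0 < ‖f z‖ := by linarith
  refine ⟨norm_pos_iff.1 h0, ?_, ?_⟩
  · have hd : DifferentiableOn ℂ (fun w => f w - 1) (closedBall z r) := fun w hw =>
      ((hf w hw).sub_const 1).differentiableWithinAt
    have hc : DiffContOnCl ℂ (fun w => f w - 1) (ball z r) := by
      refine DifferentiableOn.diffContOnCl ?_
      rwa [closure_ball z hr.ne']
    have := Complex.norm_deriv_le_of_forall_mem_sphere_norm_le hr hc
      (fun w hw => hB w (sphere_subset_closedBall hw))
    rw [deriv_sub_const] at this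
    rw [logDeriv_apply, norm_div, div_le_iff₀ h0]
    have h3 : 2 * ε / r * (1 / 2) ≤ 2 * ε / r * ‖f z‖ := by gcongr; linarith
    calc _ ≤ ε / r := this
      _ = 2 * ε / r * (1 / 2) := by ring
      _ ≤ _ := h3
  · rw [abs_le]
    constructor
    · have h3 := Real.one_sub_inv_le_log_of_pos h0
      have h4 : ‖f z‖⁻¹ ≤ 1 + 2 * ε := by
        rw [inv_le_comm₀ h0 (by linarith)]
        refine le_trans ?_ h2
        rw [inv_le_iff_one_le_mul₀ (by linarith)]
        nlinarith
      linarith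
    · have := Real.log_le_sub_one_of_pos h0
      linarith

theorem vSide_near {f : ℂ → ℂ} {b c d r ε : ℝ} (hr : 0 < r) (hcd : c ≤ d)
    (hf : ∀ y ∈ Icc c d, ∀ w ∈ closedBall ((b : ℂ) + y * I) r, DifferentiableAt ℂ f w)
    (hB : ∀ y ∈ Icc c d, ∀ w ∈ closedBall ((b : ℂ) + y * I) r, ‖f w - 1‖ ≤ ε) (hε : ε ≤ 1 / 2) :
    |vSide f b c d| ≤ (|b| * (2 * ε / r) + 2 * ε) * (d - c) := by
  rw [vSide, ← Real.norm_eq_abs]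
  have := intervalIntegral.norm_integral_le_of_norm_le_const (a := c) (b := d)
    (f := fun y : ℝ => b * (logDeriv f (b + y * I)).re - Real.log ‖f (b + y * I)‖)
    (C := |b| * (2 * ε / r) + 2 * ε) ?_
  · rwa [abs_of_nonneg (by linarith : 0 ≤ d - c)] at this
  · intro y hy
    rw [uIoc_of_le hcd] at hy
    have hy' : y ∈ Icc c d := ⟨hy.1.le, hy.2⟩
    obtain ⟨-, h1, h2⟩ := near_one hr (hf y hy') (hB y hy') hε
    rw [Real.norm_eq_abs]
    refine (abs_sub _ _).trans (add_le_add ?_ h2)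
    rw [abs_mul]
    gcongr
    exact (abs_re_le_norm _).trans h1

theorem hSide_le {f : ℂ → ℂ} {a b c W D : ℝ} (hab : a ≤ b) (hW : ∀ x ∈ Icc a b, |x| ≤ W)
    (hD : ∀ x ∈ Icc a b, |(logDeriv f (x + c * I)).im| ≤ D) : |hSide f a b c| ≤ W * D * (b - a) := by
  rw [hSide, ← Real.norm_eq_abs]
  have := intervalIntegral.norm_integral_le_of_norm_le_const (a := a) (b := b)
    (f := fun x : ℝ => x * (logDeriv f (x + c * I)).im) (C := W * D) ?_
  · rwa [abs_of_nonneg (by linarith : 0 ≤ b - a)] at this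
  · intro x hx
    rw [uIoc_of_le hab] at hx
    have hx' : x ∈ Icc a b := ⟨hx.1.le, hx.2⟩
    rw [Real.norm_eq_abs, abs_mul]
    have := hW x hx'
    exact mul_le_mul this (hD x hx') (abs_nonneg _) ((abs_nonneg _).trans this)

theorem logDeriv_contAt {f : ℂ → ℂ} {U : Set ℂ} (hU : IsOpen U) (hf : DifferentiableOn ℂ f U) {z : ℂ}
    (hz : z ∈ U) (h0 : f z ≠ 0) : ContinuousAt (logDeriv f) z := by
  have hVo : IsOpen (U ∩ f ⁻¹' {0}ᶜ) := hf.continuousOn.isOpen_inter_preimage hU isOpen_compl_singleton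
  exact (diffOn_logDeriv hVo (hf.mono inter_subset_left) fun z hz => hz.2).continuousOn.continuousAt
    (hVo.mem_nhds ⟨hz, h0⟩)

theorem hSide_cont {f : ℂ → ℂ} {U : Set ℂ} (hU : IsOpen U) (hf : DifferentiableOn ℂ f U) {a b c : ℝ}
    (hab : a ≤ b) (hz : ∀ x ∈ Icc a b, (x + c * I : ℂ) ∈ U) (h0 : ∀ x ∈ Icc a b, f (x + c * I) ≠ 0) :
    IntervalIntegrable (fun x : ℝ => x * (logDeriv f (x + c * I)).im) volume a b := by
  refine ContinuousOn.intervalIntegrable ?_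
  rw [uIcc_of_le hab]
  intro x hx
  refine ContinuousAt.continuousWithinAt (continuousAt_id.mul ?_)
  have h1 := logDeriv_contAt hU hf (hz x hx) (h0 x hx)
  exact continuous_im.continuousAt.comp
    (ContinuousAt.comp (f := fun x : ℝ => (x + c * I : ℂ)) h1 (continuous_hline c).continuousAt)

theorem hSide_split {f : ℂ → ℂ} {U : Set ℂ} (hU : IsOpen U) (hf : DifferentiableOn ℂ f U) {a b c e : ℝ}
    (hab : a ≤ b) (hbe : b ≤ e) (hz : ∀ x ∈ Icc a e, (x + c * I : ℂ) ∈ U)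
    (h0 : ∀ x ∈ Icc a e, f (x + c * I) ≠ 0) :
    hSide f a e c = hSide f a b c + hSide f b e c := by
  rw [hSide, hSide, hSide, intervalIntegral.integral_add_adjacent_intervals]
  · exact hSide_cont hU hf hab (fun x hx => hz x ⟨hx.1, hx.2.trans hbe⟩) fun x hx => h0 x ⟨hx.1, hx.2.trans hbe⟩
  · exact hSide_cont hU hf hbe (fun x hx => hz x ⟨hab.trans hx.1, hx.2⟩) fun x hx => h0 x ⟨hab.trans hx.1, hx.2⟩

theorem R_logDeriv {s : ℂ} (h : 0 < s.im) (h0 : RiemannR s ≠ 0) :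
    Ff s ≠ 0 ∧ logDeriv RiemannR s = logDeriv G1 s + logDeriv Ff s := by
  have hF : Ff s ≠ 0 := fun h => h0 (by rw [R_eq_GF, h, mul_zero])
  refine ⟨hF, ?_⟩
  have : RiemannR = fun s => G1 s * Ff s := funext R_eq_GF
  rw [this]
  exact logDeriv_mul s (G1_ne s) hF (G1_diff.differentiableAt (hp_open.mem_nhds h))
    (Ff_diff.differentiableAt (hp_open.mem_nhds h))

theorem hSide_R {a b t : ℝ} (ht : 0 < t) (hab : a ≤ b) (h0 : ∀ x ∈ Icc a b, RiemannR (x + t * I) ≠ 0) :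
    hSide RiemannR a b t = hSide G1 a b t + hSide Ff a b t := by
  have him : ∀ x : ℝ, 0 < (x + t * I : ℂ).im := fun x => by simpa using ht
  rw [hSide, hSide, hSide, ← intervalIntegral.integral_add]
  · refine intervalIntegral.integral_congr fun x hx => ?_
    rw [uIcc_of_le hab] at hx
    rw [(R_logDeriv (him x) (h0 x hx)).2, add_im]; ring
  · exact hSide_cont hp_open G1_diff hab (fun x _ => him x) fun x _ => G1_ne _
  · exact hSide_cont hp_open Ff_diff hab (fun x _ => him x) fun x hx => (R_logDeriv (him x) (h0 x hx)).1

theorem vSide_cont {f : ℂ → ℂ} {U : Set ℂ} (hU : IsOpen U) (hf : DifferentiableOn ℂ f U) {a b c : ℝ}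
    (hab : a ≤ b) (hz : ∀ y ∈ Icc a b, (c + y * I : ℂ) ∈ U) (h0 : ∀ y ∈ Icc a b, f (c + y * I) ≠ 0) :
    IntervalIntegrable (fun y : ℝ => c * (logDeriv f (c + y * I)).re - Real.log ‖f (c + y * I)‖) volume a b := by
  refine ContinuousOn.intervalIntegrable ?_
  rw [uIcc_of_le hab]
  intro x hx
  have h1 := logDeriv_contAt hU hf (hz x hx) (h0 x hx)
  have h2 : ContinuousAt f (c + x * I : ℂ) := hf.continuousOn.continuousAt (hU.mem_nhds (hz x hx))
  have h3 : ContinuousAt (fun y : ℝ => (c + y * I : ℂ)) x := (continuous_vline c).continuousAt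
  refine ContinuousAt.continuousWithinAt ((continuousAt_const.mul ?_).sub ?_)
  · exact continuous_re.continuousAt.comp (ContinuousAt.comp (f := fun y : ℝ => (c + y * I : ℂ)) h1 h3)
  · refine ContinuousAt.log ?_ (norm_ne_zero_iff.2 (h0 x hx))
    exact (ContinuousAt.comp (f := fun y : ℝ => (c + y * I : ℂ)) h2 h3).norm

theorem vSide_R {b c d : ℝ} (hc : 0 < c) (hcd : c ≤ d) (h0 : ∀ y ∈ Icc c d, RiemannR (b + y * I) ≠ 0) :
    vSide RiemannR b c d = vSide G1 b c d + vSide Ff b c d := by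
  have him : ∀ y ∈ Icc c d, 0 < (b + y * I : ℂ).im := fun y hy => by simpa using hc.trans_le hy.1
  rw [vSide, vSide, vSide, ← intervalIntegral.integral_add]
  · refine intervalIntegral.integral_congr fun y hy => ?_
    rw [uIcc_of_le hcd] at hy
    obtain ⟨g1, g2⟩ := R_logDeriv (him y hy) (h0 y hy)
    rw [g2, add_re, R_eq_GF, norm_mul, Real.log_mul (norm_ne_zero_iff.2 (G1_ne _)) (norm_ne_zero_iff.2 g1)]; ring
  · exact vSide_cont hp_open G1_diff hcd him fun x _ => G1_ne _
  · exact vSide_cont hp_open Ff_diff hcd him fun x hx => (R_logDeriv (him x hx) (h0 x hx)).1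

theorem G1_norm_it {y : ℝ} (hy : 0 < y) : ‖G1 ((0 : ℝ) + y * I)‖ = 1 / √2 := by
  have him : (((0 : ℝ) : ℂ) + y * I).im = y := by simp
  have hre : (((0 : ℝ) : ℂ) + y * I).re = 0 := by simp
  generalize (((0 : ℝ) : ℂ) + y * I) = s at *
  have hpos : 0 < s.im := by rw [him]; exact hy
  have hell : (ell s).im = 0 := by
    rw [ell_im]
    have : arg (s / (2 * Real.pi * I)) = 0 := by
      rw [arg_eq_zero_iff, sdiv_re, sdiv_im, hre, him]
      have := Real.pi_pos
      exact ⟨by positivity, by simp⟩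
    rw [this]; simp
  have heta : (eta s).im = 0 := by
    rw [eta, exp_im, hell]; simp
  have e1 : ‖gf s‖ = 1 := by
    rw [gf, norm_exp]
    have : (-s * ell s + s / 2).re = 0 := by
      have e : s / 2 = ((1 / 2 : ℝ) : ℂ) * s := by push_cast; ring
      rw [add_re, e, re_ofReal_mul, mul_re, neg_re, neg_im, hre, hell]; simp
    rw [this, Real.exp_zero]
  have e2 : ‖Complex.exp (Real.pi * I * eta s)‖ = 1 := by
    rw [norm_exp]
    have e : Real.pi * I * eta s = (Real.pi : ℂ) * (I * eta s) := by ring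
    rw [e, re_ofReal_mul, I_mul_re, heta]; simp
  rw [G1, norm_mul, norm_mul, e1, e2, c1_norm]; ring

theorem vSide_G1_zero {c d : ℝ} (hc : 0 < c) (hcd : c ≤ d) :
    vSide G1 0 c d = Real.log 2 / 2 * (d - c) := by
  rw [vSide]
  have : ∫ y in c..d, ((0 : ℝ) * (logDeriv G1 ((0 : ℝ) + y * I)).re - Real.log ‖G1 ((0 : ℝ) + y * I)‖)
      = ∫ y in c..d, Real.log 2 / 2 := by
    refine intervalIntegral.integral_congr fun y hy => ?_
    rw [uIcc_of_le hcd] at hy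
    rw [G1_norm_it (hc.trans_le hy.1), one_div, Real.log_inv, Real.log_sqrt (by norm_num)]; ring
  rw [this, intervalIntegral.integral_const, smul_eq_mul]; ring

theorem vSide_G1 {A c d : ℝ} (hA : 0 ≤ A) (hc : 0 < c) (hcd : c ≤ d) :
    vSide G1 (-A) c d = Real.log 2 / 2 * (d - c) + hSide G1 (-A) 0 c - hSide G1 (-A) 0 d := by
  have := littlewood hp_open G1_diff (by linarith : -A ≤ 0) hcd
    (fun z hz => lt_of_lt_of_le hc hz.2.2.1) (fun _ => 0) ∅ (fun z _ => by simp [G1_ne]) (by simp)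
    (fun z _ => G1_ne z) (by simp)
  rw [vSide_G1_zero hc hcd] at this
  simp only [Finset.sum_empty, mul_zero] at this
  linarith

theorem ell_im_le {s : ℂ} (h : 0 < s.im) : |(ell s).im| ≤ |s.re| / s.im := by
  have hpi := Real.pi_pos
  have h4 := Real.pi_lt_four
  have hb : |arg (s / (2 * Real.pi * I))| ≤ Real.pi / 2 :=
    (abs_arg_lt_pi_div_two_iff.2 (Or.inl (by rw [sdiv_re]; positivity))).le
  have h1 := Real.mul_abs_le_abs_sin hb
  rw [sin_arg, sdiv_im, norm_div] at h1
  have hn : ‖(2 * Real.pi * I : ℂ)‖ = 2 * Real.pi := by simp [abs_of_pos hpi]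
  rw [hn, div_div_div_cancel_right₀ (by positivity), abs_div, abs_neg, abs_of_nonneg (norm_nonneg s)] at h1
  have h2 : |s.re| / ‖s‖ ≤ |s.re| / s.im := by gcongr; exact im_le_norm s
  rw [ell_im, abs_div, abs_of_pos (by norm_num : (0:ℝ) < 2)]
  have h3 : 2 / Real.pi * |arg (s / (2 * Real.pi * I))| ≤ |s.re| / s.im := h1.trans h2
  refine le_trans ?_ h3
  rw [div_mul_eq_mul_div, div_le_div_iff₀ (by norm_num) hpi]
  nlinarith [abs_nonneg (arg (s / (2 * Real.pi * I)))]

theorem eta_ge {s : ℂ} (h : 0 < s.im) : √s.im / 4 ≤ ‖eta s‖ := by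
  have hn := eta_norm h
  have h4 := Real.pi_lt_four
  have := im_le_norm s
  have h1 : √s.im ≤ 4 * ‖eta s‖ := by
    rw [Real.sqrt_le_left (by positivity)]
    nlinarith [sq_nonneg ‖eta s‖]
  linarith

theorem G1_logDeriv_im {s : ℂ} (h : 0 < s.im) :
    |(logDeriv G1 s).im| ≤ |s.re| / s.im + 1 / √s.im := by
  have hpi := Real.pi_pos
  have hn := eta_norm h
  have he := eta_ge h
  have hsq : 0 < √s.im := Real.sqrt_pos.2 h
  have he0 : 0 < ‖eta s‖ := by linarith
  rw [G1_logDeriv h, add_im, neg_im]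
  refine (abs_add_le _ _).trans (add_le_add ?_ ?_)
  · rw [abs_neg]; exact ell_im_le h
  · refine (abs_im_le_norm _).trans ?_
    rw [norm_mul, norm_div, norm_mul, norm_mul, ← hn, norm_I, norm_real, Real.norm_of_nonneg hpi.le,
      RCLike.norm_ofNat]
    have : Real.pi * 1 * (‖eta s‖ / (2 * (2 * Real.pi * ‖eta s‖ ^ 2))) = 1 / (4 * ‖eta s‖) := by
      field_simp; norm_num
    rw [this]
    gcongr; linarith

theorem hSide_G1 {A b t : ℝ} (ht : 0 < t) (hb : -A ≤ b) (hb0 : b ≤ 0) :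
    |hSide G1 (-A) b t| ≤ A * (A / t + 1 / √t) * A := by
  have hA : 0 ≤ A := by linarith
  have hW : ∀ x ∈ Icc (-A) b, |x| ≤ A := fun x hx => by
    rw [abs_le]; exact ⟨hx.1, hx.2.trans (by linarith)⟩
  refine (hSide_le (W := A) (D := A / t + 1 / √t) hb hW ?_).trans ?_
  · intro x hx
    have him : 0 < (x + t * I : ℂ).im := by simpa using ht
    have := G1_logDeriv_im him
    have e1 : (x + t * I : ℂ).im = t := by simp
    have e2 : (x + t * I : ℂ).re = x := by simp
    rw [e1, e2] at this
    refine this.trans ?_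
    gcongr
    exact hW x hx
  · gcongr; linarith

end Sg

end

section

namespace Sg
open Complex Set MeasureTheory Metric Filter Topology
set_option autoImplicit false

/-- `T` is large in terms of `K` -/
def big (K T : ℝ) : Prop := K ≤ Real.log T ∧ K * Real.log T ^ 8 ≤ √T

theorem exists_big (K : ℝ) : ∃ T0 : ℝ, 1 ≤ T0 ∧ ∀ T, T0 ≤ T → big K T := by
  have h1 : ∀ᶠ T in atTop, K ≤ Real.log T := Real.tendsto_log_atTop.eventually_ge_atTop K
  have h2 := (Real.isLittleO_pow_log_id_atTop (n := 16)).def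
    (by positivity : (0 : ℝ) < 1 / (K ^ 2 + 1))
  obtain ⟨T0, h⟩ := eventually_atTop.1 ((h1.and h2).and (eventually_ge_atTop 1))
  refine ⟨max T0 1, le_max_right _ _, fun T hT => ?_⟩
  obtain ⟨⟨g1, g2⟩, g3⟩ := h T ((le_max_left _ _).trans hT)
  refine ⟨g1, ?_⟩
  refine Real.le_sqrt_of_sq_le ?_
  have hl := Real.log_nonneg g3
  rw [id, Real.norm_of_nonneg (by positivity), Real.norm_of_nonneg (by linarith), div_mul_eq_mul_div, one_mul,
    le_div_iff₀ (by positivity)] at g2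
  nlinarith [pow_nonneg hl 16]

theorem big.mono {K K' T : ℝ} (h : big K T) (hK : K' ≤ K) : big K' T := by
  refine ⟨hK.trans h.1, le_trans ?_ h.2⟩
  have : 0 ≤ Real.log T ^ 8 := by positivity
  gcongr

theorem big.basic {K T : ℝ} (h : big K T) (hK : 1000 ≤ K) :
    0 < T ∧ √T ^ 2 = T ∧ K ≤ √T ∧ K * Real.log T ≤ √T ∧ Real.log (4 * T) ≤ 2 * Real.log T
      ∧ K * Real.log T ^ 2 ≤ √T ∧ K ≤ √T / Real.log T := by
  obtain ⟨h1, h2⟩ := h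
  have hL : 1 ≤ Real.log T := by linarith
  have hp : Real.log T ≤ Real.log T ^ 8 := le_self_pow₀ hL (by norm_num)
  have hp2 : Real.log T ^ 2 ≤ Real.log T ^ 8 := pow_le_pow_right₀ hL (by norm_num)
  have h3 : K * Real.log T ≤ √T := le_trans (by gcongr) h2
  have h4 : K ≤ √T := by nlinarith
  have hT : 0 < T := Real.sqrt_pos.1 (by linarith)
  have hs := Real.sq_sqrt hT.le
  refine ⟨hT, hs, h4, h3, ?_, le_trans (by gcongr) h2, ?_⟩
  · have : 2 * Real.log T = Real.log (T * T) := by rw [Real.log_mul hT.ne' hT.ne']; ring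
    rw [this]
    refine Real.log_le_log (by positivity) ?_
    have : 4 ≤ T := by nlinarith
    gcongr
  · rw [le_div_iff₀ (by linarith)]; exact h3

theorem ball_re_im {w c : ℂ} {r : ℝ} (h : w ∈ closedBall c r) :
    c.re - r ≤ w.re ∧ w.re ≤ c.re + r ∧ c.im - r ≤ w.im ∧ w.im ≤ c.im + r := by
  rw [mem_closedBall, dist_eq_norm] at h
  have h1 := (abs_re_le_norm (w - c)).trans h
  have h2 := (abs_im_le_norm (w - c)).trans h
  rw [abs_le, sub_re] at h1
  rw [abs_le, sub_im] at h2
  refine ⟨?_, ?_, ?_, ?_⟩ <;> linarith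

theorem F_near (ε : ℝ) (hε : 0 < ε) : ∃ K : ℝ, 1000 ≤ K ∧ ∀ T, big K T → ∀ s : ℂ, T / 2 ≤ s.im → s.im ≤ 4 * T →
    32 * √T * Real.log T ≤ -s.re → ‖Ff s - 1‖ < ε := by
  obtain ⟨T0, hT0, h⟩ := F_near_one ε hε
  refine ⟨max 1000 T0, le_max_left _ _, fun T hb s h1 h2 h3 => ?_⟩
  have hm := le_max_right 1000 T0
  have hm' := le_max_left 1000 T0
  obtain ⟨b1, b2, b3, b4, b5, b6, -⟩ := hb.basic (le_max_left _ _)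
  have hL := hb.1
  generalize max 1000 T0 = K at *
  have hpos : 0 < s.im := by linarith
  refine h s (by nlinarith) (le_trans ?_ h3)
  have e1 : √s.im ≤ 2 * √T := by
    rw [Real.sqrt_le_left (by positivity), mul_pow, b2]; linarith
  have e2 : Real.log s.im ≤ 2 * Real.log T := (Real.log_le_log hpos h2).trans b5
  calc 8 * √s.im * Real.log s.im ≤ 8 * √s.im * (2 * Real.log T) := by gcongr
    _ ≤ 8 * (2 * √T) * (2 * Real.log T) := by
      have : 0 ≤ Real.log T := by linarith
      gcongr
    _ = _ := by ring

theorem Ff_bound : ∃ C : ℝ, 0 < C ∧ ∀ s : ℂ, 0 < s.im → 2 ≤ -s.re → -s.re ≤ s.im →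
    ‖Ff s‖ ≤ C * s.im * Real.exp (2 * (-s.re) / √s.im) := by
  obtain ⟨C, hC, hM⟩ := M_bound
  refine ⟨8 * C, by positivity, fun s ht h2 ha => ?_⟩
  have hpi := Real.pi_pos
  have hM := hM s ht (by linarith)
  obtain ⟨e1, e2⟩ := eta_re_im ht
  have hn := eta_norm ht
  have hge := eta_ge ht
  have hx := eta_re_ge ht
  have hy := eta_im_pos ht (by linarith)
  have hsq : 0 < √s.im := Real.sqrt_pos.2 ht
  have he0 : 0 < ‖eta s‖ := by linarith
  have hx0 : 0 < (eta s).re := by linarith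
  have hxle : (eta s).re ≤ ‖eta s‖ := re_le_norm _
  have hns : ‖s‖ ≤ 2 * s.im := by
    refine (norm_le_abs_re_add_abs_im s).trans ?_
    rw [abs_of_nonpos (by linarith), abs_of_pos ht]; linarith
  have hy0 : Real.pi * (eta s).im ≤ 2 * (-s.re) / √s.im := by
    rw [le_div_iff₀ hsq, e2]
    have : √s.im ≤ 8 * (eta s).re := by linarith
    have h3 : Real.pi * (eta s).im * √s.im ≤ Real.pi * (eta s).im * (8 * (eta s).re) := by gcongr
    linarith
  have hr : ‖eta s‖ / (eta s).im ≤ 2 * s.im := by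
    rw [div_le_iff₀ hy]
    have h3 : 2 * ‖eta s‖ ≤ 4 * Real.pi * (eta s).re * (eta s).im * ‖eta s‖ := by
      rw [← e2]; gcongr
    have h4 : 4 * Real.pi * (eta s).re * (eta s).im * ‖eta s‖ ≤ 4 * Real.pi * ‖eta s‖ * (eta s).im * ‖eta s‖ := by
      gcongr
    have h5 : 4 * Real.pi * ‖eta s‖ * (eta s).im * ‖eta s‖ = 2 * ‖s‖ * (eta s).im := by rw [← hn]; ring
    have h6 : 2 * ‖s‖ * (eta s).im ≤ 2 * (2 * s.im) * (eta s).im := by gcongr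
    linarith
  have he1 : ‖Complex.exp (I * Real.pi * s)‖ ≤ 1 := by
    rw [norm_eis]; exact Real.exp_le_one_iff.2 (by nlinarith)
  have h4 : ‖1 - Complex.exp (I * Real.pi * s)‖ ≤ 2 := by
    refine (norm_sub_le _ _).trans ?_
    rw [norm_one]; linarith
  have hg : ‖G1 s‖ = 1 / √2 * (‖gf s‖ * Real.exp (-(Real.pi * (eta s).im))) := by
    rw [G1, norm_mul, norm_mul, c1_norm, norm_exp]
    congr 3
    have e : Real.pi * I * eta s = (Real.pi : ℂ) * (I * eta s) := by ring
    rw [e, re_ofReal_mul, I_mul_re]; ring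
  have hgf : 0 < ‖gf s‖ := norm_pos_iff.2 (Complex.exp_ne_zero _)
  rw [Ff, R_eq_M (by linarith), norm_div, norm_mul, div_le_iff₀ (norm_pos_iff.2 (G1_ne s)), hg]
  have h2s : 0 < √2 := by positivity
  have h22 : √2 ≤ 2 := by rw [Real.sqrt_le_left (by norm_num)]; norm_num
  have h12 : 1 / 2 ≤ 1 / √2 := by gcongr
  have hexp : 1 ≤ Real.exp (2 * (-s.re) / √s.im) * Real.exp (-(Real.pi * (eta s).im)) := by
    rw [← Real.exp_add]; exact Real.one_le_exp (by linarith)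
  calc ‖1 - Complex.exp (I * Real.pi * s)‖ * ‖Mf s‖ ≤ 2 * (C * (‖gf s‖ * (2 * s.im))) := by
        refine mul_le_mul h4 (hM.trans ?_) (norm_nonneg _) (by norm_num)
        gcongr
    _ = 8 * C * s.im * (1 / 2 * ‖gf s‖) * 1 := by ring
    _ ≤ 8 * C * s.im * (1 / √2 * ‖gf s‖) * (Real.exp (2 * (-s.re) / √s.im) * Real.exp (-(Real.pi * (eta s).im))) := by
        gcongr
    _ = _ := by ring

theorem hSide_Ff : ∃ K : ℝ, 1000 ≤ K ∧ ∀ T, big K T → ∀ t, T ≤ t → t ≤ 3 * T →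
    (∀ x ∈ Icc (-(64 * √T * Real.log T)) (-(√T / Real.log T)), RiemannR (x + t * I) ≠ 0) →
    |hSide Ff (-(64 * √T * Real.log T)) (-(√T / Real.log T)) t| ≤ 50000000000 * (√T * Real.log T ^ 6) := by
  obtain ⟨K1, hK1, hn⟩ := F_near (1 / 2) (by norm_num)
  obtain ⟨C, hC, hF⟩ := Ff_bound
  refine ⟨K1 + 8 * C, by linarith, fun T hb t ht1 ht2 h0 => ?_⟩
  obtain ⟨b1, b2, b3, b4, b5, b6, b7⟩ := hb.basic (by linarith)
  have hL := hb.1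
  have hn := hn T (hb.mono (by linarith))
  have hel : Real.exp (2 * Real.log T) = T ^ 2 := by
    rw [mul_comm, Real.exp_mul, Real.exp_log b1]; norm_num
  generalize Real.log T = L at *
  generalize √T = S at *
  have hLpos : 0 < L := by linarith
  have hSpos : 0 < S := by linarith
  have hSL : 1000 * L ≤ S := by nlinarith
  have hSL2 : 1000 * L ^ 2 ≤ S := by nlinarith
  set A := 64 * S * L with hA
  set A' := S / L with hA'
  have hA'1 : 1000 ≤ A' := by linarith
  have hAA : A' ≤ S := by rw [hA', div_le_iff₀ hLpos]; nlinarith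
  have hAS : 64 * S ≤ A := by rw [hA]; nlinarith
  have hAT : 15 * A ≤ T := by rw [hA, ← b2]; nlinarith
  have hApos : 0 < A := by linarith
  have hcim : ((-A : ℝ) + t * I : ℂ).im = t := by simp
  have hcre : ((-A : ℝ) + t * I : ℂ).re = -A := by simp
  set c : ℂ := (-A : ℝ) + t * I with hc
  have hcn : ‖Ff c - 1‖ < 1 / 2 := hn c (by rw [hcim]; linarith) (by rw [hcim]; linarith)
    (by rw [hcre, hA]; nlinarith)
  have hc2 : 1 / 2 ≤ ‖Ff c‖ := by
    have := norm_sub_norm_le (1 : ℂ) (Ff c)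
    rw [norm_one, norm_sub_rev] at this; linarith
  have := disc_lemma (f := Ff) (c := c) (r := A - A') (R := A - A' / 2) (R' := A) (M := 514 * L) (W := A)
    (a := -A) (b := -A') (by linarith) (by linarith) (by linarith) (by linarith)
    (Ff_diff.mono fun w hw => ?_) (by intro h; rw [h, norm_zero] at hc2; linarith) ?_ (by linarith) ?_ ?_ ?_
  · rw [hcim] at this
    refine this.trans ?_
    have e1 : A - A' / 2 - (A - A') = A' / 2 := by ring
    have e2 : (A - A' / 2) / (A' / 2) ≤ 128 * L ^ 2 := by
      rw [div_le_iff₀ (by linarith)]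
      have : 128 * L ^ 2 * (A' / 2) = A := by rw [hA, hA']; field_simp; norm_num
      linarith
    have e3 : 0 ≤ (A - A' / 2) / (A' / 2) := div_nonneg (by linarith) (by linarith)
    rw [e1]
    calc 80 * A * (514 * L) * ((A - A' / 2) / (A' / 2)) ^ 2 ≤ 80 * A * (514 * L) * (128 * L ^ 2) ^ 2 := by gcongr
      _ = 43117445120 * (S * L ^ 6) := by rw [hA]; ring
      _ ≤ _ := by gcongr; norm_num
  · obtain ⟨-, -, g3, -⟩ := ball_re_im (ball_subset_closedBall hw)
    rw [hcim] at g3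
    change 0 < w.im
    linarith
  · intro z hz
    obtain ⟨g1, g2, g3, g4⟩ := ball_re_im hz
    rw [hcim] at g3 g4
    rw [hcre] at g1 g2
    have hz1 : T / 4 ≤ z.im := by linarith
    have hz2 : z.im ≤ 4 * T := by linarith
    have hsq : S / 2 ≤ √z.im := Real.le_sqrt_of_sq_le (by rw [div_pow, b2]; linarith)
    refine (hF z (by linarith) (by linarith) (by linarith)).trans ?_
    have e1 : 2 * (-z.re) / √z.im ≤ 512 * L := by
      rw [div_le_iff₀ (by linarith)]
      have : 512 * L * (S / 2) ≤ 512 * L * √z.im := by gcongr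
      have : 512 * L * (S / 2) = 4 * A := by rw [hA]; ring
      linarith
    have e2 : Real.exp (514 * L) = T ^ 2 * Real.exp (512 * L) := by
      rw [← hel, ← Real.exp_add]; congr 1; ring
    have hT8 : 8 * C ≤ T := by nlinarith
    rw [e2]
    calc C * z.im * Real.exp (2 * (-z.re) / √z.im) ≤ C * (4 * T) * Real.exp (512 * L) := by gcongr
      _ = 8 * C * (1 / 2 * T * Real.exp (512 * L)) := by ring
      _ ≤ T * (1 / 2 * T * Real.exp (512 * L)) := by gcongr
      _ = T ^ 2 * Real.exp (512 * L) * (1 / 2) := by ring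
      _ ≤ _ := by gcongr
  · intro x hx
    have : (x + c.im * I : ℂ) - c = ((x + A : ℝ) : ℂ) := by rw [hcim, hc]; push_cast; ring
    rw [this, norm_real, Real.norm_of_nonneg (by linarith [hx.1])]; linarith [hx.2]
  · intro x hx
    rw [hcim]
    exact (R_logDeriv (by simp; linarith) (h0 x hx)).1
  · intro x hx
    rw [abs_le]; exact ⟨hx.1, by linarith [hx.2]⟩

theorem R_near (ε : ℝ) (hε : 0 < ε) : ∃ σ0 : ℝ, 2 ≤ σ0 ∧ ∀ s : ℂ, 0 < s.im → σ0 ≤ s.re → ‖RiemannR s - 1‖ ≤ ε := by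
  obtain ⟨C, hC, h⟩ := R_right
  refine ⟨max 2 (2 * (C / ε)), le_max_left _ _, fun s hs h2 => ?_⟩
  have g1 := (le_max_left _ _).trans h2
  have g2 := (le_max_right _ _).trans h2
  refine (h s g1 hs).trans ?_
  have e := Real.add_one_le_exp (s.re / 2)
  have e2 : -s.re / 2 = -(s.re / 2) := by ring
  rw [e2, Real.exp_neg, ← div_eq_mul_inv, div_le_iff₀ (Real.exp_pos _)]
  have : C / ε ≤ Real.exp (s.re / 2) := by linarith
  rw [div_le_iff₀ hε] at this
  linarith

theorem hSide_R2 {σ : ℝ} (hσ : 2 ≤ σ) (hR : ∀ s : ℂ, 0 < s.im → σ ≤ s.re → ‖RiemannR s - 1‖ ≤ 1 / 2) :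
    ∃ K : ℝ, 1000 ≤ K ∧ ∀ T, big K T → ∀ t, T ≤ t → t ≤ 3 * T →
    (∀ x ∈ Icc (-(√T / Real.log T)) σ, RiemannR (x + t * I) ≠ 0) →
    |hSide RiemannR (-(√T / Real.log T)) σ t| ≤ 1600 * (T / Real.log T) := by
  obtain ⟨C, hC, hG⟩ := R_growth
  refine ⟨1000 + σ + 2 * C, by linarith, fun T hb t ht1 ht2 h0 => ?_⟩
  obtain ⟨b1, b2, b3, b4, b5, b6, b7⟩ := hb.basic (by linarith)
  have hL := hb.1
  have hT4 : ∀ u, 0 < u → u ≤ 4 * T → Real.log u ≤ 2 * Real.log T := fun u hu hu2 =>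
    (Real.log_le_log hu hu2).trans b5
  generalize Real.log T = L at *
  generalize √T = S at *
  have hLpos : 0 < L := by linarith
  have hSpos : 0 < S := by linarith
  have hSL : 1000 * L ≤ S := by nlinarith
  set A' := S / L with hA'
  have hA'1 : σ ≤ A' := by linarith
  have hAL : A' * L = S := by rw [hA']; field_simp
  have hAS : 1000 * A' ≤ S := by
    rw [← hAL, mul_comm]; gcongr; linarith
  have hST : 1000 * S ≤ T := by rw [← b2]; nlinarith
  have hcim : ((σ : ℝ) + t * I : ℂ).im = t := by simp
  have hcre : ((σ : ℝ) + t * I : ℂ).re = σ := by simp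
  set c : ℂ := (σ : ℝ) + t * I with hc
  have hc2 : 1 / 2 ≤ ‖RiemannR c‖ := by
    have := norm_sub_norm_le (1 : ℂ) (RiemannR c)
    rw [norm_one, norm_sub_rev] at this
    have := hR c (by rw [hcim]; linarith) (by rw [hcre])
    linarith
  have := disc_lemma (f := RiemannR) (c := c) (r := σ + A') (R := 2 * (σ + A')) (R' := 3 * (σ + A'))
    (M := 5 * S) (W := A')
    (a := -A') (b := σ) (by linarith) (by linarith) (by linarith) (by linarith)
    R_differentiable.differentiableOn (by intro h; rw [h, norm_zero] at hc2; linarith) ?_ (by linarith) ?_ ?_ ?_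
  · rw [hcim] at this
    refine this.trans ?_
    have e1 : 2 * (σ + A') / (2 * (σ + A') - (σ + A')) = 2 := by
      have : σ + A' ≠ 0 := by linarith
      have e : 2 * (σ + A') - (σ + A') = σ + A' := by ring
      rw [e]; field_simp
    rw [e1, ← b2, hA']
    apply le_of_eq; field_simp; norm_num
  · intro z hz
    obtain ⟨g1, g2, g3, g4⟩ := ball_re_im hz
    rw [hcim] at g3 g4
    rw [hcre] at g1 g2
    have hz1 : T / 4 ≤ z.im := by linarith
    have hz2 : z.im ≤ 4 * T := by linarith
    have hsq : S / 2 ≤ √z.im := Real.le_sqrt_of_sq_le (by rw [div_pow, b2]; linarith)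
    refine (hG z (by linarith) (by linarith)).trans ?_
    have hlog := hT4 z.im (by linarith) hz2
    have hlog0 : 0 ≤ Real.log z.im := Real.log_nonneg (by linarith)
    have e1 : (max (-z.re) 0 + 1) * Real.log z.im / 2 ≤ 4 * S := by
      have : max (-z.re) 0 ≤ 3 * A' := max_le (by linarith) (by linarith)
      calc (max (-z.re) 0 + 1) * Real.log z.im / 2 ≤ (3 * A' + 1) * (2 * L) / 2 := by gcongr
        _ = 3 * (A' * L) + L := by ring
        _ ≤ _ := by rw [hAL]; linarith
    have e2 : 2 * C ≤ Real.exp S := by linarith [Real.add_one_le_exp S]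
    calc C * Real.exp ((max (-z.re) 0 + 1) * Real.log z.im / 2) ≤ C * Real.exp (4 * S) := by gcongr
      _ = 2 * C * (Real.exp (4 * S) * (1 / 2)) := by ring
      _ ≤ Real.exp S * (Real.exp (4 * S) * ‖RiemannR c‖) := by gcongr
      _ = _ := by rw [← mul_assoc, ← Real.exp_add]; congr 2; ring
  · intro x hx
    have : (x + c.im * I : ℂ) - c = ((x - σ : ℝ) : ℂ) := by rw [hcim, hc]; push_cast; ring
    rw [this, norm_real, Real.norm_of_nonpos (by linarith [hx.2])]; linarith [hx.1]
  · intro x hx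
    rw [hcim]
    exact h0 x hx
  · intro x hx
    rw [abs_le]; exact ⟨hx.1, by linarith [hx.2]⟩

end Sg

end

section

namespace Sg
open Complex Set MeasureTheory Metric Filter Topology
set_option autoImplicit false

theorem ne_of_near {z : ℂ} {ε : ℝ} (hε : ε ≤ 1 / 2) (h : ‖z - 1‖ ≤ ε) : z ≠ 0 := by
  rintro rfl
  rw [zero_sub, norm_neg, norm_one] at h; linarith

theorem hSide_G1_big {T b t : ℝ} (hb : big 1000 T) (ht : T ≤ t) (hb1 : -(64 * √T * Real.log T) ≤ b) (hb0 : b ≤ 0) :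
    |hSide G1 (-(64 * √T * Real.log T)) b t| ≤ 270000 * (√T * Real.log T ^ 6) := by
  obtain ⟨b1, b2, b3, b4, b5, b6, b7⟩ := hb.basic le_rfl
  have hL := hb.1
  refine (hSide_G1 (by linarith) hb1 hb0).trans ?_
  have hst : √T ≤ √t := Real.sqrt_le_sqrt ht
  generalize Real.log T = L at *
  generalize √T = S at *
  have hL0 : 1 ≤ L := by linarith
  have hS : 0 < S := by linarith
  have h1 : 64 * S * L / t + 1 / √t ≤ 65 * L / S := by
    have e1 : 64 * S * L / t ≤ 64 * L / S := by
      calc 64 * S * L / t ≤ 64 * S * L / T := by gcongr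
        _ = 64 * L / S := by rw [← b2]; field_simp
    have e2 : 1 / √t ≤ L / S := by gcongr
    calc _ ≤ 64 * L / S + L / S := add_le_add e1 e2
      _ = _ := by ring
  calc 64 * S * L * (64 * S * L / t + 1 / √t) * (64 * S * L) ≤ 64 * S * L * (65 * L / S) * (64 * S * L) := by
        gcongr
    _ = 266240 * (S * L ^ 3) := by field_simp; ring
    _ ≤ 270000 * (S * L ^ 6) := by gcongr <;> norm_num

set_option maxHeartbeats 1000000 in
theorem window (m : ℂ → ℕ)
    (hm : ∀ ρ : ℂ, RiemannR ρ = 0 →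
      ∃ g : ℂ → ℂ, AnalyticAt ℂ g ρ ∧ g ρ ≠ 0 ∧
        ∀ᶠ s in nhds ρ, RiemannR s = (s - ρ) ^ (m ρ) * g s) (ε : ℝ) (hε : 0 < ε) :
    ∃ T0 : ℝ, 1 ≤ T0 ∧ ∀ T, T0 ≤ T → ∀ T1 T2, T ≤ T1 → T1 ≤ T2 → T2 ≤ 3 * T →
      (∀ s : ℂ, s.im = T1 → RiemannR s ≠ 0) → (∀ s : ℂ, s.im = T2 → RiemannR s ≠ 0) →
      |(∑ᶠ ρ ∈ {ρ : ℂ | RiemannR ρ = 0 ∧ T1 < ρ.im ∧ ρ.im ≤ T2}, (m ρ : ℝ) * ρ.re)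
        + (T2 - T1) * (Real.log 2 / (4 * Real.pi))| ≤ ε * T := by
  obtain ⟨e, he⟩ : ∃ e, e = min (ε / 5) (1 / 2) := ⟨_, rfl⟩
  have he0 : 0 < e := by rw [he]; positivity
  have he1 : e ≤ ε / 5 := he ▸ min_le_left _ _
  have he2 : e ≤ 1 / 2 := he ▸ min_le_right _ _
  obtain ⟨σ0, hσ0, hR⟩ := R_near e he0
  obtain ⟨K1, hK1, hFn⟩ := F_near e he0
  obtain ⟨K2, hK2, hFs⟩ := hSide_Ff
  obtain ⟨K3, hK3, hRs⟩ := hSide_R2 (σ := 2 * σ0) (by linarith)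
    (fun s hs h => (hR s hs (by linarith)).trans he2)
  obtain ⟨T0, hT0, hbig⟩ := exists_big (K1 + K2 + K3 + 200000000000 / e)
  have hKe : 0 < 200000000000 / e := by positivity
  refine ⟨max T0 (σ0 + 1), hT0.trans (le_max_left _ _), fun T hT' T1 T2 hT1 hT12 hT2 hz1 hz2 => ?_⟩
  have hT := (le_max_left _ _).trans hT'
  have hTσ := (le_max_right _ _).trans hT'
  have hb := hbig T hT
  have hFn := hFn T (hb.mono (by linarith))
  have hFs := hFs T (hb.mono (by linarith))
  have hRs := hRs T (hb.mono (by linarith))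
  have hGs := fun b t ht hb1 hb0 => hSide_G1_big (T := T) (b := b) (t := t) (hb.mono (by linarith)) ht hb1 hb0
  have hbe := hb.mono (by linarith : 200000000000 / e ≤ K1 + K2 + K3 + 200000000000 / e)
  have hb := hb.mono (by linarith : 1000 ≤ K1 + K2 + K3 + 200000000000 / e)
  obtain ⟨b1, b2, b3, b4, b5, b6, b7⟩ := hb.basic le_rfl
  have hL := hb.1
  obtain ⟨c1, c2⟩ := hbe
  generalize Real.log T = L at *
  generalize √T = S at *
  have hLpos : 0 < L := by linarith
  have hSpos : 0 < S := by linarith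
  obtain ⟨A, hA⟩ : ∃ A, A = 64 * S * L := ⟨_, rfl⟩
  obtain ⟨A', hA'⟩ : ∃ A', A' = S / L := ⟨_, rfl⟩
  have hAA : A' ≤ S := by rw [hA', div_le_iff₀ hLpos]; nlinarith
  have hA'0 : 0 < A' := by rw [hA']; positivity
  have hAS : 64 * S ≤ A := by rw [hA]; nlinarith
  have hAT : 15 * A ≤ T := by rw [hA, ← b2]; nlinarith
  have hApos : 0 < A := by linarith
  have h32 : A / 2 = 32 * S * L := by rw [hA]; ring
  rw [← h32] at hFn
  rw [← hA, ← hA'] at hFs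
  rw [← hA'] at hRs
  rw [← hA] at hGs
  -- zero free on left and right
  have hleft : ∀ s : ℂ, T1 ≤ s.im → s.im ≤ T2 → A ≤ -s.re → RiemannR s ≠ 0 := fun s h1 h2 h3 => by
    rw [R_eq_GF]
    exact mul_ne_zero (G1_ne s) (ne_of_near he2 (hFn s (by linarith) (by linarith) (by linarith)).le)
  have hright : ∀ s : ℂ, T1 ≤ s.im → 2 * σ0 ≤ s.re → RiemannR s ≠ 0 := fun s h1 h2 =>
    ne_of_near he2 (hR s (by linarith) (by linarith))
  have hfin : {ρ : ℂ | RiemannR ρ = 0 ∧ T1 < ρ.im ∧ ρ.im ≤ T2}.Finite :=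
    (zeros_fin T2).subset fun ρ h => ⟨h.1, by linarith [h.2.1], h.2.2⟩
  rw [finsum_mem_eq_finite_toFinset_sum _ hfin]
  have hmem : ∀ z, z ∈ hfin.toFinset ↔ RiemannR z = 0 ∧ T1 < z.im ∧ z.im ≤ T2 := fun z => by
    rw [hfin.mem_toFinset]; rfl
  have hlit := littlewood isOpen_univ R_differentiable.differentiableOn (by linarith : -A ≤ 2 * σ0) hT12
    (subset_univ _) m hfin.toFinset ?_ ?_ ?_ ?_
  rotate_left
  · intro z hz
    rw [hmem]
    refine ⟨fun h => ⟨h, lt_of_le_of_ne hz.2.2.1 fun h' => hz1 z h'.symm h, hz.2.2.2⟩, fun h => h.1⟩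
  · intro z hz
    rw [hmem] at hz
    obtain ⟨g1, g2, g3⟩ := hz
    refine ⟨?_, ?_, g2.le, g3⟩
    · by_contra hh; push Not at hh
      exact hleft z g2.le g3 (by linarith) g1
    · by_contra hh; push Not at hh
      exact hright z g2.le hh.le g1
  · rintro z ⟨hz, h | h | h | h⟩
    · exact hleft z hz.2.2.1 hz.2.2.2 (by linarith)
    · exact hright z hz.2.2.1 h.ge
    · exact hz1 z h
    · exact hz2 z h
  · intro ρ hρ
    exact hm ρ ((hmem ρ).1 hρ).1
  -- sides
  have hsplit : ∀ t, T ≤ t → t ≤ 3 * T → (∀ s : ℂ, s.im = t → RiemannR s ≠ 0) →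
      |hSide RiemannR (-A) (2 * σ0) t| ≤ 270000 * (S * L ^ 6) + 50000000000 * (S * L ^ 6) + 1600 * (T / L) := by
    intro t h1 h2 h3
    have h3' : ∀ x : ℝ, RiemannR (x + t * I) ≠ 0 := fun x => h3 _ (by simp)
    rw [hSide_split isOpen_univ R_differentiable.differentiableOn (by linarith : -A ≤ -A') (by linarith : -A' ≤ 2 * σ0)
      (fun _ _ => mem_univ _) (fun x _ => h3' x), hSide_R (by linarith) (by linarith) (fun x _ => h3' x)]
    have g1 := hGs (-A') t h1 (by linarith) (by linarith)
    have g2 := hFs t h1 h2 (fun x _ => h3' x)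
    have g3 := hRs t h1 h2 (fun x _ => h3' x)
    exact (abs_add_le _ _).trans (add_le_add ((abs_add_le _ _).trans (add_le_add g1 g2)) g3)
  have s1 := hsplit T1 hT1 (by linarith) hz1
  have s2 := hsplit T2 (by linarith) hT2 hz2
  have s3 : |vSide RiemannR (2 * σ0) T1 T2| ≤ 6 * e * (2 * T) := by
    have := vSide_near (f := RiemannR) (b := 2 * σ0) (r := σ0) (ε := e) (by linarith) hT12
      (fun y hy w hw => R_differentiable.differentiableAt) (fun y hy w hw => ?_) he2
    · refine this.trans ?_
      have e1 : |2 * σ0| * (2 * e / σ0) + 2 * e = 6 * e := by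
        rw [abs_of_pos (by linarith)]; field_simp; norm_num
      rw [e1]; gcongr; linarith
    · obtain ⟨g1, g2, g3, g4⟩ := ball_re_im hw
      have i1 : (((2 * σ0 : ℝ) : ℂ) + y * I).im = y := by simp
      have i2 : (((2 * σ0 : ℝ) : ℂ) + y * I).re = 2 * σ0 := by simp
      rw [i2] at g1
      rw [i1] at g3
      exact hR w (by linarith [hy.1]) (by linarith)
  have s4 : |vSide Ff (-A) T1 T2| ≤ 6 * e * (2 * T) := by
    have hh : ∀ y ∈ Icc T1 T2, ∀ w ∈ closedBall (((-A : ℝ) : ℂ) + y * I) (A / 2),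
        A / 2 ≤ -w.re ∧ T / 2 ≤ w.im ∧ w.im ≤ 4 * T := by
      intro y hy w hw
      obtain ⟨g1, g2, g3, g4⟩ := ball_re_im hw
      have i1 : (((-A : ℝ) : ℂ) + y * I).im = y := by simp
      have i2 : (((-A : ℝ) : ℂ) + y * I).re = -A := by simp
      rw [i2] at g1 g2
      rw [i1] at g3 g4
      refine ⟨?_, ?_, ?_⟩ <;> linarith [hy.1, hy.2]
    have := vSide_near (f := Ff) (b := -A) (r := A / 2) (ε := e) (by linarith) hT12
      (fun y hy w hw => Ff_diff.differentiableAt (hp_open.mem_nhds ?_)) (fun y hy w hw => ?_) he2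
    · refine this.trans ?_
      have e1 : |-A| * (2 * e / (A / 2)) + 2 * e = 6 * e := by
        rw [abs_neg, abs_of_pos (by linarith)]; field_simp; norm_num
      rw [e1]; gcongr; linarith
    · change 0 < w.im
      linarith [(hh y hy w hw).2.1]
    · obtain ⟨g1, g2, g3⟩ := hh y hy w hw
      exact (hFn w g2 g3 g1).le
  have s5 := hGs 0 T1 hT1 (by linarith) le_rfl
  have s6 := hGs 0 T2 (by linarith) (by linarith) le_rfl
  have s7 := vSide_R (b := -A) (by linarith : 0 < T1) hT12
    (fun y hy => hleft _ (by simpa using hy.1) (by simpa using hy.2) (by simp))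
  rw [vSide_G1 hApos.le (by linarith) hT12] at s7
  -- error terms
  have r1 : S * L ^ 6 ≤ e * T / 200000000000 := by
    rw [div_mul_eq_mul_div, div_le_iff₀ he0] at c2
    have : L ^ 6 ≤ L ^ 8 := pow_le_pow_right₀ (by linarith) (by norm_num)
    rw [← b2, le_div_iff₀ (by norm_num)]
    calc S * L ^ 6 * 200000000000 ≤ S * L ^ 8 * 200000000000 := by gcongr
      _ = S * (200000000000 * L ^ 8) := by ring
      _ ≤ S * (S * e) := by gcongr
      _ = _ := by ring
  have r2 : T / L ≤ e * T / 200000000000 := by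
    rw [div_le_iff₀ he0] at c1
    rw [div_le_div_iff₀ hLpos (by norm_num)]
    calc T * 200000000000 ≤ T * (L * e) := by gcongr
      _ = _ := by ring
  have hpi := Real.pi_gt_three
  generalize (∑ ρ ∈ hfin.toFinset, (m ρ : ℝ) * ρ.re) = Q at *
  have hfinal : |2 * Real.pi * Q + Real.log 2 / 2 * (T2 - T1)| ≤ 30 * e * T := by
    rw [abs_le] at *
    constructor <;> linarith
  have e1 : Q + (T2 - T1) * (Real.log 2 / (4 * Real.pi)) =
      (2 * Real.pi * Q + Real.log 2 / 2 * (T2 - T1)) / (2 * Real.pi) := by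
    field_simp; ring
  rw [e1, abs_div, abs_of_pos (by linarith : 0 < 2 * Real.pi), div_le_iff₀ (by linarith)]
  refine hfinal.trans ?_
  have h5 : 5 * e ≤ ε := by linarith
  calc 30 * e * T = 5 * e * T * 6 := by ring
    _ ≤ ε * T * (2 * Real.pi) := by gcongr; linarith

end Sg

end

section

namespace Sg
open Complex Set MeasureTheory Metric Filter Topology
set_option autoImplicit false

def zset (T : ℝ) : Set ℂ := {ρ : ℂ | RiemannR ρ = 0 ∧ 0 < ρ.im ∧ ρ.im ≤ T}

theorem gap (T η : ℝ) (hT : 0 < T) (hη : 0 < η) : ∃ T', T < T' ∧ T' ≤ T + η ∧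
    (∀ s : ℂ, s.im = T' → RiemannR s ≠ 0) ∧ zset T' = zset T := by
  have hF : ((fun z : ℂ => z.im) '' zset (T + 1) ∩ Ioi T).Finite := ((zeros_fin (T + 1)).image _).inter_of_left _
  obtain ⟨δ, hδ, hb⟩ := Metric.mem_nhds_iff.1 (hF.isClosed.isOpen_compl.mem_nhds (fun h => lt_irrefl T h.2 : T ∈ _))
  obtain ⟨d, hd⟩ : ∃ d, d = min (min δ η) 1 / 2 := ⟨_, rfl⟩
  have hm1 : min (min δ η) 1 ≤ δ := (min_le_left _ _).trans (min_le_left _ _)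
  have hm2 : min (min δ η) 1 ≤ η := (min_le_left _ _).trans (min_le_right _ _)
  have hm3 : min (min δ η) 1 ≤ 1 := min_le_right _ _
  have hm0 : 0 < min (min δ η) 1 := by positivity
  have key : ∀ s : ℂ, T < s.im → s.im ≤ T + d → RiemannR s ≠ 0 := by
    intro s h1 h2 h0
    refine hb (a := s.im) ?_ ⟨⟨s, ⟨h0, by linarith, by linarith⟩, rfl⟩, h1⟩
    rw [mem_ball, Real.dist_eq, abs_of_pos (by linarith)]; linarith
  refine ⟨T + d, by linarith, by linarith, fun s hs => key s (by linarith) hs.le, ?_⟩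
  ext s
  constructor
  · rintro ⟨h0, h1, h2⟩
    refine ⟨h0, h1, ?_⟩
    by_contra hh; push Not at hh
    exact key s hh h2 h0
  · rintro ⟨h0, h1, h2⟩
    exact ⟨h0, h1, by linarith⟩

theorem main (m : ℂ → ℕ)
    (hm : ∀ ρ : ℂ, RiemannR ρ = 0 →
      ∃ g : ℂ → ℂ, AnalyticAt ℂ g ρ ∧ g ρ ≠ 0 ∧
        ∀ᶠ s in nhds ρ, RiemannR s = (s - ρ) ^ (m ρ) * g s) :
    ∀ ε > (0 : ℝ), ∃ T₀ : ℝ, ∀ T ≥ T₀,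
      |(-∑ᶠ ρ ∈ zset T, (m ρ : ℝ) * ρ.re) - T / (4 * Real.pi) * Real.log 2| ≤ ε * T := by
  intro ε hε
  obtain ⟨T0, hT0, hw⟩ := window m hm (ε / 8) (by positivity)
  obtain ⟨κ, hκ⟩ : ∃ κ, κ = Real.log 2 / (4 * Real.pi) := ⟨_, rfl⟩
  have hpi := Real.pi_gt_three
  have hκ0 : 0 ≤ κ := by rw [hκ]; have := Real.log_nonneg (by norm_num : (1:ℝ) ≤ 2); positivity
  have hκ1 : κ ≤ 1 := by
    rw [hκ, div_le_one (by positivity)]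
    have := Real.log_two_lt_d9
    linarith
  rw [← hκ] at hw
  let S : ℝ → ℝ := fun T => ∑ᶠ ρ ∈ zset T, (m ρ : ℝ) * ρ.re
  let E : ℝ → ℝ := fun T => S T + κ * T
  have step : ∀ T T1 T2, T0 ≤ T → T ≤ T1 → T1 ≤ T2 → T2 ≤ 2 * T → |E T2 - E T1| ≤ ε / 4 * T := by
    intro T T1 T2 h0 h1 h2 h3
    rcases h2.eq_or_lt with h2 | h2
    · rw [h2, sub_self, abs_zero]; have : 0 < T := by linarith
      positivity
    obtain ⟨η, hη⟩ : ∃ η, η = min (min (T2 - T1) (ε / 8 * T)) T := ⟨_, rfl⟩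
    have hTpos : 0 < T := by linarith
    have g0 : 0 < η := by rw [hη]; have : 0 < T2 - T1 := by linarith
                          positivity
    have g1 : η ≤ T2 - T1 := hη ▸ (min_le_left _ _).trans (min_le_left _ _)
    have g2 : η ≤ ε / 8 * T := hη ▸ (min_le_left _ _).trans (min_le_right _ _)
    have g3 : η ≤ T := hη ▸ min_le_right _ _
    obtain ⟨U1, a1, a2, a3, a4⟩ := gap T1 η (by linarith) g0
    obtain ⟨U2, c1, c2, c3, c4⟩ := gap T2 η (by linarith) g0
    have hW := hw T h0 U1 U2 (by linarith) (by linarith) (by linarith) a3 c3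
    have hS : S T2 = S T1 + ∑ᶠ ρ ∈ {ρ : ℂ | RiemannR ρ = 0 ∧ U1 < ρ.im ∧ ρ.im ≤ U2}, (m ρ : ℝ) * ρ.re := by
      simp only [S]
      rw [← c4, ← a4, ← finsum_mem_union]
      · congr 1; ext ρ
        have : ρ ∈ zset U2 ↔ ρ ∈ zset U1 ∪ {ρ : ℂ | RiemannR ρ = 0 ∧ U1 < ρ.im ∧ ρ.im ≤ U2} := by
          constructor
          · rintro ⟨p1, p2, p3⟩
            rcases le_or_gt ρ.im U1 with h | h
            · exact Or.inl ⟨p1, p2, h⟩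
            · exact Or.inr ⟨p1, h, p3⟩
          · rintro (⟨p1, p2, p3⟩ | ⟨p1, p2, p3⟩)
            · exact ⟨p1, p2, by linarith⟩
            · exact ⟨p1, by linarith, p3⟩
        simp only [this]
      · rw [Set.disjoint_left]
        rintro ρ ⟨_, _, p⟩ ⟨_, q, _⟩
        linarith
      · exact zeros_fin U1
      · exact (zeros_fin U2).subset fun ρ h => ⟨h.1, by linarith [h.2.1], h.2.2⟩
    simp only [E]
    rw [hS]
    generalize (∑ᶠ ρ ∈ {ρ : ℂ | RiemannR ρ = 0 ∧ U1 < ρ.im ∧ ρ.im ≤ U2}, (m ρ : ℝ) * ρ.re) = Q at *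
    have q1 : |κ * ((T2 - T1) - (U2 - U1))| ≤ ε / 8 * T := by
      rw [abs_mul, abs_of_nonneg hκ0]
      have : |(T2 - T1) - (U2 - U1)| ≤ η := by rw [abs_le]; constructor <;> linarith
      calc _ ≤ 1 * η := by gcongr
        _ ≤ _ := by linarith
    have e : S T1 + Q + κ * T2 - (S T1 + κ * T1) = (Q + (U2 - U1) * κ) + κ * ((T2 - T1) - (U2 - U1)) := by ring
    rw [e]
    refine (abs_add_le _ _).trans ?_
    linarith
  have ind : ∀ n : ℕ, ∀ T, T0 ≤ T → T ≤ 2 ^ n * T0 → |E T| ≤ |E T0| + ε / 2 * T := by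
    intro n
    induction n with
    | zero =>
      intro T h1 h2
      have : T = T0 := by simp at h2; linarith
      rw [this]
      have : 0 ≤ ε / 2 * T0 := by have : 0 < T0 := by linarith
                                  positivity
      linarith
    | succ n ih =>
      intro T h1 h2
      rcases le_total T (2 * T0) with h | h
      · have := step T0 T0 T le_rfl le_rfl h1 h
        have h3 := abs_sub_abs_le_abs_sub (E T) (E T0)
        have h4 : ε / 4 * T0 ≤ ε / 2 * T := by gcongr <;> linarith
        linarith
      · have := step (T / 2) (T / 2) T (by linarith) le_rfl (by linarith) (by linarith)
        have h3 := abs_sub_abs_le_abs_sub (E T) (E (T / 2))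
        have h4 := ih (T / 2) (by linarith) (by rw [pow_succ] at h2; linarith)
        have : 0 ≤ ε * T := by have : 0 < T := by linarith
                               positivity
        linarith
  refine ⟨max T0 (2 * |E T0| / ε), fun T hT => ?_⟩
  have k1 : T0 ≤ T := (le_max_left _ _).trans hT
  have k2 : 2 * |E T0| / ε ≤ T := (le_max_right _ _).trans hT
  obtain ⟨n, hn⟩ := pow_unbounded_of_one_lt T (by norm_num : (1:ℝ) < 2)
  have h2n : (2:ℝ) ^ n ≤ 2 ^ n * T0 := le_mul_of_one_le_right (by positivity) hT0
  have := ind n T k1 (by linarith)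
  rw [div_le_iff₀ hε] at k2
  have e : -(∑ᶠ ρ ∈ zset T, (m ρ : ℝ) * ρ.re) - T / (4 * Real.pi) * Real.log 2 = -E T := by
    simp only [E, S]; rw [hκ]; ring
  rw [e, abs_neg]
  linarith

end Sg

end


/-- With `m` the multiplicity of each zero of `R`, and
`h(T) = − ∑_{0 < Im ρ ≤ T} m ρ · Re ρ` the sum over the zeros of `R` with
imaginary part in `(0, T]` counted with multiplicity, one has
`h(T) = (T/4π) log 2 + o(T)` as `T → +∞`. -/
theorem siegel_sum_re_zeros_asymptotic
    (m : ℂ → ℕ)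
    (hm : ∀ ρ : ℂ, RiemannR ρ = 0 →
      ∃ g : ℂ → ℂ, AnalyticAt ℂ g ρ ∧ g ρ ≠ 0 ∧
        ∀ᶠ s in nhds ρ, RiemannR s = (s - ρ) ^ (m ρ) * g s) :
    ∀ ε > (0 : ℝ), ∃ T₀ : ℝ, ∀ T ≥ T₀,
      |(-∑ᶠ ρ ∈ {ρ : ℂ | RiemannR ρ = 0 ∧ 0 < ρ.im ∧ ρ.im ≤ T},
          (m ρ : ℝ) * ρ.re) -
        T / (4 * Real.pi) * Real.log 2| ≤ ε * T := by
  exact Sg.main m hm
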